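/- Let g ≥ 2 and n ≥ 2. Then the Hitchin component HIT_n is Zariski-dense in Hom(Γ_g, SL_n(ℂ)): every polynomial P ∈ ℂ[x₁,…,x_{2g·n²}] that vanishes at every point of HIT_n (viewed inside ℂ^{2g·n²} via the inclusion ℝ^{2g·n²} ⊆ ℂ^{2g·n²}) vanishes at every point of Hom(Γ_g, SL_n(ℂ)). -/

import Mathlib

open Matrix MvPolynomial
open scoped commutatorElement

/-- `SL n K`: the special linear group of `n × n` matrices over `K`. -/
abbrev SL (n : ℕ) (K : Type) [CommRing K] := Matrix.SpecialLinearGroup (Fin n) K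

/-- Topology on `SL n ℝ` induced from the space of matrices (the Euclidean topology). -/
instance (n : ℕ) (K : Type) [CommRing K] [TopologicalSpace K] :
    TopologicalSpace (SL n K) :=
  TopologicalSpace.induced (fun A => (A : Matrix (Fin n) (Fin n) K)) inferInstance

/-- The relator `[a₁,b₁][a₂,b₂]⋯[a_g,b_g]` of the genus-`g` surface group;
`(i, false)` is the generator `aᵢ` and `(i, true)` is `bᵢ`. -/
def surfaceRelator (g : ℕ) : FreeGroup (Fin g × Bool) :=
  (List.ofFn fun i : Fin g =>
    ⁅FreeGroup.of (i, false), FreeGroup.of (i, true)⁆).prod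

/-- The surface group `Γ_g` of genus `g`. -/
abbrev SurfaceGroup (g : ℕ) : Type :=
  PresentedGroup ({surfaceRelator g} : Set (FreeGroup (Fin g × Bool)))

/-- The tuple `(ρ(a₁), ρ(b₁), …, ρ(a_g), ρ(b_g))` of matrices associated to a
representation `ρ : Γ_g → SL n ℝ`. -/
def repTuple {g n : ℕ} (ρ : SurfaceGroup g →* SL n ℝ) :
    (Fin g × Bool) → Matrix (Fin n) (Fin n) ℝ :=
  fun x => (ρ (PresentedGroup.of x) : Matrix (Fin n) (Fin n) ℝ)

/-- `Hom(Γ_g, SL_n(K))` as a subset of `K^{2g·n²}`: the `2g`-tuples of matrices of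
determinant one whose product of commutators is the identity. -/
def RepVariety (g n : ℕ) (K : Type) [CommRing K] :
    Set ((Fin g × Bool) → Matrix (Fin n) (Fin n) K) :=
  {A | (∀ x, (A x).det = 1) ∧
    (List.ofFn fun i : Fin g =>
      A (i, false) * A (i, true) * (A (i, false))⁻¹ * (A (i, true))⁻¹).prod = 1}

/-- `ρ₀ : Γ_g → SL₂(ℝ)` is discrete and faithful: injective with discrete image. -/
def IsDiscreteFaithful {g : ℕ} (ρ₀ : SurfaceGroup g →* SL 2 ℝ) : Prop :=
  Function.Injective ρ₀ ∧ DiscreteTopology (ρ₀.range : Subgroup (SL 2 ℝ))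

/-- `j : SL₂(ℝ) → SL_n(ℝ)` is a continuous homomorphism acting irreducibly on `ℝⁿ`. -/
def IsIrreducibleEmbedding (n : ℕ) (j : SL 2 ℝ →* SL n ℝ) : Prop :=
  Continuous j ∧
  ∀ W : Submodule ℝ (Fin n → ℝ),
    (∀ A : SL 2 ℝ, ∀ v ∈ W, (j A : Matrix (Fin n) (Fin n) ℝ).mulVec v ∈ W) →
    W = ⊥ ∨ W = ⊤

/-- A tuple in `ℝ^{2g·n²}` is a Teichmüller representation if it comes from `j ∘ ρ₀` with
`ρ₀` discrete and faithful and `j` continuous and irreducible. -/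
def IsTeichmuller (g n : ℕ) (T : (Fin g × Bool) → Matrix (Fin n) (Fin n) ℝ) : Prop :=
  ∃ (ρ₀ : SurfaceGroup g →* SL 2 ℝ) (j : SL 2 ℝ →* SL n ℝ),
    IsDiscreteFaithful ρ₀ ∧ IsIrreducibleEmbedding n j ∧
    T = repTuple (j.comp ρ₀)

/-- The Hitchin component: the connected component (Euclidean topology) of
`Hom(Γ_g, SL_n(ℝ))` containing the Teichmüller representation `T`. -/
def HIT (g n : ℕ) (T : (Fin g × Bool) → Matrix (Fin n) (Fin n) ℝ) :
    Set ((Fin g × Bool) → Matrix (Fin n) (Fin n) ℝ) :=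
  connectedComponentIn (RepVariety g n ℝ) T

/-- A subgroup `H ≤ SL_n(ℝ)` is Zariski-dense in `SL_n(ℝ)`. -/
def IsZariskiDense (n : ℕ) (H : Subgroup (SL n ℝ)) : Prop :=
  ∀ P : MvPolynomial (Fin n × Fin n) ℝ,
    (∀ h ∈ H, eval (fun p => (h : Matrix (Fin n) (Fin n) ℝ) p.1 p.2) P = 0) →
    ∀ A : SL n ℝ, eval (fun p => (A : Matrix (Fin n) (Fin n) ℝ) p.1 p.2) P = 0

/-- A subgroup `Γ ≤ SL_n(ℝ)` is strongly dense: every pair of noncommuting elements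
generates a Zariski-dense subgroup. -/
def IsStronglyDense (n : ℕ) (Γ : Subgroup (SL n ℝ)) : Prop :=
  ∀ x ∈ Γ, ∀ y ∈ Γ, x * y ≠ y * x → IsZariskiDense n (Subgroup.closure {x, y})

section PartG1
open Cardinal

theorem G1_step {k R : Type} [Field k] [CommRing R] [IsDomain R] [IsNoetherianRing R] [Algebra k R]
    (P : Ideal (Polynomial R)) [P.IsPrime] (d : ℕ)
    (h : ∀ p : Ideal R, p.IsPrime → ∃ a b : ℕ, d ≤ a + b ∧ (a : ℕ∞) ≤ p.height ∧
      (b : Cardinal) ≤ Algebra.trdeg k (R ⧸ p)) :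
    ∃ a b : ℕ, d + 1 ≤ a + b ∧ (a : ℕ∞) ≤ P.height ∧
      (b : Cardinal) ≤ Algebra.trdeg k (Polynomial R ⧸ P) := by
  set p := P.comap (Polynomial.C : R →+* Polynomial R) with hp
  have hpP : p.IsPrime := inferInstance
  obtain ⟨a, b, hd, ha, hb⟩ := h p hpP
  have hlo : P.LiesOver p := ⟨rfl⟩
  have hht := Ideal.height_eq_height_add_of_liesOver_of_hasGoingDown p P
  let φ : (R ⧸ p) →ₐ[k] (Polynomial R ⧸ P) := Ideal.quotientMapₐ P Polynomial.CAlgHom le_rfl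
  have hφ : Function.Injective φ := Ideal.quotientMap_injective
  by_cases hc : P = p.map Polynomial.C
  · refine ⟨a, b + 1, by omega, ?_, ?_⟩
    · rw [hht]; exact ha.trans le_self_add
    · let ψ : Polynomial (R ⧸ p) →ₐ[k] (Polynomial R ⧸ P) :=
        { Polynomial.eval₂RingHom φ.toRingHom (Ideal.Quotient.mk P Polynomial.X) with
          commutes' := fun c => by
            simp [Polynomial.algebraMap_apply] }
      have hψ : Function.Injective ψ := by
        rw [injective_iff_map_eq_zero]
        intro f hf
        obtain ⟨F, rfl⟩ := Polynomial.map_surjective _ Ideal.Quotient.mk_surjective f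
        have h1 : ψ (F.map (Ideal.Quotient.mk p)) = Ideal.Quotient.mk P F := by
          show Polynomial.eval₂ φ.toRingHom (Ideal.Quotient.mk P Polynomial.X)
            (F.map (Ideal.Quotient.mk p)) = _
          rw [Polynomial.eval₂_map]
          have : (φ.toRingHom.comp (Ideal.Quotient.mk p)) =
              (Ideal.Quotient.mk P).comp Polynomial.C := by
            ext x; rfl
          rw [this, ← Polynomial.hom_eval₂, Polynomial.eval₂_C_X]
        rw [h1, Ideal.Quotient.eq_zero_iff_mem, hc, Ideal.mem_map_C_iff] at hf
        ext i
        simpa [Ideal.Quotient.eq_zero_iff_mem] using hf i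
      have := trdeg_le_of_injective ψ hψ
      refine le_trans ?_ this
      have h2 : Algebra.trdeg k (R ⧸ p) + Algebra.trdeg (R ⧸ p) (Polynomial (R ⧸ p)) = _ :=
        trdeg_add_eq k (R ⧸ p)
      rw [← h2, Polynomial.trdeg_of_isDomain]
      push_cast
      gcongr
  · refine ⟨a + 1, b, by omega, ?_, hb.trans (trdeg_le_of_injective φ hφ)⟩
    rw [hht]
    push_cast
    have hle : p.map Polynomial.C ≤ P := Ideal.map_comap_le
    refine add_le_add ha ?_
    have hdom : IsDomain (Polynomial R ⧸ p.map (algebraMap R (Polynomial R))) := by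
      rw [Ideal.Quotient.isDomain_iff_prime]
      exact Ideal.isPrime_map_C_of_isPrime
    have hpr : (P.map (Ideal.Quotient.mk (p.map (algebraMap R (Polynomial R))))).IsPrime :=
      Ideal.map_isPrime_of_surjective Ideal.Quotient.mk_surjective (by
        rw [Ideal.mk_ker]; exact hle)
    rw [Order.one_le_iff_ne_zero]
    intro h0
    have h0' := Ideal.height_eq_zero_iff_eq_bot.mp h0
    rw [Ideal.map_eq_bot_iff_le_ker, Ideal.mk_ker] at h0'
    exact hc (le_antisymm h0' hle)

theorem G1_fin {k : Type} [Field k] (N : ℕ) (P : Ideal (MvPolynomial (Fin N) k)) [P.IsPrime] :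
    ∃ a b : ℕ, N ≤ a + b ∧ (a : ℕ∞) ≤ P.height ∧
      (b : Cardinal) ≤ Algebra.trdeg k (MvPolynomial (Fin N) k ⧸ P) := by
  induction N with
  | zero => exact ⟨0, 0, by simp⟩
  | succ N ih =>
    let e := (MvPolynomial.finSuccEquiv k N)
    let Q : Ideal (Polynomial (MvPolynomial (Fin N) k)) := P.comap e.symm.toRingEquiv
    have hQ : Q.IsPrime := inferInstance
    obtain ⟨a, b, h1, h2, h3⟩ := G1_step (k := k) Q N (fun p hp => ih p)
    refine ⟨a, b, h1, ?_, h3.trans ?_⟩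
    · have := RingEquiv.height_comap e.symm.toRingEquiv P
      exact h2.trans this.le
    · have hle : Q ≤ P.comap (e.symm.toAlgHom : _ →ₐ[k] _) := fun x hx => hx
      have hge : P.comap (e.symm.toAlgHom : _ →ₐ[k] _) ≤ Q := fun x hx => hx
      let ψ := Ideal.quotientMapₐ (I := Q) P e.symm.toAlgHom hle
      exact trdeg_le_of_injective ψ (Ideal.quotientMap_injective' (H := hle) (h := hge))

theorem G1_gen {k σ : Type} [Field k] [Fintype σ] (P : Ideal (MvPolynomial σ k)) [P.IsPrime] :
    ∃ a b : ℕ, Fintype.card σ ≤ a + b ∧ (a : ℕ∞) ≤ P.height ∧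
      (b : Cardinal) ≤ Algebra.trdeg k (MvPolynomial σ k ⧸ P) := by
  let e := (MvPolynomial.renameEquiv k (Fintype.equivFin σ))
  let Q : Ideal (MvPolynomial (Fin (Fintype.card σ)) k) := P.comap e.symm.toRingEquiv
  have hQ : Q.IsPrime := inferInstance
  obtain ⟨a, b, h1, h2, h3⟩ := G1_fin _ Q
  refine ⟨a, b, h1, ?_, h3.trans ?_⟩
  · have := RingEquiv.height_comap e.symm.toRingEquiv P
    exact h2.trans this.le
  · have hle : Q ≤ P.comap (e.symm.toAlgHom : _ →ₐ[k] _) := fun x hx => hx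
    have hge : P.comap (e.symm.toAlgHom : _ →ₐ[k] _) ≤ Q := fun x hx => hx
    let ψ := Ideal.quotientMapₐ (I := Q) P e.symm.toAlgHom hle
    exact trdeg_le_of_injective ψ (Ideal.quotientMap_injective' (H := hle) (h := hge))

/-- Krull: a minimal prime over `r` equations has transcendence degree at least `card σ - r`. -/
theorem G1_main {k σ : Type} [Field k] [Fintype σ] (s : Finset (MvPolynomial σ k))
    (P : Ideal (MvPolynomial σ k)) [P.IsPrime]
    (hP : P ∈ (Ideal.span (s : Set (MvPolynomial σ k))).minimalPrimes) :
    ((Fintype.card σ - s.card : ℕ) : Cardinal) ≤ Algebra.trdeg k (MvPolynomial σ k ⧸ P) := by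
  obtain ⟨a, b, h1, h2, h3⟩ := G1_gen P
  have h4 : P.height ≤ (s.card : ℕ∞) := by
    have := Ideal.height_le_card_of_mem_minimalPrimes_span_finset hP
    exact this
  have h5 : a ≤ s.card := by exact_mod_cast h2.trans h4
  refine le_trans ?_ h3
  exact_mod_cast (by omega : Fintype.card σ - s.card ≤ b)
end PartG1

section PartG2a
open TensorProduct

/-- Derivations with prescribed values on a transcendence basis. -/
theorem exists_derivation {k L : Type} {ι : Type} [Field k] [Field L] [Algebra k L] [CharZero L]
    (x : ι → L) (hx : IsTranscendenceBasis k x) (f : ι → L) :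
    ∃ D : Derivation k L L, ∀ i, D (x i) = f i := by
  let : Algebra (MvPolynomial ι k) L := (MvPolynomial.aeval x).toRingHom.toAlgebra
  have hmap : ∀ s : (MvPolynomial ι k), algebraMap (MvPolynomial ι k) L s = MvPolynomial.aeval x s := fun s => rfl
  have : IsScalarTower k (MvPolynomial ι k) L := IsScalarTower.of_algebraMap_eq (fun r => by
    rw [hmap, MvPolynomial.algebraMap_eq, MvPolynomial.aeval_C])
  have hinj : Function.Injective (algebraMap (MvPolynomial ι k) L) := hx.1
  have : FaithfulSMul (MvPolynomial ι k) L := (faithfulSMul_iff_algebraMap_injective (MvPolynomial ι k) L).mpr hinj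
  have halg : Algebra.IsAlgebraic (MvPolynomial ι k) L := by
    have := hx.isAlgebraic
    refine (Algebra.isAlgebraic_ringHom_iff_of_comp_eq (hx.1.aevalEquiv : (MvPolynomial ι k) ≃ₐ[k] _).toRingEquiv (RingEquiv.refl L) ?_).mp this
    ext s <;> simp [hmap]
  let : Algebra (FractionRing (MvPolynomial ι k)) L := FractionRing.liftAlgebra (MvPolynomial ι k) L
  have : IsScalarTower (MvPolynomial ι k) (FractionRing (MvPolynomial ι k)) L := FractionRing.isScalarTower_liftAlgebra (MvPolynomial ι k) L
  have : Algebra.IsAlgebraic (FractionRing (MvPolynomial ι k)) L :=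
    (IsFractionRing.comap_isAlgebraic_iff (A := (MvPolynomial ι k)) (K := FractionRing (MvPolynomial ι k)) (C := L)).mp halg
  have : CharZero (FractionRing (MvPolynomial ι k)) := (algebraMap (FractionRing (MvPolynomial ι k)) L).charZero
  have : Algebra.FormallyEtale (MvPolynomial ι k) (FractionRing (MvPolynomial ι k)) :=
    Algebra.FormallyEtale.of_isLocalization (nonZeroDivisors (MvPolynomial ι k))
  have : Algebra.FormallyEtale (FractionRing (MvPolynomial ι k)) L := Algebra.FormallyEtale.of_isSeparable _ _
  have : Algebra.FormallyEtale (MvPolynomial ι k) L := Algebra.FormallyEtale.comp (MvPolynomial ι k) (FractionRing (MvPolynomial ι k)) L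
  let D0 : Derivation k (MvPolynomial ι k) L := MvPolynomial.mkDerivation k f
  let φ : L ⊗[(MvPolynomial ι k)] (Ω[(MvPolynomial ι k)⁄k]) →ₗ[L] L := (D0.liftKaehlerDifferential).liftBaseChange L
  let ψ : Ω[L⁄k] →ₗ[L] L := φ ∘ₗ
    (KaehlerDifferential.tensorKaehlerEquivOfFormallyEtale k (MvPolynomial ι k) L).symm.toLinearMap
  refine ⟨ψ.compDer (KaehlerDifferential.D k L), fun i => ?_⟩
  have h1 : x i = algebraMap (MvPolynomial ι k) L (MvPolynomial.X i) := by rw [hmap]; simp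
  rw [h1]
  show φ ((KaehlerDifferential.tensorKaehlerEquivOfFormallyEtale k (MvPolynomial ι k) L).symm
    ((KaehlerDifferential.D k L) (algebraMap (MvPolynomial ι k) L (MvPolynomial.X i)))) = _
  rw [KaehlerDifferential.tensorKaehlerEquivOfFormallyEtale_symm_D_algebraMap]
  simp [φ, D0, LinearMap.liftBaseChange_tmul]
end PartG2a

section PartG2b
open AlgebraicIndependent in
/-- algebraic matroid -/
noncomputable abbrev AM (k L : Type) [Field k] [Field L] [Algebra k L] : Matroid L :=
  AlgebraicIndependent.matroid k L

/-- algebraic closure field of a set. -/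
noncomputable def clF (k : Type) {L : Type} [Field k] [Field L] [Algebra k L] (S : Set L) :
    IntermediateField k L where
  toSubalgebra := (Subalgebra.algebraicClosure (Algebra.adjoin k S) L).restrictScalars k
  inv_mem' x hx := by
    have : IsAlgebraic (Algebra.adjoin k S) x := hx
    exact this.inv

section
variable {k L : Type} [Field k] [Field L] [Algebra k L]

theorem coe_clF (S : Set L) : (clF k S : Set L) = (AM k L).closure S := by
  rw [AlgebraicIndependent.matroid_closure_eq]; rfl

theorem mem_clF_iff {S : Set L} {x : L} : x ∈ clF k S ↔ x ∈ (AM k L).closure S := by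
  rw [← coe_clF]; rfl

theorem subset_clF (S : Set L) : S ⊆ clF k S := by
  rw [coe_clF]; exact (AM k L).subset_closure S (Set.subset_univ _)

theorem mem_clF_of_pow_mem {S : Set L} {x : L} {n : ℕ} (hn : 0 < n) (h : x ^ n ∈ clF k S) :
    x ∈ clF k S := by
  have : IsAlgebraic (Algebra.adjoin k S) (x ^ n) := h
  exact this.of_pow hn

theorem eRk_le_of_subset_clF {S T : Set L} (h : S ⊆ clF k T) : (AM k L).eRk S ≤ (AM k L).eRk T := by
  rw [← (AM k L).eRk_closure_eq T, ← coe_clF]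
  exact (AM k L).eRk_mono h

theorem clF_le {S T : Set L} (h : S ⊆ clF k T) : clF k S ≤ clF k T := by
  intro x hx
  have h1 : x ∈ (AM k L).closure S := mem_clF_iff.mp hx
  rw [mem_clF_iff]
  have h2 := (AM k L).closure_subset_closure_of_subset_closure (X := S) (Y := T) (by
    rw [← coe_clF]; exact h)
  exact h2 h1

theorem deriv_zero_clF [CharZero L] {S : Set L} (D : Derivation k L L) (h : ∀ x ∈ S, D x = 0)
    {x : L} (hx : x ∈ clF k S) : D x = 0 := by
  let C : IntermediateField k L :=
    { carrier := {y | D y = 0}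
      mul_mem' := fun {a b} ha hb => by
        have ha : D a = 0 := ha
        have hb : D b = 0 := hb
        show D (a * b) = 0
        rw [D.leibniz, ha, hb]; simp
      one_mem' := D.map_one_eq_zero
      add_mem' := fun {a b} ha hb => by
        have ha : D a = 0 := ha
        have hb : D b = 0 := hb
        show D (a + b) = 0
        rw [map_add, ha, hb, add_zero]
      zero_mem' := map_zero D
      algebraMap_mem' := fun r => D.map_algebraMap r
      inv_mem' := fun a ha => by
        have ha : D a = 0 := ha
        show D a⁻¹ = 0
        rw [D.leibniz_inv, ha]; simp }
  have hC : Algebra.adjoin k S ≤ C.toSubalgebra := Algebra.adjoin_le (fun y hy => h y hy)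
  have hx' : IsAlgebraic (Algebra.adjoin k S) x := hx
  have hxC : IsAlgebraic C x := by
    obtain ⟨p, hp, hpx⟩ := hx'
    refine ⟨p.map (Subalgebra.inclusion hC).toRingHom, ?_, ?_⟩
    · exact (Polynomial.map_ne_zero_iff (Subalgebra.inclusion_injective hC)).mpr hp
    · rw [Polynomial.aeval_def] at hpx ⊢
      rw [Polynomial.eval₂_map]
      exact hpx
  let D' : Derivation C L L :=
    Derivation.mk'
      { toFun := D
        map_add' := map_add D
        map_smul' := fun c y => by
          have hc : D (c : L) = 0 := c.2
          show D ((c : L) * y) = (c : L) * D y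
          rw [D.leibniz, hc]; simp }
      (fun a b => D.leibniz a b)
  have hxint : IsIntegral C x := hxC.isIntegral
  have h3 := D'.map_aeval (minpoly C x) x
  rw [minpoly.aeval, map_zero] at h3
  have hsep : (minpoly C x).Separable := (minpoly.irreducible hxint).separable
  have h4 := hsep.aeval_derivative_ne_zero (minpoly.aeval C x)
  have h5 : D' x = 0 := by
    rcases smul_eq_zero.mp h3.symm with h | h
    · exact absurd h h4
    · exact h
  exact h5

theorem G2_core [CharZero L] {τ : Type} [Fintype τ] (S : Set L) (T : τ → L)
    (V : Submodule L (τ → L))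
    (hV : ∀ D : Derivation k L L, (∀ x ∈ S, D x = 0) → (fun t => D (T t)) ∈ V) :
    (AM k L).eRk (S ∪ Set.range T) ≤ (AM k L).eRk S + (Module.finrank L V : ℕ∞) := by
  classical
  obtain ⟨I, hI⟩ := (AM k L).exists_isBasis S (Set.subset_univ _)
  obtain ⟨J, hJ, hIJ⟩ := hI.indep.subset_isBasis_of_subset
    (X := I ∪ Set.range T) Set.subset_union_left (Set.subset_univ _)
  obtain ⟨B, hB, hJB⟩ := hJ.indep.exists_isBase_superset
  rw [← hI.eRk_eq_eRk_union, hJ.eRk_eq_encard, hI.eRk_eq_encard]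
  have hsub : J \ I ⊆ Set.range T := fun y hy => by
    rcases hJ.subset hy.1 with h | h
    · exact absurd h hy.2
    · exact h
  have hBt : IsTranscendenceBasis k ((↑) : B → L) := hB
  have hD : ∀ y : (J \ I : Set L), ∃ D : Derivation k L L, ∀ b : B, D b = if (b : L) = y then 1 else 0 :=
    fun y => exists_derivation _ hBt _
  choose D hD using hD
  have ht : ∀ y : (J \ I : Set L), ∃ t, T t = y := fun y => hsub y.2
  choose t ht using ht
  have hDS : ∀ y, ∀ x ∈ S, D y x = 0 := by
    intro y x hx
    have hx' : x ∈ clF k I := by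
      rw [mem_clF_iff]; exact hI.subset_closure hx
    refine deriv_zero_clF (D y) (fun z hz => ?_) hx'
    rw [hD y ⟨z, hJB (hIJ hz)⟩, if_neg]
    rintro h
    exact y.2.2 (h ▸ hz)
  let v : (J \ I : Set L) → V := fun y => ⟨fun s => D y (T s), hV _ (hDS y)⟩
  have hli : LinearIndependent L v := by
    rw [linearIndependent_iff']
    intro s c hc y hy
    have h1 : (((∑ i ∈ s, c i • v i : V) : τ → L)) (t y) = 0 := by rw [hc]; rfl
    rw [Submodule.coe_sum, Finset.sum_apply] at h1
    have h2 : ∀ i, ((c i • v i : V) : τ → L) (t y) = if i = y then c i else 0 := by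
      intro i
      show c i * D i (T (t y)) = _
      rw [ht y, hD i ⟨y, hJB y.2.1⟩]
      by_cases h : i = y
      · simp [h]
      · have : ¬ (y : L) = i := fun h' => h (Subtype.ext h'.symm)
        simp [h, this]
    simp_rw [h2] at h1
    simpa [hy] using h1
  have hfin : Finite (J \ I : Set L) := ((Set.finite_range T).subset hsub)
  have := Fintype.ofFinite (J \ I : Set L)
  have hcard := hli.fintype_card_le_finrank
  have hJ' : J = I ∪ (J \ I) := by rw [Set.union_sdiff_cancel hIJ]
  calc J.encard = (I ∪ (J \ I)).encard := by rw [← hJ']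
    _ ≤ I.encard + (J \ I).encard := Set.encard_union_le _ _
    _ ≤ _ := by
      gcongr
      rw [Set.encard, ENat.card_eq_coe_fintype_card]
      exact_mod_cast hcard
end
end PartG2b

section PartLin

section Lin
variable {K : Type} [Field K] {n : ℕ}
local notation "Mn" => Matrix (Fin n) (Fin n) K

/-- common centralizer -/
def Zc (A B : Mn) : Submodule K Mn where
  carrier := {Y | Y * A = A * Y ∧ Y * B = B * Y}
  add_mem' := fun {x y} hx hy => ⟨by rw [add_mul, mul_add, hx.1, hy.1], by rw [add_mul, mul_add, hx.2, hy.2]⟩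
  zero_mem' := by simp
  smul_mem' := fun c x hx => ⟨by rw [smul_mul_assoc, mul_smul_comm, hx.1], by rw [smul_mul_assoc, mul_smul_comm, hx.2]⟩

theorem mem_Zc {A B Y : Mn} : Y ∈ Zc A B ↔ Y * A = A * Y ∧ Y * B = B * Y := Iff.rfl

/-- matrix representing a functional through the trace form -/
noncomputable def repM : (Mn →ₗ[K] K) →ₗ[K] Mn where
  toFun φ := Matrix.of fun i j => φ (Matrix.single j i 1)
  map_add' φ ψ := by ext; simp
  map_smul' c φ := by ext; simp

theorem repM_spec (φ : Mn →ₗ[K] K) (M : Mn) : φ M = Matrix.trace (repM φ * M) := by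
  conv_lhs => rw [Matrix.matrix_eq_sum_single M]
  simp only [map_sum, Matrix.trace, Matrix.diag, Matrix.mul_apply, repM, LinearMap.coe_mk,
    AddHom.coe_mk, Matrix.of_apply]
  rw [Finset.sum_comm]
  refine Finset.sum_congr rfl fun i _ => Finset.sum_congr rfl fun j _ => ?_
  have : Matrix.single j i (M j i) = M j i • Matrix.single j i (1 : K) := by simp
  rw [this, map_smul, smul_eq_mul, mul_comm]

theorem Lin1 {A B Z X : Mn} (hA : IsUnit A) (hB : IsUnit B) (hZ : Z * B * A = A * B)
    (h1 : ∀ a, Matrix.trace (X * (a * B - Z * (B * a))) = 0)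
    (h2 : ∀ b, Matrix.trace (X * (A * b - Z * (b * A))) = 0) :
    X * A * B ∈ Zc A B := by
  have e1 : B * X = X * Z * B := by
    rw [Matrix.ext_iff_trace_mul_left]
    intro a
    have := h1 a
    rw [mul_sub, Matrix.trace_sub, sub_eq_zero] at this
    calc (a * (B * X)).trace = (X * (a * B)).trace := by
          rw [← mul_assoc, Matrix.trace_mul_comm]
      _ = _ := this
      _ = _ := by
        rw [Matrix.trace_mul_comm a]; simp only [mul_assoc]
  have e2 : X * A = A * X * Z := by
    rw [Matrix.ext_iff_trace_mul_left]
    intro b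
    have := h2 b
    rw [mul_sub, Matrix.trace_sub, sub_eq_zero] at this
    calc (b * (X * A)).trace = (X * (A * b)).trace := by
          rw [Matrix.trace_mul_comm b, mul_assoc]
      _ = _ := this
      _ = (X * Z * b * A).trace := by simp only [mul_assoc]
      _ = _ := by
        rw [Matrix.trace_mul_comm _ A, Matrix.trace_mul_comm b]; simp only [mul_assoc]
  have e3 : B * X * A = X * A * B := by
    rw [e1, mul_assoc X A B, ← hZ]; simp only [mul_assoc]
  constructor
  · calc X * A * B * A = A * X * Z * B * A := by rw [e2]
      _ = A * X * (Z * B * A) := by simp only [mul_assoc]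
      _ = _ := by rw [hZ]; simp only [mul_assoc]
  · rw [← e3]
    have : B * (B * X * A) = B * (X * A * B) := by rw [e3]
    rw [this]; simp only [mul_assoc]

/-- The differential of the handle equation. -/
noncomputable def TD (A B Z : Mn) : (Mn × Mn) →ₗ[K] Mn × K × K where
  toFun p := (p.1 * B + A * p.2 - Z * (p.2 * A + B * p.1), Matrix.trace (A⁻¹ * p.1), Matrix.trace (B⁻¹ * p.2))
  map_add' p q := by
    refine Prod.ext ?_ (Prod.ext ?_ ?_)
    · simp only [Prod.fst_add, Prod.snd_add]; noncomm_ring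
    · simp [mul_add]
    · simp [mul_add]
  map_smul' c p := by
    refine Prod.ext ?_ (Prod.ext ?_ ?_)
    · simp only [Prod.smul_fst, Prod.smul_snd, RingHom.id_apply, smul_mul_assoc, mul_smul_comm,
        ← smul_add, ← smul_sub]
    · simp
    · simp

theorem TD_ann {A B Z : Mn} (hA : IsUnit A) (hB : IsUnit B) (hZ : Z * B * A = A * B)
    (hn : (n : K) ≠ 0) (φ : Mn →ₗ[K] K) (μ ν : K)
    (h : ∀ p, φ (TD A B Z p).1 + μ * (TD A B Z p).2.1 + ν * (TD A B Z p).2.2 = 0) :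
    μ = 0 ∧ ν = 0 ∧ repM φ * A * B ∈ Zc A B := by
  have hA' := (Matrix.isUnit_iff_isUnit_det A).mp hA
  have hB' := (Matrix.isUnit_iff_isUnit_det B).mp hB
  have hμ : μ = 0 := by
    have := h (A, 0)
    simp only [TD, LinearMap.coe_mk, AddHom.coe_mk, mul_zero, zero_mul, add_zero, zero_add,
      ← mul_assoc, hZ, sub_self, map_zero, Matrix.nonsing_inv_mul A hA', Matrix.trace_one,
      Matrix.trace_zero, Fintype.card_fin] at this
    simpa [hn] using this
  have hν : ν = 0 := by
    have := h (0, B)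
    simp only [TD, LinearMap.coe_mk, AddHom.coe_mk, mul_zero, zero_mul, add_zero, zero_add,
      ← mul_assoc, hZ, sub_self, map_zero, Matrix.nonsing_inv_mul B hB', Matrix.trace_one,
      Matrix.trace_zero, Fintype.card_fin] at this
    simpa [hn] using this
  refine ⟨hμ, hν, Lin1 hA hB hZ (fun a => ?_) (fun b => ?_)⟩
  · have := h (a, 0)
    rw [hμ, hν, zero_mul, zero_mul, add_zero, add_zero, repM_spec] at this
    simpa [TD] using this
  · have := h (0, b)
    rw [hμ, hν, zero_mul, zero_mul, add_zero, add_zero, repM_spec] at this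
    simpa [TD] using this

theorem repM_injective : Function.Injective (repM : (Mn →ₗ[K] K) →ₗ[K] Mn) := by
  rw [injective_iff_map_eq_zero]
  intro φ h
  ext1 M
  rw [repM_spec, h]; simp

theorem finrank_TD_ker {A B Z : Mn} (hA : IsUnit A) (hB : IsUnit B) (hZ : Z * B * A = A * B)
    (hn : (n : K) ≠ 0) :
    Module.finrank K (LinearMap.ker (TD A B Z)) + 2 ≤ n ^ 2 + Module.finrank K (Zc A B) := by
  set T := TD A B Z with hT
  let W := LinearMap.range T
  have h1 := Subspace.finrank_add_finrank_dualAnnihilator_eq W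
  have h2 := LinearMap.finrank_range_add_finrank_ker T
  have hd : Module.finrank K (Mn × Mn) = n ^ 2 + n ^ 2 := by
    simp [Module.finrank_matrix, sq]
  have hd2 : Module.finrank K (Mn × K × K) = n ^ 2 + 2 := by
    simp [Module.finrank_matrix, sq]
  rw [hd] at h2
  have h1' : Module.finrank K W + Module.finrank K W.dualAnnihilator = n ^ 2 + 2 := h1.trans hd2
  have h2' : Module.finrank K W + Module.finrank K (LinearMap.ker T) = n ^ 2 + n ^ 2 := h2
  have h3 : Module.finrank K W.dualAnnihilator ≤ Module.finrank K (Zc A B) := by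
    have key : ∀ f ∈ W.dualAnnihilator, f ∘ₗ LinearMap.inr K Mn (K × K) = 0 ∧
        repM (f ∘ₗ LinearMap.inl K Mn (K × K)) * A * B ∈ Zc A B := by
      intro f hf
      rw [Submodule.mem_dualAnnihilator] at hf
      have hdec : ∀ q : Mn × K × K, f q = f (q.1, 0) + q.2.1 * f (0, (1, 0)) + q.2.2 * f (0, (0, 1)) := by
        intro q
        have : q = (q.1, 0) + q.2.1 • ((0 : Mn), ((1 : K), (0 : K))) + q.2.2 • ((0 : Mn), ((0 : K), (1 : K))) := by
          refine Prod.ext ?_ (Prod.ext ?_ ?_) <;> simp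
        conv_lhs => rw [this]
        simp only [map_add, map_smul, smul_eq_mul]
      obtain ⟨a, b, c⟩ := TD_ann hA hB hZ hn (f ∘ₗ LinearMap.inl K Mn (K × K)) (f (0, (1, 0))) (f (0, (0, 1)))
        (fun p => by
          have := hf (T p) ⟨p, rfl⟩
          rw [hdec] at this
          rw [← hT, mul_comm (f _), mul_comm (f _)]
          exact this)
      refine ⟨?_, c⟩
      ext
      · simp [a]
      · simp [b]
    let ψ : W.dualAnnihilator →ₗ[K] Zc A B :=
      { toFun := fun f => ⟨repM (f.1 ∘ₗ LinearMap.inl K Mn (K × K)) * A * B, (key f.1 f.2).2⟩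
        map_add' := fun f g => by
          ext1
          show repM ((f.1 + g.1) ∘ₗ LinearMap.inl K Mn (K × K)) * A * B = _
          rw [LinearMap.add_comp, map_add, add_mul, add_mul]; rfl
        map_smul' := fun c f => by
          ext1
          show repM ((c • f.1) ∘ₗ LinearMap.inl K Mn (K × K)) * A * B = _
          rw [LinearMap.smul_comp, map_smul, smul_mul_assoc, smul_mul_assoc]; rfl }
    refine LinearMap.finrank_le_finrank_of_injective (f := ψ) ?_
    rw [injective_iff_map_eq_zero]
    intro f hf
    have h4 : repM (f.1 ∘ₗ LinearMap.inl K Mn (K × K)) * A * B = 0 := congrArg Subtype.val hf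
    have h5 : repM (f.1 ∘ₗ LinearMap.inl K Mn (K × K)) = 0 :=
      (hA.mul_left_eq_zero).mp ((hB.mul_left_eq_zero).mp h4)
    have h6 : f.1 ∘ₗ LinearMap.inl K Mn (K × K) = 0 := repM_injective (by rw [h5, map_zero])
    ext1
    exact LinearMap.prod_ext h6 (key f.1 f.2).1
  clear h1 h2 hd hd2
  omega

/-- version with scaling parameter, surjective for trivial centralizer -/
noncomputable def TS (A B Z : Mn) : (Mn × Mn × K) →ₗ[K] Mn × K × K where
  toFun p := (p.1 * B + A * p.2.1 + p.2.2 • (A * B) - Z * (p.2.1 * A + B * p.1),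
    Matrix.trace (A⁻¹ * p.1), Matrix.trace (B⁻¹ * p.2.1))
  map_add' p q := by
    refine Prod.ext ?_ (Prod.ext ?_ ?_)
    · simp only [Prod.fst_add, Prod.snd_add, add_smul]; noncomm_ring
    · simp [mul_add]
    · simp [mul_add]
  map_smul' c p := by
    refine Prod.ext ?_ (Prod.ext ?_ ?_)
    · simp only [Prod.smul_fst, Prod.smul_snd, RingHom.id_apply, smul_mul_assoc, mul_smul_comm,
        ← smul_add, ← smul_sub, smul_assoc]
    · simp
    · simp

theorem TS_surj {A B Z : Mn} (hA : IsUnit A) (hB : IsUnit B) (hZ : Z * B * A = A * B)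
    (hn : (n : K) ≠ 0) (hc : ∀ Y ∈ Zc A B, ∃ c : K, Y = c • 1) :
    LinearMap.range (TS A B Z) = ⊤ := by
  by_contra hne
  obtain ⟨f, hf0, hf⟩ := Submodule.exists_dual_map_eq_bot_of_lt_top (lt_top_iff_ne_top.mpr hne) inferInstance
  have hf' : ∀ p, f (TS A B Z p) = 0 := by
    intro p
    have : f (TS A B Z p) ∈ (LinearMap.range (TS A B Z)).map f := ⟨_, ⟨p, rfl⟩, rfl⟩
    rw [hf] at this
    exact this
  apply hf0
  have hdec : ∀ q : Mn × K × K, f q = f (q.1, 0) + q.2.1 * f (0, (1, 0)) + q.2.2 * f (0, (0, 1)) := by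
    intro q
    have : q = (q.1, 0) + q.2.1 • ((0 : Mn), ((1 : K), (0 : K))) + q.2.2 • ((0 : Mn), ((0 : K), (1 : K))) := by
      refine Prod.ext ?_ (Prod.ext ?_ ?_) <;> simp
    conv_lhs => rw [this]
    simp only [map_add, map_smul, smul_eq_mul]
  obtain ⟨a, b, c⟩ := TD_ann hA hB hZ hn (f ∘ₗ LinearMap.inl K Mn (K × K)) (f (0, (1, 0))) (f (0, (0, 1)))
    (fun p => by
      have := hf' (p.1, p.2, 0)
      rw [hdec] at this
      rw [mul_comm (f _), mul_comm (f _)]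
      simpa [TS, TD] using this)
  obtain ⟨c, hc⟩ := hc _ c
  have h1 := hf' (0, 0, 1)
  rw [hdec, a, b] at h1
  have h2 : (f ∘ₗ LinearMap.inl K Mn (K × K)) (A * B) = 0 := by
    simpa [TS] using h1
  rw [repM_spec, ← mul_assoc, hc] at h2
  have hc0 : c = 0 := by
    simpa [hn] using h2
  rw [hc0, zero_smul] at hc
  have h5 : repM (f ∘ₗ LinearMap.inl K Mn (K × K)) = 0 :=
    (hA.mul_left_eq_zero).mp ((hB.mul_left_eq_zero).mp hc)
  have h6 : f ∘ₗ LinearMap.inl K Mn (K × K) = 0 := repM_injective (by rw [h5, map_zero])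
  refine LinearMap.prod_ext (h6.trans (by simp)) ?_
  ext
  · simp [a]
  · simp [b]
end Lin
end PartLin

section PartG3

section G3
open Module

/-- kernels of matrices over a subfield are spanned by vectors over the subfield -/
theorem KL {k Ω : Type} [Field k] [Field Ω] [Algebra k Ω] (F : IntermediateField k Ω) {ι κ : Type}
    [Fintype κ] (M : ι → κ → F) (v : κ → Ω) (hv : ∀ i, ∑ j, (M i j : Ω) * v j = 0) :
    v ∈ Submodule.span Ω {w : κ → Ω | (∀ j, w j ∈ F) ∧ ∀ i, ∑ j, (M i j : Ω) * w j = 0} := by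
  classical
  let b := Module.Basis.ofVectorSpace F Ω
  let s : Finset _ := Finset.univ.biUnion fun j : κ => (b.repr (v j)).support
  have hvj : ∀ j, v j = ∑ β ∈ s, ((b.repr (v j) β : F) : Ω) * b β := by
    intro j
    conv_lhs => rw [← b.linearCombination_repr (v j)]
    rw [Finsupp.linearCombination_apply, Finsupp.sum_of_support_subset (s := s)]
    · rfl
    · intro x hx
      exact Finset.mem_biUnion.mpr ⟨j, Finset.mem_univ _, hx⟩
    · intros; simp
  have hv2 : v = ∑ β ∈ s, b β • (fun j => ((b.repr (v j) β : F) : Ω)) := by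
    ext j
    rw [hvj j, Finset.sum_apply]
    refine Finset.sum_congr rfl fun β _ => ?_
    simp [mul_comm]
  rw [hv2]
  refine Submodule.sum_mem _ fun β _ => Submodule.smul_mem _ _ (Submodule.subset_span ⟨fun j => (b.repr (v j) β).2, fun i => ?_⟩)
  have h0 : ∑ j, M i j • v j = 0 := hv i
  have h1 := congrArg (fun x => b.repr x β) h0
  simp only [map_sum, map_smul, map_zero, Finsupp.coe_zero, Pi.zero_apply, Finsupp.coe_finset_sum,
    Finset.sum_apply, Finsupp.smul_apply, smul_eq_mul] at h1
  have h2 := congrArg (fun x : F => (x : Ω)) h1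
  simpa using h2

variable {k Ω : Type} [Field k] [Field Ω] [Algebra k Ω] {n : ℕ}
local notation "Mn" => Matrix (Fin n) (Fin n) Ω

theorem Zc_basis (F : IntermediateField k Ω) (A B : Mn) (hA : ∀ i j, A i j ∈ F) (hB : ∀ i j, B i j ∈ F) :
    ∃ X : Fin (finrank Ω (Zc A B)) → Mn, (∀ l i j, X l i j ∈ F) ∧ LinearIndependent Ω X ∧
      Submodule.span Ω (Set.range X) = Zc A B := by
  classical
  let s : Set Mn := {Y | (∀ i j, Y i j ∈ F) ∧ Y ∈ Zc A B}
  have hs : Submodule.span Ω s = Zc A B := by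
    refine le_antisymm (Submodule.span_le.mpr fun Y hY => hY.2) fun Y hY => ?_
    -- coefficient matrix
    let c : (Fin 2 × Fin n × Fin n) → (Fin n × Fin n) → F := fun x y =>
      let C : Matrix (Fin n) (Fin n) F := if x.1 = 0 then Matrix.of fun i j => ⟨A i j, hA i j⟩ else Matrix.of fun i j => ⟨B i j, hB i j⟩
      (if y.1 = x.2.1 then C y.2 x.2.2 else 0) - (if y.2 = x.2.2 then C x.2.1 y.1 else 0)
    have hsum : ∀ (x : Fin 2 × Fin n × Fin n) (w : Fin n × Fin n → Ω),
        ∑ y, ((c x y : F) : Ω) * w y = 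
         ((Matrix.of fun i j => w (i, j)) * (if x.1 = 0 then A else B) - (if x.1 = 0 then A else B) * (Matrix.of fun i j => w (i, j)) : Mn) x.2.1 x.2.2 := by
      intro x w
      obtain ⟨x1, i, j⟩ := x
      rw [Fintype.sum_prod_type, Matrix.sub_apply, Matrix.mul_apply, Matrix.mul_apply]
      by_cases hx : x1 = 0
      · simp [c, hx, sub_mul, Finset.sum_sub_distrib, mul_comm, apply_ite (fun z : F => (z : Ω)), Finset.sum_ite_eq]
      · simp [c, hx, sub_mul, Finset.sum_sub_distrib, mul_comm, apply_ite (fun z : F => (z : Ω)), Finset.sum_ite_eq]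
    have hiff : ∀ w : Fin n × Fin n → Ω, (∀ x, ∑ y, ((c x y : F) : Ω) * w y = 0) ↔ (Matrix.of fun i j => w (i, j)) ∈ Zc A B := by
      intro w
      simp only [hsum]
      rw [mem_Zc]
      constructor
      · intro h
        refine ⟨sub_eq_zero.mp (Matrix.ext fun i j => ?_), sub_eq_zero.mp (Matrix.ext fun i j => ?_)⟩
        · simpa using h (0, i, j)
        · simpa using h (1, i, j)
      · rintro ⟨h1, h2⟩ ⟨x, i, j⟩
        by_cases hx : x = 0
        · simp [hx, h1]
        · simp [hx, h2]
    have := KL F c (fun y => Y y.1 y.2) ((hiff _).mpr hY)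
    let e : (Fin n × Fin n → Ω) →ₗ[Ω] Mn :=
      { toFun := fun w => Matrix.of fun i j => w (i, j)
        map_add' := fun _ _ => rfl
        map_smul' := fun _ _ => rfl }
    have h2 := Submodule.mem_map_of_mem (f := e) this
    rw [Submodule.map_span] at h2
    have h3 : e (fun y => Y y.1 y.2) = Y := rfl
    rw [h3] at h2
    refine Submodule.span_mono ?_ h2
    rintro _ ⟨w, hw, rfl⟩
    exact ⟨fun i j => hw.1 _, (hiff w).mp hw.2⟩
  have hf := Submodule.exists_fun_fin_finrank_span_eq Ω s
  rw [hs] at hf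
  obtain ⟨f, h1, h2, h3⟩ := hf
  exact ⟨f, fun l => (h1 l).1, h3, h2⟩

/-- intertwiner spaces -/
def Itw {M V : Type} [AddCommGroup M] [Module Ω M] [AddCommGroup V] [Module Ω V] (g : M →ₗ[Ω] M) (f : V →ₗ[Ω] V) :
    Submodule Ω (M →ₗ[Ω] V) where
  carrier := {Y | Y ∘ₗ g = f ∘ₗ Y}
  add_mem' := fun {x y} hx hy => by
    have hx : x ∘ₗ g = f ∘ₗ x := hx
    have hy : y ∘ₗ g = f ∘ₗ y := hy
    show (x + y) ∘ₗ g = f ∘ₗ (x + y)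
    rw [LinearMap.add_comp, LinearMap.comp_add, hx, hy]
  zero_mem' := by simp
  smul_mem' := fun c x hx => by
    have hx : x ∘ₗ g = f ∘ₗ x := hx
    show (c • x) ∘ₗ g = f ∘ₗ (c • x)
    rw [LinearMap.smul_comp, LinearMap.comp_smul, hx]

theorem Itw_finrank [IsAlgClosed Ω] {V : Type} [AddCommGroup V] [Module Ω V] [FiniteDimensional Ω V]
    (f : V →ₗ[Ω] V) (d : ℕ) (hd : ∀ c : Ω, finrank Ω (LinearMap.ker (f - c • LinearMap.id)) ≤ d) :
    ∀ (r : ℕ) (M : Type) [AddCommGroup M] [Module Ω M] [FiniteDimensional Ω M] (_ : finrank Ω M = r)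
      (g : M →ₗ[Ω] M), finrank Ω (Itw g f) ≤ r * d := by
  intro r
  induction r with
  | zero =>
    intro M _ _ _ hM g
    have : Subsingleton M := finrank_zero_iff.mp hM
    have : Subsingleton (M →ₗ[Ω] V) := ⟨fun a b => by ext x; rw [Subsingleton.elim x 0]; simp⟩
    have : Subsingleton (Itw g f) := inferInstance
    rw [finrank_zero_of_subsingleton]; simp
  | succ r ih =>
    intro M _ _ _ hM g
    have : Nontrivial M := nontrivial_of_finrank_pos (R := Ω) (by omega)
    obtain ⟨c, hc⟩ := Module.End.exists_eigenvalue (K := Ω) (V := M) g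
    obtain ⟨m, hm⟩ := hc.exists_hasEigenvector
    have hgm : g m = c • m := hm.apply_eq_smul
    have hm0 : m ≠ 0 := hm.2
    let P : Submodule Ω M := Submodule.span Ω {m}
    have hP : P ≤ P.comap g := by
      rw [Submodule.span_le]
      rintro x rfl
      show g x ∈ P
      rw [hgm]
      exact Submodule.smul_mem _ _ (Submodule.mem_span_singleton_self x)
    let ev : Itw g f →ₗ[Ω] LinearMap.ker (f - c • LinearMap.id) :=
      { toFun := fun Y => ⟨Y.1 m, by
          have hY : Y.1 ∘ₗ g = f ∘ₗ Y.1 := Y.2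
          have := LinearMap.congr_fun hY m
          simp only [LinearMap.comp_apply, hgm, map_smul] at this
          simp [← this]⟩
        map_add' := fun _ _ => rfl
        map_smul' := fun _ _ => rfl }
    have h1 := LinearMap.finrank_range_add_finrank_ker ev
    have h2 : finrank Ω (LinearMap.range ev) ≤ d := (Submodule.finrank_le _).trans (hd c)
    have hq : finrank Ω (M ⧸ P) = r := by
      have := Submodule.finrank_quotient_add_finrank P
      have h3 : finrank Ω P = 1 := finrank_span_singleton hm0
      omega
    have h3 := ih (M ⧸ P) hq (P.mapQ P g hP)
    have h4 : finrank Ω (LinearMap.ker ev) ≤ finrank Ω (Itw (P.mapQ P g hP) f) := by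
      have hk : ∀ Y : LinearMap.ker ev, P ≤ LinearMap.ker Y.1.1 := by
        intro Y
        rw [Submodule.span_le]
        rintro x rfl
        exact congrArg Subtype.val (LinearMap.mem_ker.mp Y.2)
      let φ : LinearMap.ker ev →ₗ[Ω] Itw (P.mapQ P g hP) f :=
        { toFun := fun Y => ⟨P.liftQ Y.1.1 (hk Y), by
            show (P.liftQ Y.1.1 (hk Y)) ∘ₗ (P.mapQ P g hP) = f ∘ₗ (P.liftQ Y.1.1 (hk Y))
            ext x
            exact LinearMap.congr_fun (show Y.1.1 ∘ₗ g = f ∘ₗ Y.1.1 from Y.1.2) x⟩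
          map_add' := fun X Y => by
            ext1; apply Submodule.linearMap_qext; ext x; rfl
          map_smul' := fun c Y => by
            ext1; apply Submodule.linearMap_qext; ext x; rfl }
      refine LinearMap.finrank_le_finrank_of_injective (f := φ) ?_
      rw [injective_iff_map_eq_zero]
      intro Y hY
      ext x
      have := LinearMap.congr_fun (congrArg Subtype.val hY) (P.mkQ x)
      exact this
    rw [Nat.add_mul]
    omega

theorem Zc_self_finrank [IsAlgClosed Ω] (X : Mn) (r : ℕ) (hr : ∀ c : Ω, r ≤ (X - c • (1 : Mn)).rank) :
    finrank Ω (Zc X X) ≤ n * (n - r) := by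
  have hd : ∀ c : Ω, finrank Ω (LinearMap.ker (Matrix.toLin' X - c • LinearMap.id)) ≤ n - r := by
    intro c
    have h1 := LinearMap.finrank_range_add_finrank_ker (Matrix.toLin' X - c • LinearMap.id)
    have h2 := hr c
    have h3 : Matrix.toLin' X - c • LinearMap.id = Matrix.toLin' (X - c • (1 : Mn)) := by
      simp
    rw [h3] at h1 ⊢
    rw [Matrix.rank, ← Matrix.toLin'_apply'] at h2
    simp only [finrank_fintype_fun_eq_card, Fintype.card_fin] at h1
    omega
  have := Itw_finrank (Matrix.toLin' X) (n - r) hd n (Fin n → Ω) (by simp) (Matrix.toLin' X)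
  refine le_trans ?_ this
  let φ : Zc X X →ₗ[Ω] Itw (Matrix.toLin' X) (Matrix.toLin' X) :=
    { toFun := fun Y => ⟨Matrix.toLin' Y.1, by
        show Matrix.toLin' Y.1 ∘ₗ Matrix.toLin' X = Matrix.toLin' X ∘ₗ Matrix.toLin' Y.1
        rw [← Matrix.toLin'_mul, ← Matrix.toLin'_mul, (mem_Zc.mp Y.2).1]⟩
      map_add' := fun a b => by ext1; simp
      map_smul' := fun a b => by ext1; simp }
  refine LinearMap.finrank_le_finrank_of_injective (f := φ) ?_
  intro a b h
  ext1
  exact Matrix.toLin'.injective (congrArg Subtype.val h)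

/-- entries -/
def ent (A : Mn) : Set Ω := Set.range fun p : Fin n × Fin n => A p.1 p.2

theorem ent_mem (A : Mn) (i j) : A i j ∈ ent A := ⟨(i, j), rfl⟩

theorem ent_subset {A : Mn} {F : Set Ω} : ent A ⊆ F ↔ ∀ i j, A i j ∈ F := by
  constructor
  · intro h i j; exact h (ent_mem A i j)
  · rintro h _ ⟨p, rfl⟩; exact h _ _

theorem rank_param (X : Mn) (c : Ω) (r : ℕ) (hr : (X - c • (1 : Mn)).rank = r) :
    (AM k Ω).eRk (ent X) ≤ ((1 + r * n + (n - r) * r : ℕ) : ℕ∞) := by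
  classical
  set N := X - c • (1 : Mn) with hN
  have hspan := Submodule.exists_fun_fin_finrank_span_eq Ω (Set.range N.row)
  rw [← Matrix.rank_eq_finrank_span_row, hr] at hspan
  obtain ⟨f, hf, hs, hli⟩ := hspan
  choose e he using hf
  have heinj : Function.Injective e := by
    intro a b hab
    apply hli.injective
    rw [← he, ← he, hab]
  have hrow : ∀ i, ∃ α : Fin r → Ω, ∑ l, α l • f l = N.row i := by
    intro i
    have : N.row i ∈ Submodule.span Ω (Set.range f) := by
      rw [hs]; exact Submodule.subset_span ⟨i, rfl⟩
    exact (Submodule.mem_span_range_iff_exists_fun Ω).mp this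
  choose α hα using hrow
  let J : Set (Fin n) := (Set.range e)ᶜ
  let G : Set Ω := {c} ∪ (Set.range (fun p : Fin r × Fin n => N (e p.1) p.2)) ∪ 
    ((fun p : Fin n × Fin r => α p.1 p.2) '' (J ×ˢ Set.univ))
  have hG : G.encard ≤ ((1 + r * n + (n - r) * r : ℕ) : ℕ∞) := by
    refine (Set.encard_union_le _ _).trans ?_
    push_cast
    refine add_le_add ((Set.encard_union_le _ _).trans (add_le_add ?_ ?_)) ?_
    · simp
    · rw [← Set.image_univ]
      refine (Set.encard_image_le _ _).trans ?_
      rw [Set.encard_univ]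
      simp
    · refine (Set.encard_image_le _ _).trans ?_
      rw [Set.encard_prod, Set.encard_univ]
      have hJ : J.encard = ((n - r : ℕ) : ℕ∞) := by
        have h1 : J = ((Finset.univ.image e)ᶜ : Finset (Fin n)) := by
          ext x; simp [J]
        rw [h1, Set.encard_coe_eq_coe_finsetCard, Finset.card_compl, Finset.card_image_of_injective _ heinj]
        simp
      rw [hJ]
      simp
  refine le_trans ?_ (((AM k Ω).eRk_le_encard G).trans hG)
  apply eRk_le_of_subset_clF
  have hsub := subset_clF (k := k) G
  have hc : c ∈ clF k G := hsub (Or.inl (Or.inl rfl))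
  have hNe : ∀ l j, N (e l) j ∈ clF k G := fun l j => hsub (Or.inl (Or.inr ⟨(l, j), rfl⟩))
  have hNall : ∀ i j, N i j ∈ clF k G := by
    intro i j
    by_cases hi : i ∈ Set.range e
    · obtain ⟨l, rfl⟩ := hi
      exact hNe l j
    · have h1 := congrFun (hα i) j
      rw [Finset.sum_apply] at h1
      have h2 : N i j = ∑ l, α i l * N (e l) j := by
        refine Eq.trans (show N i j = N.row i j from rfl) (h1.symm.trans ?_)
        refine Finset.sum_congr rfl fun l _ => ?_
        rw [Pi.smul_apply, smul_eq_mul, ← he l]; rfl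
      rw [h2]
      exact sum_mem fun l _ => mul_mem (hsub (Or.inr ⟨(i, l), ⟨hi, trivial⟩, rfl⟩)) (hNe l j)
  rw [ent_subset]
  intro i j
  have : X i j = N i j + c * (1 : Mn) i j := by simp [hN]
  rw [this]
  refine add_mem (hNall i j) (mul_mem hc ?_)
  rw [Matrix.one_apply]
  split_ifs
  · exact one_mem _
  · exact zero_mem _

theorem ratio_lemma (hn : 0 < n) (X A : Mn) (z : ℕ) (Y : Fin z → Mn) (hY : ∀ l i j, Y l i j ∈ clF k (ent X))
    (hA : A ∈ Submodule.span Ω (Set.range Y)) (hdet : A.det = 1) :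
    ∃ R : Set Ω, R.encard ≤ ((z - 1 : ℕ) : ℕ∞) ∧ ent A ⊆ clF k (ent X ∪ R) := by
  classical
  obtain ⟨α, hα⟩ := (Submodule.mem_span_range_iff_exists_fun Ω).mp hA
  have hne : ∃ l0, α l0 ≠ 0 := by
    by_contra h
    push Not at h
    have : A = 0 := by rw [← hα]; simp [h]
    rw [this] at hdet
    have : Nonempty (Fin n) := ⟨⟨0, hn⟩⟩
    rw [Matrix.det_zero] at hdet
    exact zero_ne_one hdet
  obtain ⟨l0, hl0⟩ := hne
  let R : Set Ω := (fun l => α l / α l0) '' {l0}ᶜ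
  refine ⟨R, ?_, ?_⟩
  · refine (Set.encard_image_le _ _).trans ?_
    have : (({l0}ᶜ : Set (Fin z))) = (({l0}ᶜ : Finset (Fin z)) : Set (Fin z)) := by simp
    rw [this, Set.encard_coe_eq_coe_finsetCard, Finset.card_compl]
    simp
  · set F := clF k (ent X ∪ R) with hF
    have hsub := subset_clF (k := k) (ent X ∪ R)
    have hle : clF k (ent X) ≤ F := clF_le (Set.subset_union_left.trans hsub)
    have hrat : ∀ l, α l / α l0 ∈ F := by
      intro l
      by_cases hl : l = l0
      · rw [hl, div_self hl0]; exact one_mem _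
      · exact hsub (Or.inr ⟨l, hl, rfl⟩)
    let A' : Mn := ∑ l, (α l / α l0) • Y l
    have hA' : ∀ i j, A' i j ∈ F := by
      intro i j
      simp only [A', Matrix.sum_apply, Matrix.smul_apply, smul_eq_mul]
      exact sum_mem fun l _ => mul_mem (hrat l) (hle (hY l i j))
    have hAA : A = α l0 • A' := by
      rw [← hα, Finset.smul_sum]
      refine Finset.sum_congr rfl fun l _ => ?_
      rw [smul_smul, mul_div_cancel₀ _ hl0]
    have hdetF : A'.det ∈ F := by
      rw [Matrix.det_apply]
      refine sum_mem fun σ _ => ?_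
      rw [Units.smul_def, zsmul_eq_mul]
      exact mul_mem (intCast_mem _ _) (prod_mem fun i _ => hA' _ _)
    have h1 : α l0 ^ n * A'.det = 1 := by
      rw [hAA, Matrix.det_smul, Fintype.card_fin] at hdet
      exact hdet
    have h2 : α l0 ^ n ∈ F := by
      rw [eq_inv_of_mul_eq_one_left h1]
      exact inv_mem hdetF
    have h3 : α l0 ∈ F := mem_clF_of_pow_mem hn h2
    rw [ent_subset]
    intro i j
    rw [hAA, Matrix.smul_apply, smul_eq_mul]
    exact mul_mem h3 (hA' i j)

theorem G3_main [IsAlgClosed Ω] (A B : Mn) (hA : A.det = 1) (hB : B.det = 1) {m : ℕ} (hm : 2 ≤ m)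
    (X : Fin m → Mn) (hX : ∀ l i j, X l i j ∈ clF k (ent A ∪ ent B)) (hZ : ∀ l, X l ∈ Zc A B)
    (hli : LinearIndependent Ω X) (t : Fin m → Ω)
    (ht : (AM k Ω).eRk (ent A ∪ ent B) + m ≤ (AM k Ω).eRk ((ent A ∪ ent B) ∪ Set.range t)) :
    (AM k Ω).eRk (ent A ∪ ent B) + m ≤ ((2 * n ^ 2 - 2 : ℕ) : ℕ∞) := by
  classical
  have hn : 0 < n := by
    rcases Nat.eq_zero_or_pos n with rfl | h
    · exfalso
      exact hli.ne_zero ⟨0, by omega⟩ (Subsingleton.elim _ _)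
    · exact h
  set S := ent A ∪ ent B with hS
  let Y : Mn := ∑ l, t l • X l
  have hYZ : Y ∈ Zc A B := Submodule.sum_mem _ fun l _ => Submodule.smul_mem _ _ (hZ l)
  -- step 1
  have h1 : Set.range t ⊆ clF k (S ∪ ent Y) := by
    set F := clF k (S ∪ ent Y) with hF
    have hsub := subset_clF (k := k) (S ∪ ent Y)
    have hle : clF k S ≤ F := clF_le (Set.subset_union_left.trans hsub)
    let c : (Fin n × Fin n) → Option (Fin m) → F := fun p o => o.elim ⟨Y p.1 p.2, hsub (Or.inr (ent_mem _ _ _))⟩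
      (fun l => ⟨X l p.1 p.2, hle (hX l _ _)⟩)
    let v : Option (Fin m) → Ω := fun o => o.elim (-1) t
    have hv : ∀ p, ∑ o, (c p o : Ω) * v o = 0 := by
      intro p
      rw [Fintype.sum_option]
      simp only [c, v, Option.elim, Y, Matrix.sum_apply, Matrix.smul_apply, smul_eq_mul]
      simp [mul_comm]
    have hk := KL F c v hv
    have hw : ∃ w : Option (Fin m) → Ω, ((∀ j, w j ∈ F) ∧ ∀ i, ∑ j, (c i j : Ω) * w j = 0) ∧ w none ≠ 0 := by
      by_contra hcon
      push Not at hcon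
      have : ∀ u ∈ Submodule.span Ω {w : Option (Fin m) → Ω | (∀ j, w j ∈ F) ∧ ∀ i, ∑ j, (c i j : Ω) * w j = 0}, u none = 0 := by
        intro u hu
        induction hu using Submodule.span_induction with
        | mem x hx => exact hcon x hx
        | zero => rfl
        | add x y _ _ hx hy => simp [hx, hy]
        | smul a x _ hx => simp [hx]
      have := this v hk
      simp [v] at this
    obtain ⟨w, ⟨hwF, hw⟩, hw0⟩ := hw
    have h2 : ∑ l, (w (some l) + w none * t l) • X l = 0 := by
      ext i j
      have := hw (i, j)
      rw [Fintype.sum_option] at this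
      simp only [c, Option.elim, Y, Matrix.sum_apply, Matrix.smul_apply, smul_eq_mul] at this
      simp only [Matrix.sum_apply, Matrix.smul_apply, smul_eq_mul, Matrix.zero_apply, add_mul, Finset.sum_add_distrib]
      rw [← this, Finset.sum_mul, add_comm]
      congr 1
      · exact Finset.sum_congr rfl fun l _ => by ring
      · exact Finset.sum_congr rfl fun l _ => by ring
    have h3 := Fintype.linearIndependent_iff.mp hli _ h2
    rintro _ ⟨l, rfl⟩
    have : t l = - (w (some l) / w none) := by
      field_simp
      linear_combination h3 l
    rw [this]
    exact neg_mem (div_mem (hwF _) (hwF _))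
  -- Y nonscalar
  have hfin : (AM k Ω).eRk S ≠ ⊤ := by
    apply ne_top_of_le_ne_top _ ((AM k Ω).eRk_le_encard S)
    rw [Set.encard_ne_top_iff]
    exact (Set.finite_range _).union (Set.finite_range _)
  have hns : ∀ c : Ω, Y - c • (1 : Mn) ≠ 0 := by
    intro c hc
    have hYc : Y = c • (1 : Mn) := sub_eq_zero.mp hc
    have h2 : ent Y ⊆ clF k {c} := by
      rw [ent_subset]
      intro i j
      rw [hYc, Matrix.smul_apply, smul_eq_mul]
      refine mul_mem (subset_clF _ rfl) ?_
      rw [Matrix.one_apply]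
      split_ifs
      · exact one_mem _
      · exact zero_mem _
    have h3 : S ∪ Set.range t ⊆ clF k (S ∪ {c}) := by
      have hle : clF k {c} ≤ clF k (S ∪ {c}) := clF_le (Set.subset_union_right.trans (subset_clF _))
      have hle2 : clF k (S ∪ ent Y) ≤ clF k (S ∪ {c}) := clF_le (Set.union_subset (Set.subset_union_left.trans (subset_clF _)) (h2.trans hle))
      exact Set.union_subset (Set.subset_union_left.trans (subset_clF _)) (h1.trans hle2)
    have h4 := ht.trans ((eRk_le_of_subset_clF h3).trans ((AM k Ω).eRk_union_le_eRk_add_encard S {c}))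
    rw [Set.encard_singleton] at h4
    have h5 : (m : ℕ∞) ≤ 1 := (WithTop.add_le_add_iff_left hfin).mp h4
    have : m ≤ 1 := by exact_mod_cast h5
    omega
  -- minimal rank
  obtain ⟨c, hc⟩ : ∃ c : Ω, ∀ c' : Ω, (Y - c • (1 : Mn)).rank ≤ (Y - c' • (1 : Mn)).rank := by
    let f : Ω → ℕ := fun c => (Y - c • (1 : Mn)).rank
    exact ⟨Function.argmin f, fun c' => Function.argmin_le f c'⟩
  set r := (Y - c • (1 : Mn)).rank with hr
  have hr1 : 1 ≤ r := by
    by_contra h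
    have h0 : r = 0 := by omega
    have h2 : finrank Ω (LinearMap.range (Y - c • (1 : Mn)).mulVecLin) = 0 := hr.symm.trans h0
    have h3 := LinearMap.range_eq_bot.mp (Submodule.finrank_eq_zero.mp h2)
    apply hns c
    apply Matrix.toLin'.injective
    rw [map_zero, Matrix.toLin'_apply', h3]
  have hrn : r ≤ n := by
    have := Matrix.rank_le_width (Y - c • (1 : Mn))
    exact this
  have hz := Zc_self_finrank Y r hc
  set z := finrank Ω (Zc Y Y) with hzdef
  obtain ⟨W, hW1, hW2, hW3⟩ := Zc_basis (clF k (ent Y)) Y Y (fun i j => subset_clF _ (ent_mem _ _ _)) (fun i j => subset_clF _ (ent_mem _ _ _))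
  obtain ⟨RA, hRA, hRA2⟩ := ratio_lemma (k := k) hn Y A z W hW1 (by rw [hW3]; exact ⟨hYZ.1.symm, hYZ.1.symm⟩) hA
  obtain ⟨RB, hRB, hRB2⟩ := ratio_lemma (k := k) hn Y B z W hW1 (by rw [hW3]; exact ⟨hYZ.2.symm, hYZ.2.symm⟩) hB
  have hz1 : 1 ≤ z := by
    have h1 : (1 : Mn) ∈ Zc Y Y := by rw [mem_Zc]; simp
    have : Nontrivial (Zc Y Y) := ⟨⟨1, h1⟩, 0, fun h => by
      have h2 : (1 : Mn) = 0 := congrArg Subtype.val h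
      have := congrFun (congrFun h2 ⟨0, hn⟩) ⟨0, hn⟩
      simp at this⟩
    exact Module.finrank_pos
  set U := ent Y ∪ RA ∪ RB with hU
  have hUs := subset_clF (k := k) U
  have hAU : ent A ⊆ clF k U := hRA2.trans (clF_le (Set.subset_union_left.trans hUs))
  have hBU : ent B ⊆ clF k U := hRB2.trans (clF_le (Set.Subset.trans (by
    intro x hx
    rcases hx with hx | hx
    · exact Or.inl (Or.inl hx)
    · exact Or.inr hx) hUs))
  have hYU : ent Y ⊆ clF k U := (Set.subset_union_left.trans Set.subset_union_left).trans hUs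
  have hSU : S ⊆ clF k U := Set.union_subset hAU hBU
  have htU : Set.range t ⊆ clF k U := h1.trans (clF_le (Set.union_subset hSU hYU))
  have hfinal := ht.trans (eRk_le_of_subset_clF (Set.union_subset hSU htU))
  refine hfinal.trans (((AM k Ω).eRk_union_le_eRk_add_encard _ _).trans ((add_le_add ((AM k Ω).eRk_union_le_eRk_add_encard _ _) le_rfl).trans ?_))
  refine (add_le_add (add_le_add (rank_param Y c r hr.symm) hRA) hRB).trans ?_
  norm_cast
  clear_value z r
  have key : ∀ n r z : ℕ, r ≤ n → 1 ≤ r → 1 ≤ z → z ≤ n * (n - r) →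
      1 + r * n + (n - r) * r + (z - 1) + (z - 1) ≤ 2 * n ^ 2 - 2 := by
    intro n r z hrn hr1 hz1 hz
    obtain ⟨s, rfl⟩ := Nat.exists_eq_add_of_le hrn
    have e1 : r + s - r = s := by omega
    rw [e1] at hz ⊢
    obtain ⟨q, rfl⟩ := Nat.exists_eq_add_of_le hr1
    have : 1 + (1 + q) * (1 + q + s) + s * (1 + q) + (z - 1) + (z - 1) + 2 ≤ 2 * (1 + q + s) ^ 2 := by
      have h2z : (z - 1) + (z - 1) + 2 = 2 * z := by omega
      nlinarith [hz, h2z]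
    omega
  exact key n r z hrn hr1 hz1 hz

end G3
end PartG3

section PartRep
section Rep
/-- product of the entries before position `i` -/
def preP {M : Type} [Monoid M] {g : ℕ} (f : Fin g → M) (i : Fin g) : M := ((List.ofFn f).take i).prod
/-- product of the entries after position `i` -/
def sufP {M : Type} [Monoid M] {g : ℕ} (f : Fin g → M) (i : Fin g) : M := ((List.ofFn f).drop (i + 1)).prod

theorem pre_suf {M : Type} [Monoid M] {g : ℕ} (f : Fin g → M) (i : Fin g) :
    (List.ofFn f).prod = preP f i * f i * sufP f i := by
  have h1 : (List.ofFn f) = (List.ofFn f).take i ++ (List.ofFn f)[(i : ℕ)]'(by simp) :: (List.ofFn f).drop (i + 1) := by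
    rw [List.getElem_cons_drop, List.take_append_drop]
  conv_lhs => rw [h1]
  rw [List.prod_append, List.prod_cons, preP, sufP, ← mul_assoc]
  simp

theorem preP_mem {M S : Type} [Monoid M] [SetLike S M] [SubmonoidClass S M] {g : ℕ} (f : Fin g → M) (i : Fin g) (H : S)
    (h : ∀ j ≠ i, f j ∈ H) : preP f i ∈ H := by
  refine list_prod_mem fun x hx => ?_
  obtain ⟨l, hl, rfl⟩ := List.mem_iff_getElem.mp hx
  simp only [List.length_take, List.length_ofFn, lt_min_iff] at hl
  simp only [List.getElem_take, List.getElem_ofFn]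
  exact h _ (fun h => by have := congrArg Fin.val h; simp at this; omega)

theorem sufP_mem {M S : Type} [Monoid M] [SetLike S M] [SubmonoidClass S M] {g : ℕ} (f : Fin g → M) (i : Fin g) (H : S)
    (h : ∀ j ≠ i, f j ∈ H) : sufP f i ∈ H := by
  refine list_prod_mem fun x hx => ?_
  obtain ⟨l, hl, rfl⟩ := List.mem_iff_getElem.mp hx
  simp only [List.length_drop, List.length_ofFn] at hl
  simp only [List.getElem_drop, List.getElem_ofFn]
  exact h _ (fun h => by have := congrArg Fin.val h; simp at this; omega)

theorem preP_congr {M : Type} [Monoid M] {g : ℕ} {f f' : Fin g → M} {i : Fin g}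
    (h : ∀ j ≠ i, f j = f' j) : preP f i = preP f' i := by
  unfold preP
  congr 1
  apply List.ext_getElem
  · simp
  · intro l h1 h2
    simp only [List.length_take, List.length_ofFn, lt_min_iff] at h1
    simp only [List.getElem_take, List.getElem_ofFn]
    exact h _ (fun h => by have := congrArg Fin.val h; simp at this; omega)

theorem sufP_congr {M : Type} [Monoid M] {g : ℕ} {f f' : Fin g → M} {i : Fin g}
    (h : ∀ j ≠ i, f j = f' j) : sufP f i = sufP f' i := by
  unfold sufP
  congr 1
  apply List.ext_getElem
  · simp
  · intro l h1 h2
    simp only [List.getElem_drop, List.getElem_ofFn]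
    exact h _ (fun h => by have := congrArg Fin.val h; simp at this; omega)

theorem map_preP {M N : Type} [Monoid M] [Monoid N] (φ : M →* N) {g : ℕ} (f : Fin g → M) (i : Fin g) :
    φ (preP f i) = preP (fun j => φ (f j)) i := by
  unfold preP
  rw [map_list_prod, List.map_take, List.map_ofFn]; rfl

theorem map_sufP {M N : Type} [Monoid M] [Monoid N] (φ : M →* N) {g : ℕ} (f : Fin g → M) (i : Fin g) :
    φ (sufP f i) = sufP (fun j => φ (f j)) i := by
  unfold sufP
  rw [map_list_prod, List.map_drop, List.map_ofFn]; rfl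

/-- inclusion of SL in matrices -/
def slHom (n : ℕ) (K : Type) [CommRing K] : SL n K →* Matrix (Fin n) (Fin n) K where
  toFun A := A
  map_one' := rfl
  map_mul' _ _ := rfl

theorem slHom_inv {n : ℕ} {K : Type} [CommRing K] (A : SL n K) : slHom n K A⁻¹ = (slHom n K A)⁻¹ := by
  have : (slHom n K A).det = 1 := A.2
  rw [Matrix.inv_def, this, Ring.inverse_one, one_smul]
  exact Matrix.SpecialLinearGroup.coe_inv A

theorem slHom_comm {n : ℕ} {K : Type} [CommRing K] (A B : SL n K) :
    slHom n K ⁅A, B⁆ = slHom n K A * slHom n K B * (slHom n K A)⁻¹ * (slHom n K B)⁻¹ := by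
  rw [commutatorElement_def, map_mul, map_mul, map_mul, slHom_inv, slHom_inv]

theorem slHom_injective {n : ℕ} {K : Type} [CommRing K] : Function.Injective (slHom n K) :=
  fun _ _ h => Subtype.ext h

theorem rep_iff {g n : ℕ} {K : Type} [CommRing K] (A : (Fin g × Bool) → Matrix (Fin n) (Fin n) K) :
    A ∈ RepVariety g n K ↔ ∃ s : Fin g × Bool → SL n K, (∀ x, A x = slHom n K (s x)) ∧
      (List.ofFn fun i => ⁅s (i, false), s (i, true)⁆).prod = 1 := by
  have key : ∀ s : Fin g × Bool → SL n K, (List.ofFn fun i : Fin g =>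
      slHom n K (s (i, false)) * slHom n K (s (i, true)) * (slHom n K (s (i, false)))⁻¹ * (slHom n K (s (i, true)))⁻¹).prod =
      slHom n K ((List.ofFn fun i => ⁅s (i, false), s (i, true)⁆).prod) := by
    intro s
    rw [map_list_prod, List.map_ofFn]
    refine congrArg List.prod (congrArg List.ofFn (funext fun i => ?_))
    exact (slHom_comm _ _).symm
  constructor
  · rintro ⟨h1, h2⟩
    let s : Fin g × Bool → SL n K := fun x => ⟨A x, h1 x⟩
    refine ⟨s, fun x => rfl, slHom_injective ?_⟩
    rw [← key s, map_one]; exact h2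
  · rintro ⟨s, h1, h2⟩
    have : A = fun x => slHom n K (s x) := funext h1
    subst this
    exact ⟨fun x => (s x).2, by rw [key, h2, map_one]⟩

theorem rel_subgroup {G : Type} [Group G] {g : ℕ} (f : Fin g → G) (hf : (List.ofFn f).prod = 1) (i : Fin g) :
    f i = (preP f i)⁻¹ * (sufP f i)⁻¹ := by
  rw [pre_suf f i] at hf
  have : preP f i * f i = (sufP f i)⁻¹ := eq_inv_of_mul_eq_one_left hf
  rw [← this]; group
end Rep
end PartRep

section PartG4
section G4
open Module

theorem deriv_prod {k Ω ι : Type} [Field k] [Field Ω] [Algebra k Ω] [DecidableEq ι] (D : Derivation k Ω Ω) (s : Finset ι) (f : ι → Ω) :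
    D (∏ i ∈ s, f i) = ∑ i ∈ s, (∏ j ∈ s.erase i, f j) * D (f i) := by
  induction s using Finset.induction_on with
  | empty => simp
  | insert a s ha ih =>
    rw [Finset.prod_insert ha, D.leibniz, ih, Finset.sum_insert ha, Finset.erase_insert ha, add_comm,
      smul_eq_mul, smul_eq_mul, Finset.mul_sum]
    congr 1
    refine Finset.sum_congr rfl fun i hi => ?_
    have hia : a ≠ i := fun h => ha (h ▸ hi)
    rw [Finset.erase_insert_of_ne hia, Finset.prod_insert (fun h => ha (Finset.mem_of_mem_erase h))]
    ring

variable {k Ω : Type} [Field k] [Field Ω] [Algebra k Ω] {n : ℕ}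
local notation "Mn" => Matrix (Fin n) (Fin n) Ω

theorem deriv_det (D : Derivation k Ω Ω) (A : Mn) :
    D A.det = Matrix.trace (A.adjugate * A.map D) := by
  have h1 : Matrix.trace (A.adjugate * A.map D) = ∑ i, (A.updateCol i (fun j => D (A j i))).det := by
    rw [Matrix.trace]
    refine Finset.sum_congr rfl fun i _ => ?_
    rw [Matrix.diag_apply, ← Matrix.cramer_apply, Matrix.cramer_eq_adjugate_mulVec]
    rfl
  rw [h1, Matrix.det_apply, map_sum]
  simp_rw [Matrix.det_apply]
  rw [Finset.sum_comm]
  refine Finset.sum_congr rfl fun σ _ => ?_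
  rw [Units.smul_def, map_zsmul, deriv_prod, ← Units.smul_def, Finset.smul_sum]
  refine Finset.sum_congr rfl fun i _ => ?_
  congr 1
  rw [← Finset.prod_erase_mul _ _ (Finset.mem_univ i)]
  congr 1
  · refine Finset.prod_congr rfl fun j hj => ?_
    rw [Matrix.updateCol_ne (Finset.ne_of_mem_erase hj)]
  · rw [Matrix.updateCol_self]

theorem map_deriv_mul (D : Derivation k Ω Ω) (A B : Mn) :
    (A * B).map D = A.map D * B + A * B.map D := by
  ext i j
  simp only [Matrix.map_apply, Matrix.add_apply, Matrix.mul_apply, map_sum, D.leibniz, smul_eq_mul,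
    ← Finset.sum_add_distrib]
  exact Finset.sum_congr rfl fun l _ => by ring

/-- subgroup of matrices with entries in a subfield -/
def slF (n : ℕ) (F : IntermediateField k Ω) : Subgroup (SL n Ω) :=
  (Matrix.SpecialLinearGroup.map (n := Fin n) (algebraMap F Ω)).range

theorem mem_slF (F : IntermediateField k Ω) (A : SL n Ω) : A ∈ slF n F ↔ ∀ i j, slHom n Ω A i j ∈ F := by
  constructor
  · rintro ⟨B, rfl⟩ i j
    exact (B.1 i j).2
  · intro h
    let B : Matrix (Fin n) (Fin n) F := Matrix.of fun i j => ⟨_, h i j⟩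
    have hB : B.map (algebraMap F Ω) = slHom n Ω A := by ext i j; rfl
    have hdet : B.det = 1 := by
      apply (algebraMap F Ω).injective
      rw [RingHom.map_det, map_one]
      exact (congrArg Matrix.det hB).trans A.2
    exact ⟨⟨B, hdet⟩, Subtype.ext hB⟩

theorem handle_step [CharZero Ω] (hn : 0 < n) (S : Set Ω) (A B : SL n Ω) (hw : ⁅A, B⁆ ∈ slF n (clF k S)) :
    (AM k Ω).eRk (S ∪ (ent (slHom n Ω A) ∪ ent (slHom n Ω B))) ≤ (AM k Ω).eRk S +
      ((n ^ 2 + finrank Ω (Zc (slHom n Ω A) (slHom n Ω B)) - 2 : ℕ) : ℕ∞) := by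
  set a := slHom n Ω A with ha
  set b := slHom n Ω B with hb
  set Z := slHom n Ω ⁅A, B⁆ with hZ
  have hda : a.det = 1 := A.2
  have hdb : b.det = 1 := B.2
  have hua : IsUnit a := (Matrix.isUnit_iff_isUnit_det a).mpr (by rw [hda]; exact isUnit_one)
  have hub : IsUnit b := (Matrix.isUnit_iff_isUnit_det b).mpr (by rw [hdb]; exact isUnit_one)
  have hrel : Z * b * a = a * b := by
    rw [hZ, ha, hb, ← map_mul, ← map_mul, ← map_mul]
    congr 1
    rw [commutatorElement_def]; group
  have hn0 : (n : Ω) ≠ 0 := by exact_mod_cast hn.ne'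
  have hker := finrank_TD_ker hua hub hrel hn0
  let e : (Bool × Fin n × Fin n → Ω) →ₗ[Ω] Mn × Mn :=
    { toFun := fun w => (Matrix.of fun i j => w (false, i, j), Matrix.of fun i j => w (true, i, j))
      map_add' := fun _ _ => rfl
      map_smul' := fun _ _ => rfl }
  let V := (LinearMap.ker (TD a b Z)).comap e
  have hinv : ∀ M : Mn, M.det = 1 → M⁻¹ = M.adjugate := by
    intro M hM
    rw [Matrix.inv_def, hM, Ring.inverse_one, one_smul]
  let T : Bool × Fin n × Fin n → Ω := fun p => if p.1 then b p.2.1 p.2.2 else a p.2.1 p.2.2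
  have hT : Set.range T = ent a ∪ ent b := by
    ext x
    constructor
    · rintro ⟨⟨c, i, j⟩, rfl⟩
      cases c
      · left; simpa [T] using ent_mem a i j
      · right; simpa [T] using ent_mem b i j
    · rintro (⟨p, rfl⟩ | ⟨p, rfl⟩)
      · exact ⟨(false, p), by simp [T]⟩
      · exact ⟨(true, p), by simp [T]⟩
  have h1 := G2_core (k := k) S T V (by
    intro D hD
    have hZ0 : Z.map D = 0 := by
      ext i j
      exact deriv_zero_clF D hD ((mem_slF _ _).mp hw i j)
    have heq : e (fun t => D (T t)) = (a.map D, b.map D) := by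
      refine Prod.ext ?_ ?_ <;> ext i j <;> rfl
    show TD a b Z (e (fun t => D (T t))) = 0
    rw [heq]
    refine Prod.ext ?_ (Prod.ext ?_ ?_)
    · show a.map D * b + a * b.map D - Z * (b.map D * a + b * a.map D) = 0
      have := congrArg (fun M : Mn => M.map D) hrel
      simp only [map_deriv_mul, hZ0, mul_assoc] at this
      rw [sub_eq_zero, ← this, zero_mul, zero_add]
    · show Matrix.trace (a⁻¹ * a.map D) = 0
      rw [hinv a hda, ← deriv_det, hda, D.map_one_eq_zero]
    · show Matrix.trace (b⁻¹ * b.map D) = 0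
      rw [hinv b hdb, ← deriv_det, hdb, D.map_one_eq_zero])
  rw [hT] at h1
  refine h1.trans (add_le_add le_rfl ?_)
  norm_cast
  have h2 : finrank Ω V ≤ finrank Ω (LinearMap.ker (TD a b Z)) := by
    let φ : V →ₗ[Ω] LinearMap.ker (TD a b Z) := (e.restrict (p := V) (q := LinearMap.ker (TD a b Z)) (fun x hx => hx))
    refine LinearMap.finrank_le_finrank_of_injective (f := φ) ?_
    intro x y h
    have h3 : e x.1 = e y.1 := congrArg Subtype.val h
    ext ⟨c, i, j⟩
    cases c
    · exact congrFun (congrFun (congrArg Prod.fst h3) i) j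
    · exact congrFun (congrFun (congrArg Prod.snd h3) i) j
  omega

theorem G4_main [CharZero Ω] [IsAlgClosed Ω] {g : ℕ} (hg : 2 ≤ g) (hn : 2 ≤ n)
    (s : Fin g × Bool → SL n Ω) (hrel : (List.ofFn fun i => ⁅s (i, false), s (i, true)⁆).prod = 1)
    (hD : (((2 * g - 1) * (n ^ 2 - 1) : ℕ) : ℕ∞) ≤ (AM k Ω).eRk (⋃ x, ent (slHom n Ω (s x))))
    (ht : ∀ m : ℕ, ∃ t : Fin m → Ω, ∀ S ⊆ (⋃ x, ent (slHom n Ω (s x))), 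
      (AM k Ω).eRk S + m ≤ (AM k Ω).eRk (S ∪ Set.range t)) :
    ∃ i, finrank Ω (Zc (slHom n Ω (s (i, false))) (slHom n Ω (s (i, true)))) ≤ 1 := by
  classical
  by_contra hcon
  push Not at hcon
  set m : Fin g → ℕ := fun i => finrank Ω (Zc (slHom n Ω (s (i, false))) (slHom n Ω (s (i, true)))) with hm
  let E : Fin g → Set Ω := fun i => ent (slHom n Ω (s (i, false))) ∪ ent (slHom n Ω (s (i, true)))
  have hE : ∀ i, E i ⊆ (⋃ x, ent (slHom n Ω (s x))) := fun i =>
    Set.union_subset (Set.subset_iUnion (fun x => ent (slHom n Ω (s x))) _) (Set.subset_iUnion (fun x => ent (slHom n Ω (s x))) _)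
  have hG3 : ∀ i, (AM k Ω).eRk (E i) + m i ≤ ((2 * n ^ 2 - 2 : ℕ) : ℕ∞) := by
    intro i
    obtain ⟨X, hX1, hX2, hX3⟩ := Zc_basis (clF k (E i)) (slHom n Ω (s (i, false))) (slHom n Ω (s (i, true)))
      (fun a b => subset_clF _ (Or.inl (ent_mem _ _ _))) (fun a b => subset_clF _ (Or.inr (ent_mem _ _ _)))
    obtain ⟨t, ht⟩ := ht (m i)
    exact G3_main (slHom n Ω (s (i, false))) (slHom n Ω (s (i, true))) (s (i, false)).2 (s (i, true)).2 (hcon i) X hX1 (fun l => by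
      rw [← hX3]; exact Submodule.subset_span ⟨l, rfl⟩) hX2 t (ht _ (hE i))
  have hne : (Finset.univ : Finset (Fin g)).Nonempty := ⟨⟨0, by omega⟩, Finset.mem_univ _⟩
  obtain ⟨i0, -, hi0⟩ := Finset.exists_min_image Finset.univ m hne
  let S : Set Ω := ⋃ i ∈ (Finset.univ.erase i0), E i
  have hmemS : ∀ i ≠ i0, E i ⊆ S := fun i hi => Set.subset_biUnion_of_mem (u := E) (Finset.mem_erase.mpr ⟨hi, Finset.mem_univ _⟩)
  have hw : ⁅s (i0, false), s (i0, true)⁆ ∈ slF n (clF k S) := by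
    rw [rel_subgroup _ hrel i0]
    have : ∀ j ≠ i0, ⁅s (j, false), s (j, true)⁆ ∈ slF n (clF k S) := by
      intro j hj
      have h1 : s (j, false) ∈ slF n (clF k S) := (mem_slF _ _).mpr fun a b => subset_clF _ (hmemS j hj (Or.inl (ent_mem _ _ _)))
      have h2 : s (j, true) ∈ slF n (clF k S) := (mem_slF _ _).mpr fun a b => subset_clF _ (hmemS j hj (Or.inr (ent_mem _ _ _)))
      rw [commutatorElement_def]
      exact mul_mem (mul_mem (mul_mem h1 h2) (inv_mem h1)) (inv_mem h2)
    exact mul_mem (inv_mem (preP_mem _ _ _ this)) (inv_mem (sufP_mem _ _ _ this))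
  have h1 := handle_step (by omega) S (s (i0, false)) (s (i0, true)) hw
  have hall : (⋃ x, ent (slHom n Ω (s x))) ⊆ S ∪ E i0 := by
    intro x hx
    obtain ⟨⟨i, c⟩, hx⟩ := Set.mem_iUnion.mp hx
    have hxE : x ∈ E i := by cases c; exacts [Or.inl hx, Or.inr hx]
    by_cases hi : i = i0
    · subst hi; exact Or.inr hxE
    · exact Or.inl (hmemS i hi hxE)
  have h2 := hD.trans (((AM k Ω).eRk_mono hall).trans h1)
  have h3 : ∀ T : Finset (Fin g), (AM k Ω).eRk (⋃ i ∈ T, E i) ≤ ((T.card * (2 * n ^ 2 - 2 - m i0) : ℕ) : ℕ∞) := by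
    intro T
    induction T using Finset.induction_on with
    | empty => simp
    | insert a T ha ih =>
      rw [Finset.set_biUnion_insert, Finset.card_insert_of_notMem ha]
      refine ((AM k Ω).eRk_union_le_eRk_add_eRk _ _).trans ?_
      rw [add_comm, Nat.add_mul, one_mul]
      push_cast
      refine add_le_add ih ?_
      have h4 := hG3 a
      have h5 : ((AM k Ω).eRk (E a) + m i0) ≤ ((2 * n ^ 2 - 2 : ℕ) : ℕ∞) := 
        (add_le_add le_rfl (by exact_mod_cast hi0 a (Finset.mem_univ _))).trans h4
      generalize (AM k Ω).eRk (E a) = r at h5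
      have hr : r ≠ ⊤ := fun h => by rw [h, top_add] at h5; exact absurd h5 (not_le.mpr (ENat.coe_lt_top _))
      lift r to ℕ using hr
      norm_cast at h5 ⊢
      omega
  have h4 := h2.trans (add_le_add (h3 _) le_rfl)
  have h5 := (hG3 i0)
  have h6 : m i0 ≤ 2 * n ^ 2 - 2 := by exact_mod_cast (le_add_self).trans h5
  rw [Finset.card_erase_of_mem (Finset.mem_univ _), Finset.card_univ, Fintype.card_fin] at h4
  have h7 : (2 * g - 1) * (n ^ 2 - 1) ≤ (g - 1) * (2 * n ^ 2 - 2 - m i0) + (n ^ 2 + m i0 - 2) := by exact_mod_cast h4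
  have h8 := hcon i0
  have key : ∀ g N m : ℕ, 2 ≤ g → 4 ≤ N → 1 < m → m ≤ 2 * N - 2 → (2 * g - 1) * (N - 1) ≤ (g - 1) * (2 * N - 2 - m) + (N + m - 2) → False := by
    intro g N m h1 h2 h3 h4 h5
    obtain ⟨g, rfl⟩ := Nat.exists_eq_add_of_le h1
    obtain ⟨r, hr⟩ := Nat.exists_eq_add_of_le h4
    have e1 : 2 * N - 2 - m = r := by omega
    rw [e1] at h5
    obtain ⟨N, rfl⟩ := Nat.exists_eq_add_of_le h2
    have e2 : 2 * (2 + g) - 1 = 2 * g + 3 := by omega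
    have e3 : 4 + N - 1 = N + 3 := by omega
    have e4 : 2 + g - 1 = g + 1 := by omega
    have e5 : 4 + N + m - 2 = N + m + 2 := by omega
    rw [e2, e3, e4, e5] at h5
    have e6 : 2 * N + 6 = m + r := by omega
    nlinarith [Nat.zero_le (g * m)]
  refine key g (n ^ 2) (m i0) hg (by nlinarith) h8 h6 h7

end G4
end PartG4

section PartG5
section G5
open Module

abbrev Om (L : Type) [Field L] : Type := AlgebraicClosure (FractionRing (MvPolynomial ℕ L))

theorem Om_t (k L : Type) [Field k] [Field L] [Algebra k L] (m : ℕ) :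
    ∃ t : Fin m → Om L, ∀ S ⊆ Set.range (algebraMap L (Om L)),
      (AM k (Om L)).eRk S + m ≤ (AM k (Om L)).eRk (S ∪ Set.range t) := by
  let t : Fin m → Om L := fun l => algebraMap (MvPolynomial ℕ L) (Om L) (MvPolynomial.X (l : ℕ))
  have hinj : Function.Injective (algebraMap (MvPolynomial ℕ L) (Om L)) := by
    rw [IsScalarTower.algebraMap_eq (MvPolynomial ℕ L) (FractionRing (MvPolynomial ℕ L)) (Om L)]
    exact (algebraMap (FractionRing (MvPolynomial ℕ L)) (Om L)).injective.comp (IsFractionRing.injective _ _)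
  have ht : AlgebraicIndependent L t := by
    have h1 := (MvPolynomial.algebraicIndependent_X ℕ L).map' (f := IsScalarTower.toAlgHom L (MvPolynomial ℕ L) (Om L)) hinj
    exact h1.comp (fun l : Fin m => (l : ℕ)) Fin.val_injective
  refine ⟨t, fun S hS => ?_⟩
  obtain ⟨I, hI⟩ := (AM k (Om L)).exists_isBasis S (Set.subset_univ _)
  have hIi : AlgebraicIndependent k (Subtype.val : I → Om L) := by
    have := hI.indep
    rwa [AlgebraicIndependent.matroid_indep_iff] at this
  have hsum := hIi.sumElim_of_tower (S := L) (y := t) (by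
    rw [Subtype.range_coe]; exact hI.subset.trans hS) ht
  have hindep : (AM k (Om L)).Indep (Set.range (Sum.elim t (Subtype.val : I → Om L))) := by
    rw [AlgebraicIndependent.matroid_indep_iff]
    exact hsum.to_subtype_range
  have hle : Set.range (Sum.elim t (Subtype.val : I → Om L)) ⊆ S ∪ Set.range t := by
    rw [Set.Sum.elim_range, Subtype.range_coe]
    exact Set.union_subset Set.subset_union_right (hI.subset.trans Set.subset_union_left)
  have h2 := (AM k (Om L)).eRk_mono hle
  rw [hindep.eRk_eq_encard] at h2
  refine le_trans ?_ h2
  rw [← Set.image_univ, hsum.injective.encard_image, Set.encard_univ, ENat.card_sum, add_comm, ← hI.encard_eq_eRk]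
  refine add_le_add ?_ ?_
  · simp
  · exact le_of_eq rfl

/-- matrix of the linear system defining the centralizer (plus one normalization) -/
def Cm {n : ℕ} {K : Type} [CommRing K] (o : Fin n) (A B : Matrix (Fin n) (Fin n) K) :
    Matrix (Option (Bool × Fin n × Fin n)) (Fin n × Fin n) K :=
  Matrix.of fun r c => r.elim (if c = (o, o) then 1 else 0)
    (fun x => (if c.1 = x.2.1 then (if x.1 then B else A) c.2 x.2.2 else 0) -
      (if c.2 = x.2.2 then (if x.1 then B else A) x.2.1 c.1 else 0))

theorem Cm_map {n : ℕ} {K K' : Type} [CommRing K] [CommRing K'] (φ : K →+* K') (o : Fin n) (A B : Matrix (Fin n) (Fin n) K) :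
    (Cm o A B).map φ = Cm o (A.map φ) (B.map φ) := by
  ext r c
  rcases r with _ | ⟨b, i, j⟩
  · simp only [Cm, Matrix.map_apply, Matrix.of_apply, Option.elim, apply_ite φ, map_one, map_zero]
  · cases b <;> simp [Cm, Matrix.map_apply, apply_ite φ]

theorem Cm_none {n : ℕ} {K : Type} [CommRing K] (o : Fin n) (A B : Matrix (Fin n) (Fin n) K) (v : Fin n × Fin n → K) :
    (Cm o A B).mulVec v none = v (o, o) := by
  simp [Cm, Matrix.mulVec, dotProduct]

theorem Cm_some {n : ℕ} {K : Type} [CommRing K] (o : Fin n) (A B : Matrix (Fin n) (Fin n) K) (v : Fin n × Fin n → K)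
    (b : Bool) (i j : Fin n) :
    (Cm o A B).mulVec v (some (b, i, j)) = (Matrix.of (fun i j => v (i, j)) * (if b then B else A) -
      (if b then B else A) * Matrix.of (fun i j => v (i, j))) i j := by
  rw [Matrix.sub_apply, Matrix.mul_apply, Matrix.mul_apply]
  simp only [Cm, Matrix.mulVec, dotProduct, Matrix.of_apply, Option.elim, Fintype.sum_prod_type, sub_mul,
    Finset.sum_sub_distrib]
  congr 1
  · simp [mul_comm]
  · simp

theorem Cm_ker {n : ℕ} {K : Type} [CommRing K] (o : Fin n) (A B : Matrix (Fin n) (Fin n) K) :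
    (∀ v, (Cm o A B).mulVec v = 0 → v = 0) ↔ ∀ Y : Matrix (Fin n) (Fin n) K, Y * A = A * Y → Y * B = B * Y → ∃ c : K, Y = c • 1 := by
  constructor
  · intro h Y h1 h2
    refine ⟨Y o o, ?_⟩
    have h3 := h (fun p => (Y - Y o o • (1 : Matrix (Fin n) (Fin n) K)) p.1 p.2) (by
      ext r
      rcases r with _ | ⟨b, i, j⟩
      · rw [Cm_none]; simp
      · rw [Cm_some]
        have h4 : Matrix.of (fun i j => (Y - Y o o • (1 : Matrix (Fin n) (Fin n) K)) i j) = Y - Y o o • (1 : Matrix (Fin n) (Fin n) K) := rfl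
        show (Matrix.of (fun i j => (Y - Y o o • (1 : Matrix (Fin n) (Fin n) K)) i j) * (if b then B else A) -
          (if b then B else A) * Matrix.of (fun i j => (Y - Y o o • (1 : Matrix (Fin n) (Fin n) K)) i j)) i j = 0
        rw [h4]
        cases b
        · simp [sub_mul, mul_sub, h1]
        · simp [sub_mul, mul_sub, h2])
    rw [← sub_eq_zero]
    ext i j
    exact congrFun h3 (i, j)
  · intro h v hv
    obtain ⟨c, hc⟩ := h (Matrix.of fun i j => v (i, j)) (by
        ext i j
        have := congrFun hv (some (false, i, j))
        rw [Cm_some] at this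
        simpa [sub_eq_zero] using this) (by
        ext i j
        have := congrFun hv (some (true, i, j))
        rw [Cm_some] at this
        simpa [sub_eq_zero] using this)
    have h0 := congrFun hv none
    rw [Cm_none] at h0
    have h1 : v (o, o) = c := by
      have := congrFun (congrFun hc o) o
      simpa using this
    have hc0 : c = 0 := by rw [← h1, h0]; rfl
    ext ⟨i, j⟩
    have := congrFun (congrFun hc i) j
    simpa [hc0] using this

theorem exists_minor {K ι κ : Type} [Field K] [Fintype ι] [Fintype κ] [DecidableEq κ] (C : Matrix ι κ K)
    (h : ∀ v, C.mulVec v = 0 → v = 0) : ∃ f : κ → ι, (C.submatrix f id).det ≠ 0 := by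
  have hr : C.rank = Fintype.card κ := by
    have hinj : Function.Injective C.mulVecLin := by
      rw [injective_iff_map_eq_zero]
      exact h
    rw [Matrix.rank, LinearMap.finrank_range_of_inj hinj]; simp
  have hspan := Submodule.exists_fun_fin_finrank_span_eq K (Set.range C.row)
  rw [← Matrix.rank_eq_finrank_span_row, hr] at hspan
  obtain ⟨f, hf, hs, hli⟩ := hspan
  choose e he using hf
  let ε := Fintype.equivFin κ
  refine ⟨e ∘ ε, ?_⟩
  have h1 : LinearIndependent K (C.submatrix (e ∘ ε) id).row := by
    have : (C.submatrix (e ∘ ε) id).row = f ∘ ε := by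
      ext1 i
      exact he (ε i)
    rw [this]
    exact hli.comp _ ε.injective
  have h2 := Matrix.linearIndependent_rows_iff_isUnit.mp h1
  exact ((Matrix.isUnit_iff_isUnit_det _).mp h2).ne_zero

theorem of_minor {K ι κ : Type} [Field K] [Fintype ι] [Fintype κ] [DecidableEq κ] (C : Matrix ι κ K)
    (f : κ → ι) (hf : (C.submatrix f id).det ≠ 0) : ∀ v, C.mulVec v = 0 → v = 0 := by
  intro v hv
  refine Matrix.eq_zero_of_mulVec_eq_zero hf ?_
  ext i
  exact congrFun hv (f i)

/-- generic matrices -/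
noncomputable def gm (g n : ℕ) (x : Fin g × Bool) : Matrix (Fin n) (Fin n) (MvPolynomial ((Fin g × Bool) × Fin n × Fin n) ℂ) :=
  Matrix.of fun i j => MvPolynomial.X (x, i, j)

/-- generic relator -/
noncomputable def gr (g n : ℕ) : Matrix (Fin n) (Fin n) (MvPolynomial ((Fin g × Bool) × Fin n × Fin n) ℂ) :=
  (List.ofFn fun i : Fin g => gm g n (i, false) * gm g n (i, true) * (gm g n (i, false)).adjugate * (gm g n (i, true)).adjugate).prod

theorem gr_map (g n : ℕ) {K : Type} [CommRing K] (ψ : MvPolynomial ((Fin g × Bool) × Fin n × Fin n) ℂ →+* K) (s : Fin g × Bool → SL n K)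
    (hs : ∀ x, (gm g n x).map ψ = slHom n K (s x)) :
    (gr g n).map ψ = slHom n K (List.ofFn fun i => ⁅s (i, false), s (i, true)⁆).prod := by
  show ψ.mapMatrix (gr g n) = _
  rw [gr, map_list_prod, map_list_prod, List.map_ofFn, List.map_ofFn]
  refine congrArg List.prod (congrArg List.ofFn (funext fun i => ?_))
  have hs' : ∀ x, ψ.mapMatrix (gm g n x) = slHom n K (s x) := hs
  have hadj : ∀ x, ψ.mapMatrix (gm g n x).adjugate = slHom n K (s x)⁻¹ := by
    intro x
    rw [RingHom.map_adjugate, hs']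
    exact (Matrix.SpecialLinearGroup.coe_inv _).symm
  simp only [Function.comp_apply]
  rw [map_mul, map_mul, map_mul, hs', hs', hadj, hadj, ← map_mul, ← map_mul, ← map_mul, commutatorElement_def]

open Classical in
/-- equations -/
noncomputable def eqs (g n : ℕ) (o : Fin n) : Finset (MvPolynomial ((Fin g × Bool) × Fin n × Fin n) ℂ) :=
  (Finset.univ.image fun x => (gm g n x).det - 1) ∪ ((Finset.univ.erase (o, o)).image fun p : Fin n × Fin n => (gr g n - 1) p.1 p.2)

theorem eqs_card (g n : ℕ) (o : Fin n) : (eqs g n o).card ≤ 2 * g + (n ^ 2 - 1) := by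
  classical
  unfold eqs
  refine (Finset.card_union_le _ _).trans (add_le_add (Finset.card_image_le.trans ?_) (Finset.card_image_le.trans ?_))
  · simp [mul_comm]
  · rw [Finset.card_erase_of_mem (Finset.mem_univ _)]; simp [sq]

theorem eqs_rep (g n : ℕ) (o : Fin n) {K : Type} [CommRing K] (ψ : MvPolynomial ((Fin g × Bool) × Fin n × Fin n) ℂ →+* K)
    (h : ∀ q ∈ eqs g n o, ψ q = 0) : ∃ s : Fin g × Bool → SL n K, (∀ x, (gm g n x).map ψ = slHom n K (s x)) ∧
      (List.ofFn fun i => ⁅s (i, false), s (i, true)⁆).prod = 1 := by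
  classical
  have hdet : ∀ x, ((gm g n x).map ψ).det = 1 := by
    intro x
    have := h ((gm g n x).det - 1) (by unfold eqs; exact Finset.mem_union_left _ (Finset.mem_image_of_mem _ (Finset.mem_univ _)))
    rw [map_sub, map_one, sub_eq_zero, RingHom.map_det] at this
    exact this
  let s : Fin g × Bool → SL n K := fun x => ⟨_, hdet x⟩
  refine ⟨s, fun x => rfl, slHom_injective ?_⟩
  have h1 := gr_map g n ψ s (fun x => rfl)
  set W := (List.ofFn fun i => ⁅s (i, false), s (i, true)⁆).prod
  have hent : ∀ p : Fin n × Fin n, p ≠ (o, o) → slHom n K W p.1 p.2 = (1 : Matrix (Fin n) (Fin n) K) p.1 p.2 := by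
    intro p hp
    have := h ((gr g n - 1) p.1 p.2) (by unfold eqs; exact Finset.mem_union_right _ (Finset.mem_image_of_mem _ (Finset.mem_erase.mpr ⟨hp, Finset.mem_univ _⟩)))
    rw [← h1, Matrix.map_apply]
    rw [Matrix.sub_apply, map_sub, sub_eq_zero] at this
    rw [this, Matrix.one_apply, Matrix.one_apply]
    split_ifs <;> simp
  have hdiag : slHom n K W = Matrix.diagonal (fun i => slHom n K W i i) := by
    ext i j
    by_cases hij : i = j
    · subst hij; simp
    · rw [Matrix.diagonal_apply_ne _ hij, hent (i, j) (by rintro ⟨⟩; exact hij rfl), Matrix.one_apply_ne hij]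
  have hoo : slHom n K W o o = 1 := by
    have hd : (slHom n K W).det = 1 := W.2
    rw [hdiag, Matrix.det_diagonal, ← Finset.mul_prod_erase _ _ (Finset.mem_univ o), Finset.prod_eq_one, mul_one] at hd
    · exact hd
    · intro i hi
      rw [hent (i, i) (by rintro ⟨⟩; exact Finset.ne_of_mem_erase hi rfl), Matrix.one_apply_eq]
  rw [map_one, hdiag]
  ext i j
  by_cases hij : i = j
  · subst hij
    rw [Matrix.diagonal_apply_eq, Matrix.one_apply_eq]
    by_cases hi : i = o
    · rw [hi, hoo]
    · rw [hent (i, i) (by rintro ⟨⟩; exact hi rfl), Matrix.one_apply_eq]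
  · rw [Matrix.diagonal_apply_ne _ hij, Matrix.one_apply_ne hij]

theorem rep_eqs (g n : ℕ) (o : Fin n) {K : Type} [CommRing K] (ψ : MvPolynomial ((Fin g × Bool) × Fin n × Fin n) ℂ →+* K)
    (s : Fin g × Bool → SL n K) (hs : ∀ x, (gm g n x).map ψ = slHom n K (s x)) 
    (hrel : (List.ofFn fun i => ⁅s (i, false), s (i, true)⁆).prod = 1) : ∀ q ∈ eqs g n o, ψ q = 0 := by
  classical
  intro q hq
  unfold eqs at hq
  rcases Finset.mem_union.mp hq with hq | hq
  · obtain ⟨x, -, rfl⟩ := Finset.mem_image.mp hq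
    rw [map_sub, map_one, RingHom.map_det, sub_eq_zero]
    exact (congrArg Matrix.det (hs x)).trans (s x).2
  · obtain ⟨p, -, rfl⟩ := Finset.mem_image.mp hq
    have h1 := gr_map g n ψ s hs
    rw [hrel, map_one] at h1
    rw [Matrix.sub_apply, map_sub, ← Matrix.map_apply (f := ψ), h1, Matrix.one_apply, Matrix.one_apply]
    split_ifs <;> simp

end G5
end PartG5

section PartG6
section G6
open Module

theorem exists_algInd {k R : Type} [Field k] [CommRing R] [IsDomain R] [Algebra k R] (D : ℕ)
    (h : (D : Cardinal) ≤ Algebra.trdeg k R) : ∃ y : Fin D → R, AlgebraicIndependent k y := by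
  obtain ⟨s, hs⟩ := exists_isTranscendenceBasis k R
  rw [← hs.cardinalMk_eq_trdeg] at h
  have h' : Cardinal.mk (Fin D) ≤ Cardinal.mk s := by simpa using h
  obtain ⟨e⟩ := h'
  exact ⟨fun i => e i, hs.1.comp e e.injective⟩

theorem G6_prime {g n : ℕ} (hg : 2 ≤ g) (hn : 2 ≤ n) (o : Fin n) (p : Ideal (MvPolynomial ((Fin g × Bool) × Fin n × Fin n) ℂ))
    (hp : p ∈ (Ideal.span (eqs g n o : Set (MvPolynomial ((Fin g × Bool) × Fin n × Fin n) ℂ))).minimalPrimes) :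
    ∃ i, ∃ f : Fin n × Fin n → Option (Bool × Fin n × Fin n), ((Cm o (gm g n (i, false)) (gm g n (i, true))).submatrix f id).det ∉ p := by
  classical
  haveI : p.IsPrime := hp.1.1
  have htr := G1_main (eqs g n o) p hp
  have hD : (2 * g - 1) * (n ^ 2 - 1) ≤ Fintype.card ((Fin g × Bool) × Fin n × Fin n) - (eqs g n o).card := by
    have h1 := eqs_card g n o
    have h2 : Fintype.card ((Fin g × Bool) × Fin n × Fin n) = 2 * g * n ^ 2 := by
      simp only [Fintype.card_prod, Fintype.card_fin, Fintype.card_bool]; ring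
    rw [h2]
    have h3 : 1 ≤ n ^ 2 := Nat.one_le_pow _ _ (by omega)
    obtain ⟨m, hm⟩ := Nat.exists_eq_add_of_le h3
    rw [hm] at h1 ⊢
    have h5 : (2 * g - 1) * (1 + m - 1) + (2 * g + (1 + m - 1)) = 2 * g * (1 + m) := by
      obtain ⟨r, hr⟩ := Nat.exists_eq_add_of_le (show 1 ≤ 2 * g by omega)
      rw [hr]; simp; ring
    omega
  obtain ⟨y, hy⟩ := exists_algInd _ ((Nat.cast_le.mpr hD).trans htr)
  let R' := MvPolynomial ((Fin g × Bool) × Fin n × Fin n) ℂ ⧸ p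
  let L := FractionRing R'
  let φ : R' →ₐ[ℂ] Om L := IsScalarTower.toAlgHom ℂ R' (Om L)
  have hφ : Function.Injective φ := by
    show Function.Injective (algebraMap R' (Om L))
    rw [IsScalarTower.algebraMap_eq R' L (Om L)]
    exact (algebraMap L (Om L)).injective.comp (IsFractionRing.injective _ _)
  let ψ : MvPolynomial ((Fin g × Bool) × Fin n × Fin n) ℂ →ₐ[ℂ] Om L := φ.comp (Ideal.Quotient.mkₐ ℂ p)
  have hψ : ∀ q, ψ q = 0 ↔ q ∈ p := by
    intro q
    show φ (Ideal.Quotient.mk p q) = 0 ↔ _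
    rw [map_eq_zero_iff φ hφ, Ideal.Quotient.eq_zero_iff_mem]
  obtain ⟨s, hs, hrel⟩ := eqs_rep g n o (ψ : _ →+* Om L) (fun q hq => (hψ q).mpr (hp.1.2 (Ideal.subset_span hq)))
  have hsx : ∀ x i j, slHom n (Om L) (s x) i j = ψ (X (x, i, j)) := by
    intro x i j
    rw [← hs x]; rfl
  have hmem : ∀ q, ψ q ∈ clF ℂ (⋃ x, ent (slHom n (Om L) (s x))) := by
    intro q
    induction q using MvPolynomial.induction_on with
    | C a => 
      have : ψ (C a) = algebraMap ℂ (Om L) a := ψ.commutes a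
      rw [this]; exact IntermediateField.algebraMap_mem _ _
    | add a b ha hb => rw [map_add]; exact add_mem ha hb
    | mul_X a x ha =>
      rw [map_mul]
      refine mul_mem ha (subset_clF _ (Set.mem_iUnion.mpr ⟨x.1, ?_⟩))
      rw [← hsx x.1 x.2.1 x.2.2]; exact ent_mem _ _ _
  haveI : FaithfulSMul ℂ (Om L) := (faithfulSMul_iff_algebraMap_injective ℂ (Om L)).mpr (algebraMap ℂ (Om L)).injective
  haveI : CharZero (Om L) := charZero_of_injective_algebraMap (algebraMap ℂ (Om L)).injective
  have hyi : AlgebraicIndependent ℂ (φ ∘ y) := hy.map' hφ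
  have hrk : (((2 * g - 1) * (n ^ 2 - 1) : ℕ) : ℕ∞) ≤ (AM ℂ (Om L)).eRk (⋃ x, ent (slHom n (Om L) (s x))) := by
    have h1 : (AM ℂ (Om L)).Indep (Set.range (φ ∘ y)) := by
      rw [AlgebraicIndependent.matroid_indep_iff]
      exact hyi.to_subtype_range
    have h2 := eRk_le_of_subset_clF (k := ℂ) (S := Set.range (φ ∘ y)) (T := ⋃ x, ent (slHom n (Om L) (s x))) (by
      rintro _ ⟨i, rfl⟩
      obtain ⟨q, hq⟩ := Ideal.Quotient.mk_surjective (y i)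
      have := hmem q
      rw [show ψ q = φ (y i) from congrArg φ hq] at this
      exact this)
    rw [h1.eRk_eq_encard] at h2
    refine le_trans ?_ h2
    rw [← Set.image_univ, hyi.injective.encard_image, Set.encard_univ]
    simp
  obtain ⟨i, hi⟩ := G4_main (k := ℂ) hg hn s hrel hrk (fun m => by
    obtain ⟨t, ht⟩ := Om_t ℂ L m
    refine ⟨t, fun S hS => ht S (hS.trans ?_)⟩
    refine Set.iUnion_subset fun x => ent_subset.mpr fun i j => ?_
    rw [hsx]
    exact ⟨algebraMap R' L (Ideal.Quotient.mk p (X (x, i, j))), rfl⟩)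
  have hsc : ∀ Y : Matrix (Fin n) (Fin n) (Om L), Y * slHom n (Om L) (s (i, false)) = slHom n (Om L) (s (i, false)) * Y →
      Y * slHom n (Om L) (s (i, true)) = slHom n (Om L) (s (i, true)) * Y → ∃ c : Om L, Y = c • 1 := by
    intro Y h1 h2
    have h1n : (1 : Matrix (Fin n) (Fin n) (Om L)) ≠ 0 := by
      intro h
      have := congrFun (congrFun h o) o
      simp at this
    obtain ⟨v, hv⟩ := finrank_le_one_iff.mp hi
    obtain ⟨c, hc⟩ := hv ⟨1, mem_Zc.mpr ⟨by simp, by simp⟩⟩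
    obtain ⟨d, hd⟩ := hv ⟨Y, mem_Zc.mpr ⟨h1, h2⟩⟩
    have hc' : c • (v : Matrix (Fin n) (Fin n) (Om L)) = 1 := congrArg Subtype.val hc
    have hd' : d • (v : Matrix (Fin n) (Fin n) (Om L)) = Y := congrArg Subtype.val hd
    have hc0 : c ≠ 0 := by rintro rfl; rw [zero_smul] at hc'; exact h1n hc'.symm
    refine ⟨d * c⁻¹, ?_⟩
    rw [← hd', ← hc', smul_smul, mul_assoc, inv_mul_cancel₀ hc0, mul_one]
  obtain ⟨f, hf⟩ := exists_minor _ ((Cm_ker o _ _).mpr hsc)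
  refine ⟨i, f, fun hm => hf ?_⟩
  have h1 := (hψ _).mpr hm
  rw [AlgHom.map_det] at h1
  rw [← h1, ← hs, ← hs, ← Cm_map]
  rfl

theorem G6_main {g n : ℕ} (hg : 2 ≤ g) (hn : 2 ≤ n) (P : MvPolynomial ((Fin g × Bool) × Fin n × Fin n) ℂ)
    (hP : ∀ B ∈ RepVariety g n ℂ, (∃ i, ∀ Y : Matrix (Fin n) (Fin n) ℂ, Y * B (i, false) = B (i, false) * Y →
      Y * B (i, true) = B (i, true) * Y → ∃ c : ℂ, Y = c • 1) → eval (fun p => B p.1 p.2.1 p.2.2) P = 0) :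
    ∀ B ∈ RepVariety g n ℂ, eval (fun p => B p.1 p.2.1 p.2.2) P = 0 := by
  classical
  let o : Fin n := ⟨0, by omega⟩
  set I := Ideal.span (eqs g n o : Set (MvPolynomial ((Fin g × Bool) × Fin n × Fin n) ℂ)) with hI
  have hrad : P ∈ I.radical := by
    rw [← Ideal.sInf_minimalPrimes, Submodule.mem_sInf]
    intro p hp
    haveI hpp : Ideal.IsPrime p := hp.1.1
    obtain ⟨i, f, hf⟩ := G6_prime hg hn o p hp
    have hmul : P * ((Cm o (gm g n (i, false)) (gm g n (i, true))).submatrix f id).det ∈ p := by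
      rw [← MvPolynomial.IsPrime.vanishingIdeal_zeroLocus (K := ℂ) p, mem_vanishingIdeal_iff]
      intro x hx
      rw [map_mul]
      by_cases hz : aeval x ((Cm o (gm g n (i, false)) (gm g n (i, true))).submatrix f id).det = 0
      · rw [hz, mul_zero]
      · obtain ⟨s, hs, hrel⟩ := eqs_rep g n o ((aeval x : _ →ₐ[ℂ] ℂ) : _ →+* ℂ) (fun q hq => hx q (hp.1.2 (Ideal.subset_span hq)))
        have hB : (fun y => (gm g n y).map (aeval x : _ →ₐ[ℂ] ℂ)) ∈ RepVariety g n ℂ := (rep_iff _).mpr ⟨s, hs, hrel⟩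
        have := hP _ hB ⟨i, by
          refine (Cm_ker o _ _).mp (of_minor _ f ?_)
          rw [AlgHom.map_det] at hz
          have h2 := Cm_map ((aeval x : _ →ₐ[ℂ] ℂ) : MvPolynomial ((Fin g × Bool) × Fin n × Fin n) ℂ →+* ℂ) o (gm g n (i, false)) (gm g n (i, true))
          have h3 : Cm o ((gm g n (i, false)).map (aeval x : _ →ₐ[ℂ] ℂ)) ((gm g n (i, true)).map (aeval x : _ →ₐ[ℂ] ℂ)) = (Cm o (gm g n (i, false)) (gm g n (i, true))).map ((aeval x : _ →ₐ[ℂ] ℂ) : MvPolynomial ((Fin g × Bool) × Fin n × Fin n) ℂ →+* ℂ) := h2.symm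
          rw [h3]
          exact hz⟩
        have hx2 : (fun p : (Fin g × Bool) × Fin n × Fin n => ((gm g n p.1).map (aeval x : _ →ₐ[ℂ] ℂ)) p.2.1 p.2.2) = x := by
          ext p; simp [gm]
        rw [hx2] at this
        rw [MvPolynomial.aeval_eq_eval]
        simp [this]
    exact (Ideal.IsPrime.mem_or_mem hpp hmul).resolve_right hf
  intro B hB
  obtain ⟨s, hs, hrel⟩ := (rep_iff _).mp hB
  obtain ⟨m, hm⟩ := hrad
  have h0 := rep_eqs g n o (eval (fun p => B p.1 p.2.1 p.2.2)) s (fun x => by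
    rw [← hs x]; ext i j; simp [gm]) hrel
  have h1 : I ≤ RingHom.ker (eval (fun p : (Fin g × Bool) × Fin n × Fin n => B p.1 p.2.1 p.2.2)) := by
    rw [hI, Ideal.span_le]; exact h0
  have h2 := h1 hm
  rw [RingHom.mem_ker, map_pow] at h2
  exact eq_zero_of_pow_eq_zero h2

end G6
end PartG6

section PartC1
section C1
open Matrix.SpecialLinearGroup

theorem diag2n_decompose {ι F : Type} [Fintype ι] [DecidableEq ι] [Field F] {i j : ι} (hij : i ≠ j) (a : F) (ha : a ≠ 0) :
    diag2n hij a ha = SpecialLinearGroup.transvection hij a *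
      SpecialLinearGroup.transvection hij.symm (- a⁻¹) *
      SpecialLinearGroup.transvection hij a *
      SpecialLinearGroup.transvection hij (-1) *
      SpecialLinearGroup.transvection hij.symm 1 *
      SpecialLinearGroup.transvection hij (-1) := by
  have h : (diag2n hij a ha).1 = 1 + Matrix.single i i (a - 1) + Matrix.single j j (a⁻¹ - 1) := by
    rw [diag2n_coe]
    ext x y
    simp only [Matrix.diagonal_apply, Matrix.add_apply, Matrix.one_apply, Matrix.single_apply]
    by_cases hxi : x = i
    · subst hxi
      by_cases hxy : x = y
      · subst hxy; simp [hij.symm]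
      · simp [hxy, hij.symm]
    · by_cases hxj : x = j
      · subst hxj
        by_cases hxy : x = y
        · subst hxy; simp [hij, hxi]
        · simp [hxy, hij]
      · by_cases hxy : x = y
        · subst hxy; simp [Ne.symm hxi, Ne.symm hxj, hxi, hxj]
        · simp [hxy, Ne.symm hxi, Ne.symm hxj]
  apply coeMonoidHom_injective
  rw [coeMonoidHom_apply, h]
  simp only [map_mul, coeMonoidHom_apply, transvection_coe, mul_add, add_mul, mul_one, one_mul, Matrix.single_mul_single_same,
    Matrix.single_mul_single_of_ne _ _ _ _ hij, Matrix.single_mul_single_of_ne _ _ _ _ hij.symm, mul_neg, neg_mul, mul_inv_cancel₀ ha,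
    inv_mul_cancel₀ ha, neg_neg, add_zero, zero_add]
  simp only [sub_eq_add_neg, Matrix.single_add, ← Matrix.single_neg]
  abel

theorem SL_ind {n : ℕ} (hn : 2 ≤ n) {K : Type} [Field K] (P : SL n K → Prop)
    (ht : ∀ (i j : Fin n) (hij : i ≠ j) (a : K), P (SpecialLinearGroup.transvection hij a))
    (hmul : ∀ A B, P A → P B → P (A * B)) (M : SL n K) : P M := by
  haveI : Nontrivial (Fin n) := Fin.nontrivial_iff_two_le.mpr hn
  refine diagonal_transvection_induction' P M (fun i j hij c hc => ?_) ht hmul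
  rw [diag2n_decompose]
  refine hmul _ _ (hmul _ _ (hmul _ _ (hmul _ _ (hmul _ _ ?_ ?_) ?_) ?_) ?_) ?_
  all_goals exact ht _ _ _ _

theorem map_transv {n : ℕ} {R S : Type} [CommRing R] [CommRing S] (φ : R →+* S) {i j : Fin n} (hij : i ≠ j) (a : R) :
    SpecialLinearGroup.map φ (SpecialLinearGroup.transvection hij a) = SpecialLinearGroup.transvection hij (φ a) := by
  ext x y
  simp [transvection_coe, Matrix.one_apply, Matrix.single_apply, apply_ite φ]

theorem SL_curve {n : ℕ} (hn : 2 ≤ n) {R K0 K : Type} [CommRing R] [CommRing K0] [Field K] (φ0 : R →+* K0) (φ1 : R →+* K)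
    (h : ∀ u : K, ∃ r, φ0 r = 0 ∧ φ1 r = u) (A : SL n K) :
    ∃ σ : SL n R, SpecialLinearGroup.map φ0 σ = 1 ∧ SpecialLinearGroup.map φ1 σ = A := by
  refine SL_ind hn (fun A => ∃ σ : SL n R, SpecialLinearGroup.map φ0 σ = 1 ∧ SpecialLinearGroup.map φ1 σ = A) ?_ ?_ A
  · intro i j hij a
    obtain ⟨r, h0, h1⟩ := h a
    refine ⟨SpecialLinearGroup.transvection hij r, ?_, ?_⟩
    · rw [map_transv, h0, transvection_coeff_zero]
    · rw [map_transv, h1]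
  · rintro A B ⟨σ, h1, h2⟩ ⟨τ, h3, h4⟩
    exact ⟨σ * τ, by rw [map_mul, h1, h3, one_mul], by rw [map_mul, h2, h4]⟩
end C1
end PartC1

section PartB1
section B1
open Topology Filter
attribute [local instance] Matrix.normedAddCommGroup Matrix.normedSpace

variable {K : Type} [RCLike K] {n : ℕ}

local notation "Mn" => Matrix (Fin n) (Fin n) K

theorem contDiff_entry (i j : Fin n) : ContDiff K ⊤ (fun A : Mn => A i j) :=
  contDiff_apply_apply K K i j

theorem contDiff_det : ContDiff K ⊤ (fun A : Mn => A.det) := by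
  have : (fun A : Mn => A.det) = fun A : Mn => ∑ σ : Equiv.Perm (Fin n), (Equiv.Perm.sign σ : ℤ) • ∏ i, A (σ i) i := by
    funext A; rw [Matrix.det_apply]; rfl
  rw [this]
  refine ContDiff.sum fun σ _ => ?_
  simp only [zsmul_eq_mul]
  exact contDiff_const.mul (contDiff_prod fun i _ => contDiff_entry _ _)

theorem contDiff_mmul {E : Type} [NormedAddCommGroup E] [NormedSpace K E] {f g : E → Mn} (hf : ContDiff K ⊤ f) (hg : ContDiff K ⊤ g) :
    ContDiff K ⊤ (fun x => f x * g x) := by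
  refine contDiff_pi.mpr fun i => contDiff_pi.mpr fun j => ?_
  have : (fun x => (f x * g x) i j) = fun x => ∑ k, f x i k * g x k j := by
    funext x; rw [Matrix.mul_apply]
  show ContDiff K ⊤ (fun x => (f x * g x) i j)
  rw [this]
  refine ContDiff.sum fun k _ => ?_
  exact ((contDiff_entry i k).comp hf).mul ((contDiff_entry k j).comp hg)

/-- the map for the inverse function theorem -/
def Phi (x : Mn × (Mn × Mn × K)) : Mn × (Mn × K × K) :=
  (x.1, (x.2.2.2 • (x.2.1 * x.2.2.1) - x.1 * x.2.2.1 * x.2.1, x.2.1.det, x.2.2.1.det))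

theorem contDiff_Phi : ContDiff K ⊤ (Phi (K := K) (n := n)) := by
  have hA : ContDiff K ⊤ (fun x : Mn × (Mn × Mn × K) => x.2.1) := contDiff_fst.comp contDiff_snd
  have hB : ContDiff K ⊤ (fun x : Mn × (Mn × Mn × K) => x.2.2.1) := contDiff_fst.comp (contDiff_snd.comp contDiff_snd)
  have hs : ContDiff K ⊤ (fun x : Mn × (Mn × Mn × K) => x.2.2.2) := contDiff_snd.comp (contDiff_snd.comp contDiff_snd)
  refine contDiff_fst.prodMk (ContDiff.prodMk (ContDiff.sub (hs.smul (contDiff_mmul hA hB)) (contDiff_mmul (contDiff_mmul contDiff_fst hB) hA)) (ContDiff.prodMk (contDiff_det.comp hA) (contDiff_det.comp hB)))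

theorem hasDeriv_det (A a : Mn) (hA : A.det = 1) : HasDerivAt (fun t : K => (A + t • a).det) (A⁻¹ * a).trace 0 := by
  have hu : IsUnit A.det := by rw [hA]; exact isUnit_one
  have h1 : (fun t : K => (A + t • a).det) = fun t => ((1 + (Polynomial.X : Polynomial K) • (A⁻¹ * a).map Polynomial.C).det).eval t := by
    funext t
    have h2 : A + t • a = A * (1 + t • (A⁻¹ * a)) := by
      rw [mul_add, mul_one, mul_smul_comm, ← mul_assoc, Matrix.mul_nonsing_inv _ hu, one_mul]
    rw [h2, Matrix.det_mul, hA, one_mul, ← Polynomial.coe_evalRingHom, RingHom.map_det]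
    generalize A⁻¹ * a = M
    congr 1
    ext i j
    simp [Matrix.one_apply, apply_ite (Polynomial.eval t)]
    exact mul_comm _ _
  rw [h1, ← Matrix.derivative_det_one_add_X_smul]
  exact Polynomial.hasDerivAt _ _

theorem hasDeriv_mmul {f g : K → Mn} {f' g' : Mn} {t : K} (hf : HasDerivAt f f' t) (hg : HasDerivAt g g' t) :
    HasDerivAt (fun x => f x * g x) (f' * g t + f t * g') t := by
  refine hasDerivAt_pi.mpr fun i => hasDerivAt_pi.mpr fun j => ?_
  have hf2 : ∀ i j, HasDerivAt (fun x => f x i j) (f' i j) t := fun i j => hasDerivAt_pi.mp (hasDerivAt_pi.mp hf i) j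
  have hg2 : ∀ i j, HasDerivAt (fun x => g x i j) (g' i j) t := fun i j => hasDerivAt_pi.mp (hasDerivAt_pi.mp hg i) j
  have : (fun x => (f x * g x) i j) = fun x => ∑ k, f x i k * g x k j := by
    funext x; rw [Matrix.mul_apply]
  show HasDerivAt (fun x => (f x * g x) i j) ((f' * g t + f t * g') i j) t
  rw [this, Matrix.add_apply, Matrix.mul_apply, Matrix.mul_apply, ← Finset.sum_add_distrib]
  exact HasDerivAt.fun_sum fun k _ => (hf2 i k).mul (hg2 k j)

theorem Phi_fderiv (A B W : Mn) (hA : A.det = 1) (hB : B.det = 1) (w a b : Mn) (σ : K) :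
    fderiv K (Phi (K := K) (n := n)) (W, (A, B, 1)) (w, (a, b, σ)) = (w, TS A B W (a, b, σ) - (w * B * A, 0, 0)) := by
  have h1 : HasFDerivAt (Phi (K := K) (n := n)) (fderiv K Phi (W, (A, B, 1))) (W, (A, B, 1)) :=
    (contDiff_Phi.differentiable (by simp) _).hasFDerivAt
  have hline : ∀ {E : Type} [NormedAddCommGroup E] [NormedSpace K E] (x y : E), HasDerivAt (fun t : K => x + t • y) y 0 := by
    intro E _ _ x y
    simpa using ((hasDerivAt_id (0 : K)).smul_const y).const_add x
  have h2 := hline ((W, (A, B, (1 : K))) : Mn × (Mn × Mn × K)) (w, (a, b, σ))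
  have h3 : HasDerivAt (fun t : K => Phi (((W, (A, B, (1 : K))) : Mn × (Mn × Mn × K)) + t • (w, (a, b, σ)))) (fderiv K Phi (W, (A, B, 1)) (w, (a, b, σ))) 0 := by
    have h1' : HasFDerivAt (Phi (K := K) (n := n)) (fderiv K Phi (W, (A, B, 1))) (((W, (A, B, (1 : K))) : Mn × (Mn × Mn × K)) + (0 : K) • (w, (a, b, σ))) := by
      rw [zero_smul, add_zero]; exact h1
    exact HasFDerivAt.comp_hasDerivAt (0 : K) h1' h2
  have h4 : HasDerivAt (fun t : K => Phi (((W, (A, B, (1 : K))) : Mn × (Mn × Mn × K)) + t • (w, (a, b, σ)))) 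
      (w, (σ • (A * B) + (a * B + A * b) - ((w * B + W * b) * A + W * B * a), (A⁻¹ * a).trace, (B⁻¹ * b).trace)) 0 := by
    refine HasDerivAt.prodMk (hline W w) (HasDerivAt.prodMk ?_ (HasDerivAt.prodMk (hasDeriv_det A a hA) (hasDeriv_det B b hB)))
    refine HasDerivAt.sub ?_ ?_
    · have := (hline (1 : K) σ).smul (hasDeriv_mmul (hline A a) (hline B b))
      simp only [zero_smul, add_zero, one_smul] at this
      rw [add_comm (σ • (A * B))]
      exact this
    · have := hasDeriv_mmul (hasDeriv_mmul (hline W w) (hline B b)) (hline A a)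
      simp only [zero_smul, add_zero] at this
      exact this
  rw [h3.unique h4]
  refine Prod.ext rfl (Prod.ext ?_ (Prod.ext ?_ ?_))
  · simp only [TS, TD, LinearMap.coe_mk, AddHom.coe_mk, Prod.fst_sub]
    noncomm_ring
  · simp [TS]
  · simp [TS]

theorem local_section {E F : Type} [NormedAddCommGroup E] [NormedSpace K E] [NormedAddCommGroup F] [NormedSpace K F]
    [FiniteDimensional K E] [FiniteDimensional K F] (Φ : E → F) (p0 : E) (hΦ : ContDiff K ⊤ Φ)
    (hs : ∀ y, ∃ x, fderiv K Φ p0 x = y) :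
    ∃ q : F → E, q (Φ p0) = p0 ∧ ∀ᶠ y in 𝓝 (Φ p0), ContinuousAt q y ∧ Φ (q y) = y := by
  haveI : CompleteSpace F := FiniteDimensional.complete K _
  have hsurj : LinearMap.range ((fderiv K Φ p0 : E →L[K] F) : E →ₗ[K] F) = ⊤ := LinearMap.range_eq_top.mpr hs
  obtain ⟨R, hR⟩ := LinearMap.exists_rightInverse_of_surjective _ hsurj
  let R' : F →L[K] E := LinearMap.toContinuousLinearMap R
  have hstrict : HasStrictFDerivAt Φ (fderiv K Φ p0) p0 :=
    hΦ.contDiffAt.hasStrictFDerivAt (by simp)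
  have h2 : HasStrictFDerivAt (fun z => Φ (p0 + R' z)) ((ContinuousLinearEquiv.refl K F : F →L[K] F)) 0 := by
    have h3 : HasStrictFDerivAt (fun z => p0 + R' z) R' 0 := R'.hasStrictFDerivAt.const_add p0
    have h4 : HasStrictFDerivAt Φ (fderiv K Φ p0) (p0 + R' 0) := by
      rw [map_zero, add_zero]; exact hstrict
    have h5 := h4.comp 0 h3
    have hid : (fderiv K Φ p0).comp R' = (ContinuousLinearEquiv.refl K F : F →L[K] F) :=
      ContinuousLinearMap.ext fun z => LinearMap.congr_fun hR z
    rw [hid] at h5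
    exact h5
  let e := h2.toOpenPartialHomeomorph _
  have he : ∀ z, e z = Φ (p0 + R' z) := fun z => rfl
  have hsrc : (0 : F) ∈ e.source := h2.mem_toOpenPartialHomeomorph_source
  have he0 : e 0 = Φ p0 := by rw [he, map_zero, add_zero]
  have htgt : Φ p0 ∈ e.target := by rw [← he0]; exact e.map_source hsrc
  refine ⟨fun y => p0 + R' (e.symm y), ?_, ?_⟩
  · show p0 + R' (e.symm (Φ p0)) = p0
    rw [← he0, e.left_inv hsrc, map_zero, add_zero]
  · filter_upwards [e.open_target.mem_nhds htgt] with y hy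
    refine ⟨continuousAt_const.add (R'.continuous.continuousAt.comp (e.continuousAt_symm hy)), ?_⟩
    have := e.right_inv hy
    rwa [he] at this

theorem IFT (hn : 2 ≤ n) (A B W0 : Mn) (hA : A.det = 1) (hB : B.det = 1) (hW : W0 * B * A = A * B)
    (htriv : ∀ Y : Mn, Y * A = A * Y → Y * B = B * Y → ∃ c : K, Y = c • 1) :
    ∃ ψ : Mn → Mn × Mn, ψ W0 = (A, B) ∧ ∀ᶠ W in 𝓝 W0, ContinuousAt ψ W ∧ (W.det = 1 → (ψ W).1.det = 1 ∧ (ψ W).2.det = 1 ∧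
      (ψ W).1 * (ψ W).2 = W * (ψ W).2 * (ψ W).1) := by
  have hu : ∀ {C : Mn}, C.det = 1 → IsUnit C := fun {C} h => (Matrix.isUnit_iff_isUnit_det _).mpr (by rw [h]; exact isUnit_one)
  have hn0 : (n : K) ≠ 0 := by exact_mod_cast (by omega : n ≠ 0)
  set p0 : Mn × (Mn × Mn × K) := (W0, (A, B, 1)) with hp0
  have hsurj : ∀ y, ∃ x, fderiv K (Phi (K := K) (n := n)) p0 x = y := by
    have hT := TS_surj (hu hA) (hu hB) hW hn0 (fun Y hY => htriv Y (mem_Zc.mp hY).1 (mem_Zc.mp hY).2)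
    rw [LinearMap.range_eq_top] at hT
    rintro ⟨w, y⟩
    obtain ⟨⟨a, b, σ⟩, h⟩ := hT (y + (w * B * A, 0, 0))
    refine ⟨(w, (a, b, σ)), ?_⟩
    show fderiv K (Phi (K := K) (n := n)) (W0, (A, B, 1)) (w, (a, b, σ)) = _
    rw [Phi_fderiv A B W0 hA hB, h, add_sub_cancel_right]
  have hy0 : Phi p0 = (W0, ((0 : Mn), (1 : K), (1 : K))) := by
    simp [Phi, hp0, hA, hB, hW]
  obtain ⟨r, hr0, hr⟩ := local_section (Phi (K := K) (n := n)) p0 contDiff_Phi hsurj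
  rw [hy0] at hr0 hr
  let ι : Mn → Mn × (Mn × K × K) := fun W => (W, ((0 : Mn), (1 : K), (1 : K)))
  have hι : Continuous ι := continuous_id.prodMk continuous_const
  let q : Mn → Mn × (Mn × Mn × K) := fun W => r (ι W)
  have hq0 : q W0 = p0 := hr0
  have hev : ∀ᶠ W in 𝓝 W0, ContinuousAt r (ι W) ∧ Phi (r (ι W)) = ι W := hι.continuousAt.eventually hr
  have hqc : ∀ W, ContinuousAt r (ι W) → ContinuousAt q W := by
    intro W hWt
    exact hWt.comp hι.continuousAt
  have hroot : ∀ᶠ s in 𝓝 (1 : K), s ^ n = 1 → s = 1 := by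
    have hfin : {s : K | s ^ n = 1 ∧ s ≠ 1}.Finite := by
      refine Set.Finite.subset (Polynomial.nthRootsFinset n (1 : K)).finite_toSet ?_
      rintro s ⟨hs, -⟩
      exact (Polynomial.mem_nthRootsFinset (by omega) _).mpr hs
    have := hfin.isClosed.isOpen_compl.mem_nhds (x := (1 : K)) (by simp)
    filter_upwards [this] with s hs hs1
    by_contra h
    exact hs ⟨hs1, h⟩
  refine ⟨fun W => ((q W).2.1, (q W).2.2.1), by simp [hq0, hp0], ?_⟩
  have hs : ∀ᶠ W in 𝓝 W0, ((q W).2.2.2) ^ n = 1 → (q W).2.2.2 = 1 := by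
    have hc : Tendsto (fun W => (q W).2.2.2) (𝓝 W0) (𝓝 1) := by
      have h6 : ContinuousAt (fun W => (q W).2.2.2) W0 := (hqc W0 hev.self_of_nhds.1).snd.snd.snd
      have h7 : (q W0).2.2.2 = 1 := by rw [hq0]
      rw [← h7]; exact h6
    exact hc.eventually hroot
  filter_upwards [hev, hs] with W h1 h3
  refine ⟨(hqc W h1.1).snd.fst.prodMk (hqc W h1.1).snd.snd.fst, fun hdet => ?_⟩
  have h4 : Phi (q W) = ι W := h1.2
  have h5 : (q W).1 = W := congrArg Prod.fst h4
  have h6 : (q W).2.2.2 • ((q W).2.1 * (q W).2.2.1) - (q W).1 * (q W).2.2.1 * (q W).2.1 = 0 := congrArg (fun x => x.2.1) h4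
  have h7 : (q W).2.1.det = 1 := congrArg (fun x => x.2.2.1) h4
  have h8 : (q W).2.2.1.det = 1 := congrArg (fun x => x.2.2.2) h4
  rw [sub_eq_zero, h5] at h6
  have h9 : (q W).2.2.2 = 1 := h3 (by
    have := congrArg Matrix.det h6
    rw [Matrix.det_smul, Matrix.det_mul, Matrix.det_mul, Matrix.det_mul, hdet, h7, h8] at this
    simpa using this)
  rw [h9, one_smul] at h6
  exact ⟨h7, h8, h6⟩
end B1
end PartB1

section PartQ1
section Q1
variable {n : ℕ} {R S : Type} [CommRing R] [CommRing S]

theorem det_rank_one_aux (M : Matrix (Fin n) (Fin n) R) (u v : Fin n → R) (hM : M.det ∈ nonZeroDivisors R) :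
    (M + vecMulVec u v).det = M.det + v ⬝ᵥ (M.adjugate *ᵥ u) := by
  have h1 : M.adjugate * (M + vecMulVec u v) = M.det • 1 + vecMulVec (M.adjugate *ᵥ u) v := by
    rw [mul_add, adjugate_mul, mul_vecMulVec]
  have h2 : ∀ (d : R) (w v : Fin n → R), d * (d • (1 : Matrix (Fin n) (Fin n) R) + vecMulVec w v).det = d ^ n * (d + v ⬝ᵥ w) := by
    intro d w v
    have h3 : (d • (1 : Matrix (Fin n) (Fin n) R) + vecMulVec w v) = Matrix.scalar (Fin n) d - (- vecMulVec w v) := by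
      rw [sub_neg_eq_add]; congr 1; ext i j; simp [Matrix.one_apply, Matrix.diagonal_apply]
    rw [h3, ← Matrix.eval_charpoly, ← neg_vecMulVec, charpoly_vecMulVec]
    rcases n with _ | m
    · simp
    · simp only [Fintype.card_fin, Polynomial.eval_sub, Polynomial.eval_pow, Polynomial.eval_X, Polynomial.eval_smul, Polynomial.eval_mul,
        Polynomial.eval_C, smul_eq_mul, dotProduct_neg, neg_dotProduct, add_tsub_cancel_right, dotProduct_comm w v]
      ring
  have h4 := congrArg (fun x => M.det * x.det) h1
  simp only [det_mul] at h4
  rw [h2] at h4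
  rcases n with _ | m
  · simp
  · rw [det_adjugate, Fintype.card_fin, add_tsub_cancel_right] at h4
    have h5 : M.det ^ (m+1) * (M + vecMulVec u v).det = M.det ^ (m+1) * (M.det + v ⬝ᵥ (M.adjugate *ᵥ u)) := by
      rw [← h4]; ring
    have h6 : M.det ^ (m+1) ∈ nonZeroDivisors R := pow_mem hM _
    exact (mul_cancel_left_mem_nonZeroDivisors h6).mp h5

theorem det_rank_one (M : Matrix (Fin n) (Fin n) R) (u v : Fin n → R) :
    (M + vecMulVec u v).det = M.det + v ⬝ᵥ (M.adjugate *ᵥ u) := by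
  have h := det_rank_one_aux (charmatrix (-M)) (fun i => Polynomial.C (u i)) (fun i => Polynomial.C (v i))
    ((Matrix.charpoly_monic (-M)).mem_nonZeroDivisors)
  have h2 := congrArg (Polynomial.evalRingHom 0) h
  have e1 : (charmatrix (-M)).map (Polynomial.evalRingHom 0) = M := by
    ext i j; simp [charmatrix_apply, Matrix.diagonal_apply]; split_ifs <;> simp
  have e2 : (vecMulVec (fun i => Polynomial.C (u i)) (fun i => Polynomial.C (v i))).map (Polynomial.evalRingHom 0) = vecMulVec u v := by
    ext i j; simp [vecMulVec_apply]
  rw [RingHom.map_det, map_add, map_add, RingHom.map_det] at h2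
  rw [RingHom.mapMatrix_apply, RingHom.mapMatrix_apply, e1, e2] at h2
  rw [h2, RingHom.map_dotProduct]
  congr 2
  · ext i; simp
  · ext k
    rw [Function.comp_apply, RingHom.map_mulVec, ← RingHom.mapMatrix_apply, RingHom.map_adjugate, RingHom.mapMatrix_apply, e1]
    have : ⇑(Polynomial.evalRingHom (0:R)) ∘ (fun i => Polynomial.C (u i)) = u := by ext i; simp
    rw [this]

def pert (c : Matrix (Fin n) (Fin n) R) (a : Fin n → R) : Matrix (Fin n) (Fin n) R := c + vecMulVec a 1

noncomputable def th (c W : Matrix (Fin n) (Fin n) R) (a : Fin n → R) : Fin n → R := fun j =>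
  if (j : ℕ) = 0 then (pert c a).det else (pert c a).charpoly.coeff j - (W * pert c a).charpoly.coeff j

noncomputable def TM (c W : Matrix (Fin n) (Fin n) R) : Matrix (Fin n) (Fin n) R :=
  Matrix.of fun i j => th c W (Pi.single j 1) i - th c W 0 i

noncomputable def Del (c W : Matrix (Fin n) (Fin n) R) : R := (TM c W).det

theorem pert_map (φ : R →+* S) (c : Matrix (Fin n) (Fin n) R) (a : Fin n → R) :
    (pert c a).map φ = pert (c.map φ) (fun i => φ (a i)) := by
  ext i j; simp [pert, vecMulVec_apply]

theorem th_map (φ : R →+* S) (c W : Matrix (Fin n) (Fin n) R) (a : Fin n → R) (j : Fin n) :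
    φ (th c W a j) = th (c.map φ) (W.map φ) (fun i => φ (a i)) j := by
  unfold th
  split_ifs
  · rw [RingHom.map_det, RingHom.mapMatrix_apply, pert_map]
  · rw [map_sub, ← Polynomial.coeff_map, ← Polynomial.coeff_map, ← Matrix.charpoly_map, ← Matrix.charpoly_map,
      Matrix.map_mul, pert_map]

theorem TM_map (φ : R →+* S) (c W : Matrix (Fin n) (Fin n) R) :
    (TM c W).map φ = TM (c.map φ) (W.map φ) := by
  ext i j
  have h1 : (fun k => φ ((Pi.single j 1 : Fin n → R) k)) = Pi.single j 1 := by
    ext k; by_cases h : k = j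
    · subst h; simp
    · simp [h]
  have h2 : (fun k => φ ((0 : Fin n → R) k)) = 0 := by ext k; simp
  simp only [TM, Matrix.map_apply, Matrix.of_apply, map_sub, th_map, h1, h2]

theorem Del_map (φ : R →+* S) (c W : Matrix (Fin n) (Fin n) R) :
    φ (Del c W) = Del (c.map φ) (W.map φ) := by
  unfold Del; rw [RingHom.map_det, RingHom.mapMatrix_apply, TM_map]

theorem sum_single_lin {M : Type} [AddCommGroup M] [Module R M] (f : (Fin n → R) → M)
    (hf : ∃ L : (Fin n → R) →ₗ[R] M, ∀ a, f a = f 0 + L a) (a : Fin n → R) :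
    f a = f 0 + ∑ j, a j • (f (Pi.single j 1) - f 0) := by
  obtain ⟨L, hL⟩ := hf
  rw [hL a]
  congr 1
  have : ∀ j, f (Pi.single j 1) - f 0 = L (Pi.single j 1) := fun j => by rw [hL (Pi.single j 1)]; simp
  simp only [this]
  conv_lhs => rw [← Finset.univ_sum_single a]
  rw [map_sum]
  refine Finset.sum_congr rfl fun j _ => ?_
  rw [← map_smul]; congr 1; ext k; by_cases h : k = j
  · subst h; simp
  · simp [h]

theorem charpoly_pert_lin (W c : Matrix (Fin n) (Fin n) R) (j : ℕ) :
    ∃ L : (Fin n → R) →ₗ[R] R, ∀ a, (W * pert c a).charpoly.coeff j = (W * pert c 0).charpoly.coeff j + L a := by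
  let C1 : R →+* Polynomial R := Polynomial.C
  let M0 : Matrix (Fin n) (Fin n) (Polynomial R) := charmatrix (W * c)
  have key : ∀ a, (W * pert c a).charpoly = M0.det + (1 : Fin n → Polynomial R) ⬝ᵥ (M0.adjugate *ᵥ (fun i => - Polynomial.C ((W *ᵥ a) i))) := by
    intro a
    rw [← det_rank_one, Matrix.charpoly]
    congr 1
    ext i k
    simp only [M0, charmatrix_apply, pert, mul_add, mul_vecMulVec, Matrix.add_apply, vecMulVec_apply, Pi.one_apply, mul_one, map_add]
    ring
  refine ⟨{ toFun := fun a => ((1 : Fin n → Polynomial R) ⬝ᵥ (M0.adjugate *ᵥ (fun i => - Polynomial.C ((W *ᵥ a) i)))).coeff j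
            map_add' := ?_, map_smul' := ?_ }, ?_⟩
  · intro x y
    rw [← Polynomial.coeff_add, ← dotProduct_add, ← mulVec_add]
    congr 3; ext1 i; simp [mulVec_add]; ring
  · intro r x
    have : (fun i => - Polynomial.C ((W *ᵥ (r • x)) i)) = Polynomial.C r • (fun i => - Polynomial.C ((W *ᵥ x) i)) := by
      ext1 i; simp [mulVec_smul]
    rw [this, mulVec_smul, dotProduct_smul, smul_eq_mul, Polynomial.coeff_C_mul]; simp
  · intro a
    simp only [LinearMap.coe_mk, AddHom.coe_mk]
    rw [key a, key 0, Polynomial.coeff_add, Polynomial.coeff_add]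
    have : (fun i => - Polynomial.C ((W *ᵥ (0 : Fin n → R)) i)) = (0 : Fin n → Polynomial R) := by ext1 i; simp
    rw [this]; simp

theorem th_affine (c W : Matrix (Fin n) (Fin n) R) (a : Fin n → R) : th c W a = th c W 0 + TM c W *ᵥ a := by
  have hl : ∀ i, ∃ L : (Fin n → R) →ₗ[R] R, ∀ a, th c W a i = th c W 0 i + L a := by
    intro i
    unfold th
    split_ifs
    · obtain ⟨L, hL⟩ := charpoly_pert_lin 1 c 0
      refine ⟨((-1)^n : R) • L, fun a => ?_⟩
      have := hL a
      rw [one_mul, one_mul] at this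
      rw [Matrix.det_eq_sign_charpoly_coeff, Matrix.det_eq_sign_charpoly_coeff, this]; simp; ring
    · obtain ⟨L, hL⟩ := charpoly_pert_lin W c i
      obtain ⟨L', hL'⟩ := charpoly_pert_lin 1 c i
      refine ⟨L' - L, fun a => ?_⟩
      have := hL' a
      rw [one_mul, one_mul] at this
      rw [hL a, this]; simp; ring
  ext i
  rw [sum_single_lin (fun a => th c W a i) (hl i) a]
  simp only [Pi.add_apply, Matrix.mulVec, dotProduct, TM, Matrix.of_apply]
  congr 1
  refine Finset.sum_congr rfl fun j _ => ?_
  rw [smul_eq_mul, mul_comm]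

def KM (w : Fin n → R) (A : Matrix (Fin n) (Fin n) R) : Matrix (Fin n) (Fin n) R :=
  Matrix.of fun i j => (A ^ (j : ℕ) *ᵥ w) i

def cyc (A : Matrix (Fin n) (Fin n) R) : R := (KM 1 A).det

theorem KM_map (φ : R →+* S) (w : Fin n → R) (A : Matrix (Fin n) (Fin n) R) :
    (KM w A).map φ = KM (fun i => φ (w i)) (A.map φ) := by
  ext i j
  simp only [KM, Matrix.map_apply, Matrix.of_apply, RingHom.map_mulVec]
  rw [Matrix.map_pow]; rfl

theorem cyc_map (φ : R →+* S) (A : Matrix (Fin n) (Fin n) R) : φ (cyc A) = cyc (A.map φ) := by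
  unfold cyc
  rw [RingHom.map_det, RingHom.mapMatrix_apply, KM_map]
  congr 2; ext i; simp

noncomputable def dsc (A : Matrix (Fin n) (Fin n) R) : R :=
  Polynomial.resultant A.charpoly (Polynomial.derivative A.charpoly) n (n-1)

theorem dsc_map (φ : R →+* S) (A : Matrix (Fin n) (Fin n) R) : φ (dsc A) = dsc (A.map φ) := by
  unfold dsc
  rw [Matrix.charpoly_map, Polynomial.derivative_map, Polynomial.resultant_map_map]

noncomputable def QQ (A B : Matrix (Fin n) (Fin n) R) : R :=
  Del A (B * A * B.adjugate * A.adjugate) * cyc A * dsc A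

theorem QQ_map (φ : R →+* S) (A B : Matrix (Fin n) (Fin n) R) : φ (QQ A B) = QQ (A.map φ) (B.map φ) := by
  unfold QQ
  have h : ∀ M : Matrix (Fin n) (Fin n) R, M.adjugate.map φ = (M.map φ).adjugate := fun M => by
    rw [← RingHom.mapMatrix_apply, RingHom.map_adjugate, RingHom.mapMatrix_apply]
  rw [map_mul, map_mul, Del_map, cyc_map, dsc_map, Matrix.map_mul, Matrix.map_mul, Matrix.map_mul, h, h]
end Q1
end PartQ1

section PartQ2
section Q2
variable {K : Type} [Field K] [CharZero K]

theorem exists_lam (m : ℕ) (hm : 1 ≤ m) : ∃ l : Fin (m+1) → K, Function.Injective l ∧ ∏ i, l i = 1 := by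
  have hf : ((Nat.factorial (m+1) : ℕ) : K) ≠ 0 := by exact_mod_cast (Nat.factorial_ne_zero _)
  have h2 : 2 ≤ Nat.factorial (m+1) := by
    calc 2 = Nat.factorial 2 := rfl
      _ ≤ _ := Nat.factorial_le (by omega)
  have hne : ∀ i : Fin m, ((Nat.factorial (m+1) : ℕ) : K)⁻¹ ≠ ((i : ℕ) : K) + 2 := by
    intro i h
    have h3 : (1 : K) = (((i : ℕ) + 2) * Nat.factorial (m+1) : ℕ) := by
      push_cast; rw [← h, inv_mul_cancel₀ hf]
    have h4 : 1 = ((i : ℕ) + 2) * Nat.factorial (m+1) := by exact_mod_cast h3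
    nlinarith
  refine ⟨Fin.cons ((Nat.factorial (m+1) : ℕ) : K)⁻¹ (fun i : Fin m => ((i : ℕ) : K) + 2), ?_, ?_⟩
  · rw [Fin.cons_injective_iff]
    refine ⟨?_, ?_⟩
    · rintro ⟨i, hi⟩; exact hne i hi.symm
    · intro i j h
      have : (i : K) = j := by simpa using h
      exact Fin.ext (by exact_mod_cast this)
  · rw [Fin.prod_univ_succ]
    simp only [Fin.cons_zero, Fin.cons_succ]
    have : ∏ i : Fin m, (((i : ℕ) : K) + 2) = ((Nat.factorial (m+1) : ℕ) : K) := by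
      rw [Fin.prod_univ_eq_prod_range (fun i => (i : K) + 2), ← Finset.prod_range_add_one_eq_factorial, Finset.prod_range_succ']
      push_cast
      simp [add_assoc, one_add_one_eq_two]
    rw [this, inv_mul_cancel₀ hf]

def Bst (m : ℕ) : Matrix (Fin (m+1)) (Fin (m+1)) K := Matrix.of fun i j => if i = j then 1 else if i = 0 then 1 else 0

theorem Bst_det (m : ℕ) : (Bst m : Matrix _ _ K).det = 1 := by
  rw [Matrix.det_of_upperTriangular]
  · simp [Bst]
  · intro i j h
    simp only [id] at h
    have : i ≠ 0 := by rintro rfl; exact absurd h (by simp)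
    simp [Bst, this, h.ne']

theorem cyc_diag (m : ℕ) (l : Fin (m+1) → K) (hl : Function.Injective l) : cyc (Matrix.diagonal l) ≠ 0 := by
  have : KM 1 (Matrix.diagonal l) = Matrix.vandermonde l := by
    ext i j
    simp [KM, Matrix.diagonal_pow, Matrix.mulVec_diagonal, Matrix.vandermonde_apply, Matrix.mulVec, Matrix.diagonal_apply, dotProduct]
  unfold cyc
  rw [this]
  exact Matrix.det_vandermonde_ne_zero_iff.mpr hl

theorem natDegree_dcharpoly {n : ℕ} (A : Matrix (Fin n) (Fin n) K) : (Polynomial.derivative A.charpoly).natDegree = n - 1 := by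
  rw [Polynomial.natDegree_derivative, Matrix.charpoly_natDegree_eq_dim, Fintype.card_fin]

theorem dsc_ne_zero_iff {n : ℕ} (hn : 1 ≤ n) (A : Matrix (Fin n) (Fin n) K) : dsc A ≠ 0 ↔ A.charpoly.Separable := by
  have h : dsc A = Polynomial.resultant A.charpoly (Polynomial.derivative A.charpoly) := by
    unfold dsc
    rw [natDegree_dcharpoly, Matrix.charpoly_natDegree_eq_dim, Fintype.card_fin]
  rw [h, Ne, Polynomial.resultant_eq_zero_iff, Polynomial.separable_def]
  have := A.charpoly_monic.ne_zero
  simp [this]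

theorem dsc_diag (m : ℕ) (l : Fin (m+1) → K) (hl : Function.Injective l) : dsc (Matrix.diagonal l) ≠ 0 := by
  rw [dsc_ne_zero_iff (by omega), Matrix.charpoly_diagonal]
  exact Polynomial.separable_prod_X_sub_C_iff.mpr hl

theorem eval_charpoly' {n : ℕ} (A : Matrix (Fin n) (Fin n) K) (x : K) : A.charpoly.eval x = (x • (1 : Matrix (Fin n) (Fin n) K) - A).det := by
  rw [Matrix.eval_charpoly]; congr 2; ext i j; simp [Matrix.one_apply, Matrix.diagonal_apply]

theorem eval_charpoly_pert {n : ℕ} (W c : Matrix (Fin n) (Fin n) K) (a : Fin n → K) (x : K) :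
   (W * pert c a).charpoly.eval x = (W * c).charpoly.eval x - 1 ⬝ᵥ ((x • (1 : Matrix (Fin n) (Fin n) K) - W * c).adjugate *ᵥ (W *ᵥ a)) := by
  rw [eval_charpoly', eval_charpoly', pert, mul_add, mul_vecMulVec]
  have : (x • (1 : Matrix (Fin n) (Fin n) K) - (W * c + vecMulVec (W *ᵥ a) 1)) = (x • (1 : Matrix (Fin n) (Fin n) K) - W * c) + vecMulVec (-(W *ᵥ a)) 1 := by
    rw [neg_vecMulVec]; abel
  rw [this, det_rank_one, mulVec_neg, dotProduct_neg]; ring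

/-- The solution of the theta equation has matching characteristic polynomials. -/
theorem th_charpoly {R : Type} [CommRing R] [Nontrivial R] {n : ℕ} (hn : 1 ≤ n) (c W : Matrix (Fin n) (Fin n) R) (hW : W.det = 1) (a a' : Fin n → R)
    (h : th c W a = th c W a') : (pert c a).det = (pert c a').det ∧
    (pert c a).charpoly - (W * pert c a).charpoly = (pert c a').charpoly - (W * pert c a').charpoly := by
  constructor
  · simpa [th] using congrFun h ⟨0, hn⟩
  · ext j
    rcases Nat.eq_zero_or_pos j with rfl | hj
    · rw [Polynomial.coeff_sub, Polynomial.coeff_sub]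
      have : ∀ M : Matrix (Fin n) (Fin n) R, M.charpoly.coeff 0 = (-1)^n * M.det := fun M => by
        rw [Matrix.det_eq_sign_charpoly_coeff, Fintype.card_fin, ← mul_assoc, ← mul_pow]; simp
      simp [this, hW]
    · by_cases hjn : j < n
      · have := congrFun h ⟨j, hjn⟩
        simp only [th, hj.ne', if_false] at this
        rw [Polynomial.coeff_sub, Polynomial.coeff_sub, this]
      · have : ∀ M N : Matrix (Fin n) (Fin n) R, (M.charpoly - N.charpoly).coeff j = 0 := by
          intro M N
          rcases (not_lt.mp hjn).eq_or_lt with h1 | h1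
          · have h2 : ∀ M : Matrix (Fin n) (Fin n) R, M.charpoly.coeff j = 1 := by
              intro M
              have := M.charpoly_monic.coeff_natDegree
              rw [Matrix.charpoly_natDegree_eq_dim, Fintype.card_fin] at this
              rw [← this]; congr 1; exact h1.symm
            rw [Polynomial.coeff_sub, h2, h2, sub_self]
          · have h2 : ∀ M : Matrix (Fin n) (Fin n) R, M.charpoly.coeff j = 0 := by
              intro M
              apply Polynomial.coeff_eq_zero_of_natDegree_lt
              rwa [Matrix.charpoly_natDegree_eq_dim, Fintype.card_fin]
            rw [Polynomial.coeff_sub, h2, h2, sub_self]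
        rw [this, this]

theorem adj_diag_vec (m : ℕ) (l : Fin (m+1) → K) (i : Fin (m+1)) (u v : Fin (m+1) → K) :
    v ⬝ᵥ ((l i • (1 : Matrix (Fin (m+1)) (Fin (m+1)) K) - Matrix.diagonal l).adjugate *ᵥ u) = v i * u i * ∏ j ∈ Finset.univ.erase i, (l i - l j) := by
  have : (l i • (1 : Matrix (Fin (m+1)) (Fin (m+1)) K) - Matrix.diagonal l) = Matrix.diagonal (fun k => l i - l k) := by
    ext a b; simp [Matrix.one_apply, Matrix.diagonal_apply]; split_ifs <;> simp
  rw [this, Matrix.adjugate_diagonal]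
  rw [dotProduct, Finset.sum_eq_single i]
  · simp [Matrix.mulVec_diagonal]; ring
  · intro b _ hb
    rw [Matrix.mulVec_diagonal, Finset.prod_eq_zero (i := i)]
    · simp
    · simp [hb.symm]
    · simp
  · simp

theorem Del_example (m : ℕ) (l : Fin (m+1) → K) (hl : Function.Injective l) (hl1 : ∏ i, l i = 1) :
    Del (Matrix.diagonal l) ((Bst m) * Matrix.diagonal l * (Bst m).adjugate * (Matrix.diagonal l).adjugate) ≠ 0 := by
  set A := Matrix.diagonal l with hA
  set B : Matrix (Fin (m+1)) (Fin (m+1)) K := Bst m with hB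
  have dA : A.det = 1 := by rw [hA, Matrix.det_diagonal, hl1]
  have dB : B.det = 1 := Bst_det m
  have aA : A.adjugate * A = 1 := by rw [adjugate_mul, dA, one_smul]
  have aA' : A * A.adjugate = 1 := by rw [mul_adjugate, dA, one_smul]
  have aB : B.adjugate * B = 1 := by rw [adjugate_mul, dB, one_smul]
  have aB' : B * B.adjugate = 1 := by rw [mul_adjugate, dB, one_smul]
  set W := B * A * B.adjugate * A.adjugate with hWdef
  have dW : W.det = 1 := by
    rw [hWdef]; simp [det_mul, det_adjugate, dA, dB]
  have hWA : W * A = B * A * B.adjugate := by rw [hWdef, mul_assoc, aA, mul_one]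
  unfold Del
  intro h0
  obtain ⟨a, ha0, ha⟩ := Matrix.exists_mulVec_eq_zero_iff.mpr h0
  apply ha0
  have hth : th A W a = th A W 0 := by rw [th_affine A W a, ha, add_zero]
  obtain ⟨h1, h2⟩ := th_charpoly (by omega) A W dW a 0 hth
  have hp0 : pert A 0 = A := by simp [pert]
  rw [hp0] at h1 h2
  set y := B.adjugate *ᵥ (A.adjugate *ᵥ a) with hy
  have hay : a = A *ᵥ (B *ᵥ y) := by
    rw [hy]; simp only [mulVec_mulVec, ← mul_assoc]
    rw [mul_assoc A B, aB', mul_one, aA', one_mulVec]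
  have lne : ∀ i, l i ≠ 0 := fun i h => by
    rw [Finset.prod_eq_zero (Finset.mem_univ i) h] at hl1; exact zero_ne_one hl1
  have key : ∀ i, (B *ᵥ y) i = (1 ᵥ* B) i * y i := by
    intro i
    have h3 := congrArg (Polynomial.eval (l i)) h2
    have e1 := eval_charpoly_pert 1 A a (l i)
    rw [one_mul, one_mul, one_mulVec] at e1
    rw [Polynomial.eval_sub, Polynomial.eval_sub, e1, eval_charpoly_pert W A a (l i)] at h3
    have h4 : (l i • (1 : Matrix (Fin (m+1)) (Fin (m+1)) K) - W * A).adjugate = B * (l i • (1 : Matrix (Fin (m+1)) (Fin (m+1)) K) - A).adjugate * B.adjugate := by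
      have : (l i • (1 : Matrix (Fin (m+1)) (Fin (m+1)) K) - W * A) = B * (l i • (1 : Matrix (Fin (m+1)) (Fin (m+1)) K) - A) * B.adjugate := by
        rw [mul_sub, sub_mul, ← hWA]; simp [aB']
      rw [this, adjugate_mul_distrib, adjugate_mul_distrib]
      have hBB : B.adjugate.adjugate = B := by
        calc B.adjugate.adjugate = B.adjugate.adjugate * (B.adjugate * B) := by rw [aB, mul_one]
          _ = B := by rw [← mul_assoc, adjugate_mul, det_adjugate, dB]; simp
      rw [hBB, mul_assoc]
    have h5 : B.adjugate *ᵥ (W *ᵥ a) = A *ᵥ y := by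
      rw [hy, hWdef]; simp only [mulVec_mulVec, ← mul_assoc]
      rw [aB, one_mul]
    rw [h4, ← mulVec_mulVec, ← mulVec_mulVec, h5, dotProduct_mulVec _ B, hA, adj_diag_vec, adj_diag_vec] at h3
    have h6 : (∏ j ∈ Finset.univ.erase i, (l i - l j)) ≠ 0 := by
      rw [Finset.prod_ne_zero_iff]
      intro j hj; rw [sub_ne_zero]; exact fun h => (Finset.ne_of_mem_erase hj) (hl h.symm)
    have h7 : a i = l i * (B *ᵥ y) i := by
      conv_lhs => rw [hay, hA, Matrix.mulVec_diagonal]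
    rw [Matrix.mulVec_diagonal, h7] at h3
    have h8 : l i * (∏ j ∈ Finset.univ.erase i, (l i - l j)) * ((B *ᵥ y) i - (1 ᵥ* B) i * y i) = 0 := by
      simp only [Pi.one_apply] at h3
      linear_combination -h3
    rcases mul_eq_zero.mp h8 with h | h
    · exact absurd h (mul_ne_zero (lne i) h6)
    · exact sub_eq_zero.mp h
  have key0 : (1 : Fin (m+1) → K) ⬝ᵥ (B *ᵥ y) = 0 := by
    rw [pert, det_rank_one] at h1
    have h3 : (1 : Fin (m+1) → K) ⬝ᵥ (A.adjugate *ᵥ a) = 0 := by linear_combination h1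
    rw [hay, mulVec_mulVec, aA, one_mulVec] at h3
    exact h3
  have cs : ∀ j : Fin (m+1), (1 ᵥ* B) j = if j = 0 then 1 else 2 := by
    intro j
    simp only [Matrix.vecMul, dotProduct, Pi.one_apply, one_mul, hB, Bst, Matrix.of_apply]
    rw [Fin.sum_univ_succ]
    refine Fin.cases ?_ (fun k => ?_) j
    · simp
    · simp [Fin.succ_ne_zero, (Fin.succ_ne_zero _).symm, one_add_one_eq_two]
  have rs : ∀ j : Fin m, (B *ᵥ y) j.succ = y j.succ := by
    intro j
    simp only [Matrix.mulVec, dotProduct, hB, Bst, Matrix.of_apply]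
    simp [Fin.succ_ne_zero]
  have ys : ∀ j : Fin m, y j.succ = 0 := by
    intro j
    have := key j.succ
    rw [rs, cs, if_neg (Fin.succ_ne_zero j)] at this
    linear_combination -this
  have y0 : y 0 = 0 := by
    rw [dotProduct_mulVec, dotProduct, Fin.sum_univ_succ] at key0
    simpa [ys, cs] using key0
  have yz : y = 0 := by
    ext i; refine Fin.cases y0 ys i
  rw [hay, yz]; simp

theorem QQ_example {n : ℕ} (hn : 2 ≤ n) : ∃ A B : SL n K, QQ (slHom n K A) (slHom n K B) ≠ 0 := by
  obtain ⟨m, rfl⟩ : ∃ m, n = m + 1 := ⟨n-1, by omega⟩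
  obtain ⟨l, hl, hl1⟩ := exists_lam (K := K) m (by omega)
  refine ⟨⟨Matrix.diagonal l, by rw [Matrix.det_diagonal, hl1]⟩, ⟨Bst m, Bst_det m⟩, ?_⟩
  exact mul_ne_zero (mul_ne_zero (Del_example m l hl hl1) (cyc_diag m l hl)) (dsc_diag m l hl)
end Q2
end PartQ2

section PartD1
section D1

def upd {g : ℕ} {G : Type} (s : Fin g × Bool → G) (i : Fin g) (a b : G) : Fin g × Bool → G :=
  fun x => if x.1 = i then (if x.2 then b else a) else s x

theorem upd_false {g : ℕ} {G : Type} (s : Fin g × Bool → G) (i : Fin g) (a b : G) : upd s i a b (i, false) = a := by simp [upd]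
theorem upd_true {g : ℕ} {G : Type} (s : Fin g × Bool → G) (i : Fin g) (a b : G) : upd s i a b (i, true) = b := by simp [upd]
theorem upd_ne {g : ℕ} {G : Type} (s : Fin g × Bool → G) (i : Fin g) (a b : G) {j : Fin g} (h : j ≠ i) (e : Bool) : upd s i a b (j, e) = s (j, e) := by
  simp [upd, h]

theorem upd_apply_fun {g : ℕ} {G H : Type} (φ : G → H) (s : Fin g × Bool → G) (i : Fin g) (a b : G) (x : Fin g × Bool) :
    φ (upd s i a b x) = upd (fun x => φ (s x)) i (φ a) (φ b) x := by
  unfold upd; split_ifs <;> rfl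

theorem upd_self {g : ℕ} {G : Type} (s : Fin g × Bool → G) (i : Fin g) : upd s i (s (i,false)) (s (i,true)) = s := by
  ext ⟨j, e⟩
  by_cases h : j = i
  · subst h; cases e <;> simp [upd]
  · rw [upd_ne _ _ _ _ h]

def cm {g : ℕ} {G : Type} [Group G] (s : Fin g × Bool → G) : Fin g → G := fun i => ⁅s (i,false), s (i,true)⁆

/-- the value of the `i`-th commutator forced by the relation -/
def need {g : ℕ} {G : Type} [Group G] (s : Fin g × Bool → G) (i : Fin g) : G := (preP (cm s) i)⁻¹ * (sufP (cm s) i)⁻¹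

theorem map_need {g : ℕ} {G H : Type} [Group G] [Group H] (φ : G →* H) (s : Fin g × Bool → G) (i : Fin g) :
    φ (need s i) = need (fun x => φ (s x)) i := by
  have : ∀ j, φ (cm s j) = cm (fun x => φ (s x)) j := fun j => map_commutatorElement φ _ _
  unfold need
  rw [map_mul, map_inv, map_inv, map_preP, map_sufP]
  simp only [this]

theorem need_congr {g : ℕ} {G : Type} [Group G] {s s' : Fin g × Bool → G} {i : Fin g} (h : ∀ j ≠ i, ∀ e, s (j, e) = s' (j, e)) :
    need s i = need s' i := by
  unfold need
  have h' : ∀ j ≠ i, cm s j = cm s' j := fun j hj => by unfold cm; rw [h j hj, h j hj]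
  rw [preP_congr h', sufP_congr h']

theorem need_eq {g : ℕ} {G : Type} [Group G] {s : Fin g × Bool → G} (hs : (List.ofFn (cm s)).prod = 1) (i : Fin g) :
    ⁅s (i,false), s (i,true)⁆ = need s i := rel_subgroup (cm s) hs i

theorem upd_rel {g : ℕ} {G : Type} [Group G] (s : Fin g × Bool → G) (i : Fin g) (a b : G) (h : ⁅a, b⁆ = need s i) :
    (List.ofFn (cm (upd s i a b))).prod = 1 := by
  rw [pre_suf _ i]
  have h1 : cm (upd s i a b) i = need (upd s i a b) i := by
    rw [need_congr (s' := s) (fun j hj e => upd_ne _ _ _ _ hj e), ← h, cm, upd_false, upd_true]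
  rw [h1, need]; group

theorem D_main {K : Type} [RCLike K] {g n : ℕ} (hn : 2 ≤ n) (A : Fin g × Bool → Matrix (Fin n) (Fin n) K) (hA : A ∈ RepVariety g n K)
    (i k : Fin g) (hik : k ≠ i)
    (htriv : ∀ Y, Y * A (i,false) = A (i,false) * Y → Y * A (i,true) = A (i,true) * Y → ∃ c : K, Y = c • 1) :
    ∃ ρ : K → Fin g × Bool → Matrix (Fin n) (Fin n) K, ρ 0 = A ∧ ∃ ε > 0, ContinuousOn ρ (Metric.ball 0 ε) ∧
      ∀ t ∈ Metric.ball (0:K) ε, ρ t ∈ RepVariety g n K ∧ (t ≠ 0 → QQ (ρ t (k,false)) (ρ t (k,true)) ≠ 0) := by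
  obtain ⟨s, hsA, hs⟩ := (rep_iff A).mp hA
  change (List.ofFn (cm s)).prod = 1 at hs
  obtain ⟨Ae, Be, hQ⟩ := QQ_example (K := K) hn
  have hsurj : ∀ u : K, ∃ r : Polynomial K, Polynomial.evalRingHom 0 r = 0 ∧ Polynomial.evalRingHom 1 r = u :=
    fun u => ⟨Polynomial.C u * Polynomial.X, by simp, by simp⟩
  obtain ⟨σA, hA0, hA1⟩ := SL_curve hn (Polynomial.evalRingHom (0:K)) (Polynomial.evalRingHom (1:K)) hsurj ((s (k,false))⁻¹ * Ae)
  obtain ⟨σB, hB0, hB1⟩ := SL_curve hn (Polynomial.evalRingHom (0:K)) (Polynomial.evalRingHom (1:K)) hsurj ((s (k,true))⁻¹ * Be)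
  let ev : K → SL n (Polynomial K) →* SL n K := fun t => SpecialLinearGroup.map (Polynomial.evalRingHom t)
  let cc : SL n K →* SL n (Polynomial K) := SpecialLinearGroup.map Polynomial.C
  have evcc : ∀ t x, ev t (cc x) = x := by
    intro t x; ext a b; simp [ev, cc]
  let sX : Fin g × Bool → SL n (Polynomial K) := upd (fun x => cc (s x)) k (cc (s (k,false)) * σA) (cc (s (k,true)) * σB)
  let WX := need sX i
  let w : K → Matrix (Fin n) (Fin n) K := fun t => slHom n K (ev t WX)
  have wcont : ∀ x, Continuous (fun t => slHom n K (ev t x)) := by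
    intro x
    refine continuous_pi fun a => continuous_pi fun b => ?_
    exact (x.1 a b).continuous
  have ev0 : ∀ x, ev 0 (sX x) = s x := by
    intro x
    simp only [sX]
    rw [upd_apply_fun (ev 0)]
    simp only [map_mul, evcc]
    have e1 : ev 0 σA = 1 := hA0
    have e2 : ev 0 σB = 1 := hB0
    rw [e1, e2, mul_one, mul_one, upd_self]
  have w0 : w 0 = slHom n K ⁅s (i,false), s (i,true)⁆ := by
    simp only [w, WX]
    rw [map_need, need_eq hs]
    simp only [ev0]
  have hd : ∀ x : SL n K, (slHom n K x).det = 1 := fun x => x.2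
  obtain ⟨ψ, hψ0, hψ⟩ := IFT hn (A (i,false)) (A (i,true)) (w 0) (by rw [hsA]; exact hd _) (by rw [hsA]; exact hd _) (by
    rw [w0, hsA, hsA, ← map_mul, ← map_mul, ← map_mul]; congr 1; rw [commutatorElement_def]; group) htriv
  have hev : ∀ᶠ t in nhds (0:K), ContinuousAt ψ (w t) ∧ ((w t).det = 1 → (ψ (w t)).1.det = 1 ∧ (ψ (w t)).2.det = 1 ∧ (ψ (w t)).1*(ψ (w t)).2 = (w t)*(ψ (w t)).2*(ψ (w t)).1) :=
    ((wcont WX).tendsto 0).eventually hψ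
  let q : Polynomial K := QQ (slHom n _ (sX (k,false))) (slHom n _ (sX (k,true)))
  have hq : ∀ t, q.eval t = QQ (slHom n K (ev t (sX (k,false)))) (slHom n K (ev t (sX (k,true)))) := by
    intro t
    exact QQ_map (Polynomial.evalRingHom t) _ _
  have hq0 : q ≠ 0 := by
    intro h0
    have := hq 1
    rw [h0, Polynomial.eval_zero] at this
    have e1 : ev 1 (sX (k,false)) = Ae := by
      simp only [sX]; rw [upd_false, map_mul, evcc]
      have : ev 1 σA = _ := hA1
      rw [this, mul_inv_cancel_left]
    have e2 : ev 1 (sX (k,true)) = Be := by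
      simp only [sX]; rw [upd_true, map_mul, evcc]
      have : ev 1 σB = _ := hB1
      rw [this, mul_inv_cancel_left]
    rw [e1, e2] at this
    exact hQ this.symm
  have hqe : ∀ᶠ t in nhds (0:K), t ≠ 0 → q.eval t ≠ 0 := by
    have hfin : ({t | q.IsRoot t} \ {0}).Finite := (Polynomial.finite_setOf_isRoot hq0).subset Set.diff_subset
    have := hfin.isClosed.compl_mem_nhds (x := (0:K)) (by simp)
    filter_upwards [this] with t ht h0 h1
    exact ht ⟨h1, h0⟩
  obtain ⟨ε, hε, hball⟩ := Metric.eventually_nhds_iff_ball.mp (hev.and hqe)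
  refine ⟨fun t => upd (fun x => slHom n K (ev t (sX x))) i (ψ (w t)).1 (ψ (w t)).2, ?_, ε, hε, ?_, ?_⟩
  · simp only [ev0, hψ0, ← hsA]
    exact upd_self _ _
  · intro t ht
    apply ContinuousAt.continuousWithinAt
    have hc : ContinuousAt (fun t => ψ (w t)) t := ContinuousAt.comp (hball t ht).1.1 (wcont WX).continuousAt
    refine continuousAt_pi.mpr fun x => ?_
    unfold upd
    split_ifs
    · exact continuous_snd.continuousAt.comp hc
    · exact continuous_fst.continuousAt.comp hc
    · exact (wcont _).continuousAt
  · intro t ht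
    obtain ⟨⟨-, h2⟩, h3⟩ := hball t ht
    obtain ⟨d1, d2, hrel⟩ := h2 (hd _)
    constructor
    · rw [rep_iff]
      let a : SL n K := ⟨_, d1⟩
      let b : SL n K := ⟨_, d2⟩
      refine ⟨upd (fun x => ev t (sX x)) i a b, ?_, ?_⟩
      · intro x
        rw [upd_apply_fun (slHom n K)]; rfl
      · apply upd_rel
        rw [← map_need, commutatorElement_def, mul_inv_eq_iff_eq_mul, mul_inv_eq_iff_eq_mul]
        apply slHom_injective
        rw [map_mul, map_mul, map_mul]
        exact hrel
    · intro ht0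
      beta_reduce
      rw [upd_ne _ _ _ _ hik, upd_ne _ _ _ _ hik, ← hq]
      exact h3 ht0

theorem D_real {g n : ℕ} (hn : 2 ≤ n) (T : Fin g × Bool → Matrix (Fin n) (Fin n) ℝ) (hT : T ∈ RepVariety g n ℝ)
    (i k : Fin g) (hik : k ≠ i)
    (htriv : ∀ Y, Y * T (i,false) = T (i,false) * Y → Y * T (i,true) = T (i,true) * Y → ∃ c : ℝ, Y = c • 1) :
    ∃ B ∈ HIT g n T, QQ (B (k,false)) (B (k,true)) ≠ 0 := by
  obtain ⟨ρ, h0, ε, hε, hc, h⟩ := D_main hn T hT i k hik htriv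
  have hz : (0:ℝ) ∈ Metric.ball (0:ℝ) ε := Metric.mem_ball_self hε
  have hpre : IsPreconnected (ρ '' Metric.ball 0 ε) := ((convex_ball (0:ℝ) ε).isPreconnected).image _ hc
  have hsub := hpre.subset_connectedComponentIn (x := T) (F := RepVariety g n ℝ) ⟨0, hz, h0⟩ (by
    rintro _ ⟨t, ht, rfl⟩; exact (h t ht).1)
  have ht : ε / 2 ∈ Metric.ball (0:ℝ) ε := by
    rw [Metric.mem_ball, Real.dist_eq, sub_zero, abs_of_pos (by linarith)]; linarith
  exact ⟨ρ (ε/2), hsub ⟨_, ht, rfl⟩, (h _ ht).2 (by linarith)⟩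

theorem D_cplx {g n : ℕ} (hn : 2 ≤ n) (P : MvPolynomial ((Fin g × Bool) × Fin n × Fin n) ℂ) (k : Fin g)
    (hP : ∀ B ∈ RepVariety g n ℂ, QQ (B (k,false)) (B (k,true)) ≠ 0 → eval (fun p => B p.1 p.2.1 p.2.2) P = 0)
    (B : Fin g × Bool → Matrix (Fin n) (Fin n) ℂ) (hB : B ∈ RepVariety g n ℂ)
    (i : Fin g) (hik : k ≠ i)
    (htriv : ∀ Y, Y * B (i,false) = B (i,false) * Y → Y * B (i,true) = B (i,true) * Y → ∃ c : ℂ, Y = c • 1) :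
    eval (fun p => B p.1 p.2.1 p.2.2) P = 0 := by
  obtain ⟨ρ, h0, ε, hε, hc, h⟩ := D_main hn B hB i k hik htriv
  have hz : (0:ℂ) ∈ Metric.ball (0:ℂ) ε := Metric.mem_ball_self hε
  have hca : ContinuousAt ρ 0 := hc.continuousAt (Metric.isOpen_ball.mem_nhds hz)
  have hcf : ContinuousAt (fun t => eval (fun p : (Fin g × Bool) × Fin n × Fin n => ρ t p.1 p.2.1 p.2.2) P) 0 := by
    apply (MvPolynomial.continuous_eval P).continuousAt.comp
    refine continuousAt_pi.mpr fun p => ?_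
    have : Continuous (fun f : Fin g × Bool → Matrix (Fin n) (Fin n) ℂ => f p.1 p.2.1 p.2.2) := by
      exact (continuous_apply p.2.2).comp ((continuous_apply p.2.1).comp (continuous_apply p.1))
    exact this.continuousAt.comp hca
  have hne : (nhdsWithin (0:ℂ) {0}ᶜ).NeBot := inferInstance
  have h1 : Filter.Tendsto (fun t => eval (fun p : (Fin g × Bool) × Fin n × Fin n => ρ t p.1 p.2.1 p.2.2) P) (nhdsWithin (0:ℂ) {0}ᶜ) (nhds 0) := by
    apply tendsto_const_nhds.congr'
    filter_upwards [self_mem_nhdsWithin, mem_nhdsWithin_of_mem_nhds (Metric.isOpen_ball.mem_nhds hz)] with t ht ht'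
    exact (hP _ (h t ht').1 ((h t ht').2 ht)).symm
  have h2 := tendsto_nhds_unique (hcf.tendsto.mono_left nhdsWithin_le_nhds) h1
  rw [← h0]; exact h2
end D1
end PartD1

section PartE1
section E1
variable {n : ℕ} {R S : Type} [CommRing R] [CommRing S]

theorem map_rinv (φ : R →+* S) {x : R} (hx : IsUnit x) : φ (Ring.inverse x) = Ring.inverse (φ x) := by
  obtain ⟨u, rfl⟩ := hx
  rw [Ring.inverse_unit]
  have : φ (u : R) = ((Units.map φ.toMonoidHom u : Sˣ) : S) := rfl
  rw [this, Ring.inverse_unit]; rfl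

def ee0 : Fin n → R := fun j => if (j : ℕ) = 0 then 1 else 0

noncomputable def aS (c W : Matrix (Fin n) (Fin n) R) : Fin n → R :=
  Ring.inverse (Del c W) • ((TM c W).adjugate *ᵥ (ee0 - th c W 0))

noncomputable def AS (c W : Matrix (Fin n) (Fin n) R) : Matrix (Fin n) (Fin n) R := pert c (aS c W)

noncomputable def XS (c W : Matrix (Fin n) (Fin n) R) (w : Fin n → R) : Matrix (Fin n) (Fin n) R :=
  Ring.inverse (cyc (AS c W)) • (KM w (W * AS c W) * (KM 1 (AS c W)).adjugate)

theorem th_aS (c W : Matrix (Fin n) (Fin n) R) (h : IsUnit (Del c W)) : th c W (aS c W) = ee0 := by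
  rw [th_affine, aS, mulVec_smul, mulVec_mulVec, mul_adjugate]
  change _ + Ring.inverse (Del c W) • ((Del c W • (1 : Matrix (Fin n) (Fin n) R)) *ᵥ _) = _
  rw [smul_mulVec, one_mulVec, smul_smul, Ring.inverse_mul_cancel _ h, one_smul]; simp

theorem charpoly_ext' [Nontrivial R] (M N : Matrix (Fin n) (Fin n) R) (h0 : M.det = N.det)
    (h : ∀ j, 0 < j → j < n → M.charpoly.coeff j = N.charpoly.coeff j) : M.charpoly = N.charpoly := by
  ext j
  rcases Nat.eq_zero_or_pos j with rfl | hj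
  · have : ∀ M : Matrix (Fin n) (Fin n) R, M.charpoly.coeff 0 = (-1)^n * M.det := fun M => by
      rw [Matrix.det_eq_sign_charpoly_coeff, Fintype.card_fin, ← mul_assoc, ← mul_pow]; simp
    rw [this, this, h0]
  · by_cases hjn : j < n
    · exact h j hj hjn
    · rcases (not_lt.mp hjn).eq_or_lt with h1 | h1
      · have h2 : ∀ M : Matrix (Fin n) (Fin n) R, M.charpoly.coeff j = 1 := by
          intro M
          have := M.charpoly_monic.coeff_natDegree
          rw [Matrix.charpoly_natDegree_eq_dim, Fintype.card_fin] at this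
          rw [← this]; congr 1; exact h1.symm
        rw [h2, h2]
      · have h2 : ∀ M : Matrix (Fin n) (Fin n) R, M.charpoly.coeff j = 0 := by
          intro M
          apply Polynomial.coeff_eq_zero_of_natDegree_lt
          rwa [Matrix.charpoly_natDegree_eq_dim, Fintype.card_fin]
        rw [h2, h2]

theorem AS_det (hn : 1 ≤ n) (c W : Matrix (Fin n) (Fin n) R) (h : IsUnit (Del c W)) : (AS c W).det = 1 := by
  have := congrFun (th_aS c W h) ⟨0, hn⟩
  simpa [th, ee0, AS] using this

theorem AS_charpoly [Nontrivial R] (c W : Matrix (Fin n) (Fin n) R) (hW : W.det = 1) (h : IsUnit (Del c W)) :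
    (W * AS c W).charpoly = (AS c W).charpoly := by
  apply charpoly_ext'
  · rw [det_mul, hW, one_mul]
  · intro j hj hjn
    have := congrFun (th_aS c W h) ⟨j, hjn⟩
    simp only [th, ee0, hj.ne', if_false] at this
    exact (sub_eq_zero.mp this).symm

theorem pow_n_vec [Nontrivial R] (A : Matrix (Fin n) (Fin n) R) (w : Fin n → R) :
    A ^ n *ᵥ w = - ∑ l ∈ Finset.range n, A.charpoly.coeff l • (A ^ l *ᵥ w) := by
  have h := Matrix.aeval_self_charpoly A
  rw [Polynomial.aeval_eq_sum_range, Matrix.charpoly_natDegree_eq_dim, Fintype.card_fin, Finset.sum_range_succ] at h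
  have h2 : A.charpoly.coeff n = 1 := by
    have := A.charpoly_monic.coeff_natDegree
    rwa [Matrix.charpoly_natDegree_eq_dim, Fintype.card_fin] at this
  rw [h2, one_smul] at h
  rw [eq_neg_of_add_eq_zero_right h, neg_mulVec, Matrix.sum_mulVec]
  simp only [smul_mulVec]

theorem KM_mul_col (X A : Matrix (Fin n) (Fin n) R) (w : Fin n → R) (j : Fin n) (i : Fin n) :
    (X * KM w A) i j = (X *ᵥ (A ^ (j:ℕ) *ᵥ w)) i := by
  simp [Matrix.mul_apply, KM, Matrix.mulVec, dotProduct]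

theorem KM_intertwine [Nontrivial R] (A M X : Matrix (Fin n) (Fin n) R) (v w : Fin n → R) (hc : A.charpoly = M.charpoly)
    (hu : IsUnit (KM v A).det) (hX : X * KM v A = KM w M) : X * A = M * X := by
  have h1 : ∀ j : ℕ, j ≤ n → X *ᵥ (A ^ j *ᵥ v) = M ^ j *ᵥ w := by
    have h0 : ∀ j : ℕ, j < n → X *ᵥ (A ^ j *ᵥ v) = M ^ j *ᵥ w := by
      intro j hj
      ext i
      rw [← KM_mul_col X A v ⟨j, hj⟩ i, hX]; simp [KM]
    intro j hj
    rcases hj.lt_or_eq with hj | rfl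
    · exact h0 j hj
    · rw [pow_n_vec A, pow_n_vec M, mulVec_neg, Matrix.mulVec_sum, hc]
      congr 1
      refine Finset.sum_congr rfl fun l hl => ?_
      rw [mulVec_smul, h0 l (Finset.mem_range.mp hl)]
  have h2 : (X * A) * KM v A = (M * X) * KM v A := by
    ext i j
    have e1 : (X * A) *ᵥ (A ^ (j:ℕ) *ᵥ v) = X *ᵥ (A ^ ((j:ℕ)+1) *ᵥ v) := by
      rw [mulVec_mulVec, mulVec_mulVec, mul_assoc, ← pow_succ']
    have e2 : (M * X) *ᵥ (A ^ (j:ℕ) *ᵥ v) = M ^ ((j:ℕ)+1) *ᵥ w := by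
      rw [← mulVec_mulVec, h1 j j.2.le, mulVec_mulVec, ← pow_succ']
    rw [KM_mul_col, KM_mul_col, e1, e2, h1 _ j.2]
  have hu' : IsUnit (KM v A) := (Matrix.isUnit_iff_isUnit_det _).mpr hu
  exact hu'.mul_right_cancel h2

def Good (c W : Matrix (Fin n) (Fin n) R) (w : Fin n → R) : Prop :=
  IsUnit (Del c W) ∧ IsUnit (cyc (AS c W)) ∧ IsUnit (KM w (W * AS c W)).det

theorem XS_KM (c W : Matrix (Fin n) (Fin n) R) (w : Fin n → R) (h : IsUnit (cyc (AS c W))) :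
    XS c W w * KM 1 (AS c W) = KM w (W * AS c W) := by
  rw [XS, smul_mul_assoc, mul_assoc, adjugate_mul]
  change Ring.inverse (cyc (AS c W)) • (_ * (cyc (AS c W) • _)) = _
  rw [mul_smul_comm, smul_smul, Ring.inverse_mul_cancel _ h, one_smul, mul_one]

theorem XS_rel [Nontrivial R] (c W : Matrix (Fin n) (Fin n) R) (hW : W.det = 1) (w : Fin n → R) (h : Good c W w) :
    XS c W w * AS c W = W * AS c W * XS c W w :=
  KM_intertwine _ _ _ 1 w (AS_charpoly c W hW h.1).symm h.2.1 (XS_KM c W w h.2.1)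

theorem XS_det (c W : Matrix (Fin n) (Fin n) R) (w : Fin n → R) (h : Good c W w) : IsUnit (XS c W w).det := by
  have := congrArg Matrix.det (XS_KM c W w h.2.1)
  rw [det_mul] at this
  exact isUnit_of_mul_isUnit_left (this ▸ h.2.2)

theorem aS_map (φ : R →+* S) (c W : Matrix (Fin n) (Fin n) R) (h : IsUnit (Del c W)) (i : Fin n) :
    φ (aS c W i) = aS (c.map φ) (W.map φ) i := by
  unfold aS
  rw [Pi.smul_apply, Pi.smul_apply, smul_eq_mul, smul_eq_mul, map_mul, map_rinv φ h, Del_map, RingHom.map_mulVec, ← TM_map]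
  have h2 : (TM c W).adjugate.map φ = ((TM c W).map φ).adjugate := by
    rw [← RingHom.mapMatrix_apply, RingHom.map_adjugate, RingHom.mapMatrix_apply]
  have hv : φ ∘ (ee0 - th c W 0) = ee0 - th (c.map φ) (W.map φ) 0 := by
    ext j
    simp only [Function.comp_apply, Pi.sub_apply, map_sub, th_map]
    congr 1
    · simp only [ee0]; split_ifs <;> simp
    · congr 1; ext k; simp
  rw [h2, hv]

theorem AS_map (φ : R →+* S) (c W : Matrix (Fin n) (Fin n) R) (h : IsUnit (Del c W)) :
    (AS c W).map φ = AS (c.map φ) (W.map φ) := by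
  unfold AS
  rw [pert_map]; congr 1; ext i; exact aS_map φ c W h i

theorem XS_map (φ : R →+* S) (c W : Matrix (Fin n) (Fin n) R) (w : Fin n → R) (h : IsUnit (Del c W)) (h2 : IsUnit (cyc (AS c W))) :
    (XS c W w).map φ = XS (c.map φ) (W.map φ) (fun i => φ (w i)) := by
  unfold XS
  have h3 : (KM 1 (AS c W)).adjugate.map φ = ((KM 1 (AS c W)).map φ).adjugate := by
    rw [← RingHom.mapMatrix_apply, RingHom.map_adjugate, RingHom.mapMatrix_apply]
  have h4 : (fun i => φ ((1 : Fin n → R) i)) = 1 := by ext; simp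
  rw [Matrix.map_smul' _ _ _ (map_mul φ), map_rinv φ h2, cyc_map, AS_map φ c W h, Matrix.map_mul, h3, KM_map, KM_map, Matrix.map_mul, AS_map φ c W h, h4]

theorem Good_map (φ : R →+* S) (c W : Matrix (Fin n) (Fin n) R) (w : Fin n → R) (h : Good c W w) :
    Good (c.map φ) (W.map φ) (fun i => φ (w i)) := by
  refine ⟨?_, ?_, ?_⟩
  · rw [← Del_map]; exact h.1.map φ
  · rw [← AS_map φ c W h.1, ← cyc_map]; exact h.2.1.map φ
  · rw [← AS_map φ c W h.1, ← Matrix.map_mul, ← KM_map, ← RingHom.mapMatrix_apply, ← RingHom.map_det]; exact h.2.2.map φ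

theorem Good_of_map {K L : Type} [Field K] [Field L] (φ : K →+* L) (c W : Matrix (Fin n) (Fin n) K) (w : Fin n → K)
    (h : Good (c.map φ) (W.map φ) (fun i => φ (w i))) : Good c W w := by
  have key : ∀ x : K, IsUnit (φ x) → IsUnit x := fun x hx => by
    rw [isUnit_iff_ne_zero] at hx ⊢; exact fun h => hx (by rw [h, map_zero])
  have h1 : IsUnit (Del c W) := key _ (by rw [Del_map]; exact h.1)
  refine ⟨h1, key _ ?_, key _ ?_⟩
  · rw [cyc_map, AS_map φ c W h1]; exact h.2.1
  · rw [RingHom.map_det, RingHom.mapMatrix_apply, KM_map, Matrix.map_mul, AS_map φ c W h1]; exact h.2.2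

theorem recover {K : Type} [Field K] (A B : Matrix (Fin n) (Fin n) K) (hA : A.det = 1) (hB : B.det = 1)
    (W : Matrix (Fin n) (Fin n) K) (hW : W = B * A * B.adjugate * A.adjugate) (hQ : QQ A B ≠ 0) :
    Good A W (B *ᵥ 1) ∧ AS A W = A ∧ XS A W (B *ᵥ 1) = B := by
  have aA : A.adjugate * A = 1 := by rw [adjugate_mul, hA, one_smul]
  have aB : B.adjugate * B = 1 := by rw [adjugate_mul, hB, one_smul]
  have aB' : B * B.adjugate = 1 := by rw [mul_adjugate, hB, one_smul]
  have hWA : W * A = B * A * B.adjugate := by rw [hW, mul_assoc, aA, mul_one]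
  have dW : W.det = 1 := by rw [hW]; simp [det_mul, det_adjugate, hA, hB]
  unfold QQ at hQ
  rw [← hW] at hQ
  have h1 : IsUnit (Del A W) := isUnit_iff_ne_zero.mpr (left_ne_zero_of_mul (left_ne_zero_of_mul hQ))
  have h2 : cyc A ≠ 0 := right_ne_zero_of_mul (left_ne_zero_of_mul hQ)
  have hp0 : pert A 0 = A := by simp [pert]
  have hch : (W * A).charpoly = A.charpoly := by
    rw [hWA, Matrix.charpoly_mul_comm, ← mul_assoc, aB, one_mul]
  have hth : th A W 0 = ee0 := by
    ext j
    simp only [th, ee0, hp0, hA, hch, sub_self]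
  have ha : aS A W = 0 := by
    rw [aS, hth]; simp
  have hAS : AS A W = A := by rw [AS, ha, hp0]
  have hpow : ∀ j : ℕ, (W * A) ^ j * B = B * A ^ j := by
    intro j
    induction j with
    | zero => simp
    | succ j ih =>
      rw [pow_succ, mul_assoc, hWA, mul_assoc (B * A), aB, mul_one, ← hWA, ← mul_assoc, ih, mul_assoc, ← pow_succ]
  have hKM : KM (B *ᵥ 1) (W * A) = B * KM 1 A := by
    ext i j
    rw [KM_mul_col, mulVec_mulVec, ← hpow]; simp [KM]
  have hG : Good A W (B *ᵥ 1) := by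
    refine ⟨h1, ?_, ?_⟩
    · rw [hAS]; exact isUnit_iff_ne_zero.mpr h2
    · rw [hAS, hKM, det_mul, hB, one_mul]; exact isUnit_iff_ne_zero.mpr h2
  refine ⟨hG, hAS, ?_⟩
  have h5 := XS_KM A W (B *ᵥ 1) hG.2.1
  rw [hAS, hKM] at h5
  have hu' : IsUnit (KM 1 A) := (Matrix.isUnit_iff_isUnit_det _).mpr (isUnit_iff_ne_zero.mpr h2)
  exact hu'.mul_right_cancel h5

theorem rep_of_good {K : Type} [Field K] {g : ℕ} (hn : 1 ≤ n) (s : Fin g × Bool → SL n K) (k : Fin g) (c : Matrix (Fin n) (Fin n) K) (w : Fin n → K)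
    (h : Good c (slHom n K (need s k)⁻¹) w) (r : K) (hr : r ^ n * (XS c (slHom n K (need s k)⁻¹) w).det = 1) :
    upd (fun x => slHom n K (s x)) k (AS c (slHom n K (need s k)⁻¹)) (r • XS c (slHom n K (need s k)⁻¹) w) ∈ RepVariety g n K := by
  have hd : ∀ x : SL n K, (slHom n K x).det = 1 := fun x => x.2
  have h1 := AS_det hn c _ h.1
  have h2 : (r • XS c (slHom n K (need s k)⁻¹) w).det = 1 := by rw [det_smul, Fintype.card_fin, hr]
  have h3 := XS_rel c _ (hd _) w h
  let a : SL n K := ⟨_, h1⟩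
  let b : SL n K := ⟨_, h2⟩
  rw [rep_iff]
  refine ⟨upd s k a b, ?_, ?_⟩
  · intro x; rw [upd_apply_fun (slHom n K)]; rfl
  · apply upd_rel
    have h4 : b * a = (need s k)⁻¹ * a * b := by
      apply slHom_injective
      rw [map_mul, map_mul, map_mul]
      change (r • XS c _ w) * AS c _ = _ * AS c _ * (r • XS c _ w)
      rw [smul_mul_assoc, mul_smul_comm, h3]
    have h5 : need s k * (b * a) = a * b := by rw [h4]; group
    rw [commutatorElement_def, mul_inv_eq_iff_eq_mul, mul_inv_eq_iff_eq_mul, mul_assoc, h5]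
end E1
end PartE1

section PartE2
section E2

/-- rational functions regular on `D` -/
def SD (D : Set ℂ) : Subring (D → ℂ) where
  carrier := {f | ∃ b h : Polynomial ℂ, ∀ x : D, b.eval (x:ℂ) ≠ 0 ∧ b.eval (x:ℂ) * f x = h.eval (x:ℂ)}
  mul_mem' := by
    rintro f f' ⟨b, h, H⟩ ⟨b', h', H'⟩
    refine ⟨b * b', h * h', fun x => ⟨?_, ?_⟩⟩
    · rw [Polynomial.eval_mul]; exact mul_ne_zero (H x).1 (H' x).1
    · rw [Polynomial.eval_mul, Polynomial.eval_mul, ← (H x).2, ← (H' x).2, Pi.mul_apply]; ring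
  one_mem' := ⟨1, 1, fun x => by simp⟩
  add_mem' := by
    rintro f f' ⟨b, h, H⟩ ⟨b', h', H'⟩
    refine ⟨b * b', h * b' + h' * b, fun x => ⟨?_, ?_⟩⟩
    · rw [Polynomial.eval_mul]; exact mul_ne_zero (H x).1 (H' x).1
    · rw [Polynomial.eval_mul, Polynomial.eval_add, Polynomial.eval_mul, Polynomial.eval_mul, ← (H x).2, ← (H' x).2, Pi.add_apply]; ring
  zero_mem' := ⟨1, 0, fun x => by simp⟩
  neg_mem' := by
    rintro f ⟨b, h, H⟩
    refine ⟨b, -h, fun x => ⟨(H x).1, ?_⟩⟩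
    rw [Polynomial.eval_neg, ← (H x).2, Pi.neg_apply]; ring

def evS {D : Set ℂ} (x : D) : SD D →+* ℂ := (Pi.evalRingHom (fun _ : D => ℂ) x).comp (SD D).subtype

noncomputable def incS (D : Set ℂ) : Polynomial ℝ →+* SD D :=
  (Pi.ringHom (fun x : D => (Polynomial.aeval (x:ℂ)).toRingHom)).codRestrict (SD D) (fun f => by
    refine ⟨1, f.map (algebraMap ℝ ℂ), fun x => ⟨by simp, ?_⟩⟩
    rw [Polynomial.eval_one, one_mul, Polynomial.eval_map_algebraMap]; rfl)

def constS (D : Set ℂ) : ℂ →+* SD D :=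
  (Pi.ringHom (fun x : D => RingHom.id ℂ)).codRestrict (SD D) (fun f => ⟨1, Polynomial.C f, fun x => by simp; rfl⟩)

theorem evS_incS {D : Set ℂ} (x : D) : (evS x).comp (incS D) = (Polynomial.aeval (x:ℂ) : Polynomial ℝ →ₐ[ℝ] ℂ).toRingHom := rfl
theorem evS_constS {D : Set ℂ} (x : D) : (evS x).comp (constS D) = RingHom.id ℂ := rfl

theorem SD_unit {D : Set ℂ} (f : SD D) (hf : ∀ x, evS x f ≠ 0) : IsUnit f := by
  obtain ⟨b, h, H⟩ := f.2
  have hh : ∀ x : D, h.eval (x:ℂ) ≠ 0 := fun x => by rw [← (H x).2]; exact mul_ne_zero (H x).1 (hf x)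
  let f' : SD D := ⟨fun x => (f.1 x)⁻¹, h, b, fun x => ⟨hh x, by
    have h3 : f.1 x ≠ 0 := hf x
    rw [← (H x).2, mul_assoc, mul_inv_cancel₀ h3, mul_one]⟩⟩
  refine IsUnit.of_mul_eq_one f' ?_
  ext x
  exact mul_inv_cancel₀ (hf x)

theorem SD_zero {D : Set ℂ} (f : SD D) (hf : {z : ℂ | ∃ h : z ∈ D, evS ⟨z, h⟩ f = 0}.Infinite) (x : D) : evS x f = 0 := by
  obtain ⟨b, h, H⟩ := f.2
  have h0 : h = 0 := by
    refine Polynomial.eq_zero_of_infinite_isRoot h (hf.mono ?_)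
    rintro z ⟨hz, hz'⟩
    change h.eval z = 0
    have := (H ⟨z, hz⟩).2
    rw [← this]
    have : f.1 ⟨z, hz⟩ = 0 := hz'
    rw [this, mul_zero]
  have := (H x).2
  rw [h0, Polynomial.eval_zero] at this
  exact (mul_eq_zero.mp this).resolve_left (H x).1

theorem SD_cont {D : Set ℂ} (f : SD D) : Continuous (fun x : D => evS x f) := by
  obtain ⟨b, h, H⟩ := f.2
  have : (fun x : D => evS x f) = fun x : D => h.eval (x:ℂ) / b.eval (x:ℂ) := by
    funext x
    rw [eq_div_iff (H x).1, ← (H x).2, mul_comm]; rfl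
  rw [this]
  exact (h.continuous.comp continuous_subtype_val).div (b.continuous.comp continuous_subtype_val) (fun x => (H x).1)

theorem SD_ev {D : Set ℂ} (f : SD D) (x0 : D) (hf : evS x0 f ≠ 0) : ∀ᶠ t in nhds (x0:ℂ), ∀ h : t ∈ D, evS ⟨t, h⟩ f ≠ 0 := by
  obtain ⟨b, h, H⟩ := f.2
  have h0 : h.eval (x0:ℂ) ≠ 0 := by rw [← (H x0).2]; exact mul_ne_zero (H x0).1 hf
  filter_upwards [h.continuous.continuousAt.eventually_ne h0] with t ht hD h1
  apply ht
  rw [← (H ⟨t, hD⟩).2]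
  have : f.1 ⟨t, hD⟩ = 0 := h1
  rw [this, mul_zero]

variable {n g : ℕ} {R S : Type} [CommRing R] [CommRing S]

def cT (s : Fin g × Bool → SL n R) (k : Fin g) : Matrix (Fin n) (Fin n) R := slHom n R (s (k,false))
def WT (s : Fin g × Bool → SL n R) (k : Fin g) : Matrix (Fin n) (Fin n) R := slHom n R (need s k)⁻¹
def wT (s : Fin g × Bool → SL n R) (k : Fin g) : Fin n → R := slHom n R (s (k,true)) *ᵥ 1
def GoodT (s : Fin g × Bool → SL n R) (k : Fin g) : Prop := Good (cT s k) (WT s k) (wT s k)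
noncomputable def AT (s : Fin g × Bool → SL n R) (k : Fin g) := AS (cT s k) (WT s k)
noncomputable def XT (s : Fin g × Bool → SL n R) (k : Fin g) := XS (cT s k) (WT s k) (wT s k)
def mT (φ : R →+* S) (s : Fin g × Bool → SL n R) : Fin g × Bool → SL n S := fun x => SpecialLinearGroup.map φ (s x)

theorem slHom_map (φ : R →+* S) (x : SL n R) : slHom n S (SpecialLinearGroup.map φ x) = (slHom n R x).map φ := rfl

theorem cT_map (φ : R →+* S) (s : Fin g × Bool → SL n R) (k : Fin g) : cT (mT φ s) k = (cT s k).map φ := rfl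
theorem WT_map (φ : R →+* S) (s : Fin g × Bool → SL n R) (k : Fin g) : WT (mT φ s) k = (WT s k).map φ := by
  unfold WT mT
  rw [← map_need (SpecialLinearGroup.map φ), ← map_inv, slHom_map]
theorem wT_map (φ : R →+* S) (s : Fin g × Bool → SL n R) (k : Fin g) : wT (mT φ s) k = fun i => φ (wT s k i) := by
  unfold wT mT
  ext i
  rw [RingHom.map_mulVec, slHom_map]
  congr 2; ext; simp

theorem GoodT_map (φ : R →+* S) (s : Fin g × Bool → SL n R) (k : Fin g) (h : GoodT s k) : GoodT (mT φ s) k := by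
  unfold GoodT; rw [cT_map, WT_map, wT_map]; exact Good_map φ _ _ _ h
theorem AT_map (φ : R →+* S) (s : Fin g × Bool → SL n R) (k : Fin g) (h : GoodT s k) : AT (mT φ s) k = (AT s k).map φ := by
  unfold AT; rw [cT_map, WT_map]; exact (AS_map φ _ _ h.1).symm
theorem XT_map (φ : R →+* S) (s : Fin g × Bool → SL n R) (k : Fin g) (h : GoodT s k) : XT (mT φ s) k = (XT s k).map φ := by
  unfold XT; rw [cT_map, WT_map, wT_map]; exact (XS_map φ _ _ _ h.1 h.2.1).symm
theorem GoodT_of_map {K L : Type} [Field K] [Field L] (φ : K →+* L) (s : Fin g × Bool → SL n K) (k : Fin g) (h : GoodT (mT φ s) k) : GoodT s k := by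
  unfold GoodT at h; rw [cT_map, WT_map, wT_map] at h; exact Good_of_map φ _ _ _ h

theorem mT_mT {R' : Type} [CommRing R'] (φ : R →+* S) (φ' : S →+* R') (s : Fin g × Bool → SL n R) : mT φ' (mT φ s) = mT (φ'.comp φ) s := rfl

theorem recoverT {K : Type} [Field K] (s : Fin g × Bool → SL n K) (hs : (List.ofFn (cm s)).prod = 1) (k : Fin g)
    (hQ : QQ (slHom n K (s (k,false))) (slHom n K (s (k,true))) ≠ 0) :
    GoodT s k ∧ AT s k = slHom n K (s (k,false)) ∧ XT s k = slHom n K (s (k,true)) := by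
  apply recover _ _ (s (k,false)).2 (s (k,true)).2 _ ?_ hQ
  unfold WT
  rw [← need_eq hs, commutatorElement_inv, commutatorElement_def, map_mul, map_mul, map_mul]
  rfl

theorem repT {K : Type} [Field K] (hn : 1 ≤ n) (s : Fin g × Bool → SL n K) (k : Fin g) (h : GoodT s k) (r : K) (hr : r ^ n * (XT s k).det = 1) :
    upd (fun x => slHom n K (s x)) k (AT s k) (r • XT s k) ∈ RepVariety g n K :=
  rep_of_good hn s k _ _ h r hr

/-- Openness of goodness. -/
theorem good_open (z : Fin g × Bool → SL n (Polynomial ℝ)) (k : Fin g) (x0 : ℂ)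
    (h0 : GoodT (mT (Polynomial.aeval x0 : Polynomial ℝ →ₐ[ℝ] ℂ).toRingHom z) k) :
    ∀ᶠ t in nhds x0, GoodT (mT (Polynomial.aeval t : Polynomial ℝ →ₐ[ℝ] ℂ).toRingHom z) k := by
  let D : Set ℂ := {t | IsUnit (Del (cT (mT (Polynomial.aeval t : Polynomial ℝ →ₐ[ℝ] ℂ).toRingHom z) k) (WT (mT (Polynomial.aeval t : Polynomial ℝ →ₐ[ℝ] ℂ).toRingHom z) k))}
  let zS : Fin g × Bool → SL n (SD D) := mT (incS D) z
  have hev : ∀ x : D, mT (evS x) zS = mT (Polynomial.aeval (x:ℂ) : Polynomial ℝ →ₐ[ℝ] ℂ).toRingHom z := fun x => rfl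
  have hu : IsUnit (Del (cT zS k) (WT zS k)) := by
    apply SD_unit
    intro x
    rw [Del_map, ← cT_map, ← WT_map, hev]
    exact x.2.ne_zero
  have h0D : x0 ∈ D := h0.1
  have key : ∀ x : D, evS x (cyc (AT zS k)) = cyc (AT (mT (evS x) zS) k) := by
    intro x
    rw [cyc_map]; congr 1
    unfold AT
    rw [AS_map _ _ _ hu, ← cT_map, ← WT_map]
  have key2 : ∀ x : D, evS x (KM (wT zS k) (WT zS k * AT zS k)).det = (KM (wT (mT (evS x) zS) k) (WT (mT (evS x) zS) k * AT (mT (evS x) zS) k)).det := by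
    intro x
    unfold AT
    rw [RingHom.map_det, RingHom.mapMatrix_apply, KM_map, Matrix.map_mul, AS_map _ _ _ hu, ← cT_map, ← WT_map, ← wT_map]
  have hD : ∀ᶠ t in nhds x0, t ∈ D := by
    let d : Polynomial ℝ := Del (cT z k) (WT z k)
    have hd : ∀ t : ℂ, Polynomial.aeval t d = Del (cT (mT (Polynomial.aeval t : Polynomial ℝ →ₐ[ℝ] ℂ).toRingHom z) k) (WT (mT (Polynomial.aeval t : Polynomial ℝ →ₐ[ℝ] ℂ).toRingHom z) k) := by
      intro t
      rw [cT_map, WT_map]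
      exact Del_map (Polynomial.aeval t : Polynomial ℝ →ₐ[ℝ] ℂ).toRingHom (cT z k) (WT z k)
    have hc : Continuous (fun t : ℂ => Polynomial.aeval t d) := d.continuous_aeval
    have := hc.continuousAt.eventually_ne (x := x0) (y := 0) (by rw [hd]; exact h0.1.ne_zero)
    filter_upwards [this] with t ht
    rw [hd] at ht
    exact isUnit_iff_ne_zero.mpr ht
  filter_upwards [hD, SD_ev _ ⟨x0, h0D⟩ (by rw [key]; exact h0.2.1.ne_zero), SD_ev _ ⟨x0, h0D⟩ (by rw [key2]; exact h0.2.2.ne_zero)] with t h1 h2 h3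
  have h2' := h2 h1
  have h3' := h3 h1
  rw [key] at h2'
  rw [key2] at h3'
  exact ⟨h1, isUnit_iff_ne_zero.mpr h2', isUnit_iff_ne_zero.mpr h3'⟩
end E2
end PartE2

section PartE3
section E3

variable {n g : ℕ}

/-- The norm element. -/
theorem exists_norm (hn : 1 ≤ n) {D : Set ℂ} (zS : Fin g × Bool → SL n (SD D)) (k : Fin g) (hG : GoodT zS k)
    (P : MvPolynomial ((Fin g × Bool) × Fin n × Fin n) ℂ) :
    ∃ N : SD D, ∀ x : D, evS x N = 0 ↔ ∃ y : ℂ, y ^ n * (XT (mT (evS x) zS) k).det = 1 ∧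
      eval (fun p => upd (fun j => slHom n ℂ (mT (evS x) zS j)) k (AT (mT (evS x) zS) k) (y • XT (mT (evS x) zS) k) p.1 p.2.1 p.2.2) P = 0 := by
  let d : SD D := Ring.inverse (XT zS k).det
  have hdu : IsUnit (XT zS k).det := XS_det _ _ _ hG
  let ent : (Fin g × Bool) × Fin n × Fin n → Polynomial (SD D) := fun p =>
    upd (fun j => (slHom n _ (zS j)).map Polynomial.C) k ((AT zS k).map Polynomial.C) ((Polynomial.X : Polynomial (SD D)) • (XT zS k).map Polynomial.C) p.1 p.2.1 p.2.2
  let p : Polynomial (SD D) := eval₂ (Polynomial.C.comp (constS D)) ent P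
  have hp : ∀ (x : D) (y : ℂ), (p.map (evS x)).eval y = eval (fun p => upd (fun j => slHom n ℂ (mT (evS x) zS j)) k (AT (mT (evS x) zS) k) (y • XT (mT (evS x) zS) k) p.1 p.2.1 p.2.2) P := by
    intro x y
    rw [Polynomial.eval_map]
    change Polynomial.eval₂RingHom (evS x) y p = _
    simp only [p]
    rw [MvPolynomial.hom_eval₂]
    have h1 : (Polynomial.eval₂RingHom (evS x) y).comp (Polynomial.C.comp (constS D)) = RingHom.id ℂ := by
      ext t
      simp only [RingHom.comp_apply, Polynomial.coe_eval₂RingHom, Polynomial.eval₂_C]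
      rfl
    rw [h1]
    change eval₂ (RingHom.id ℂ) _ P = eval₂ (RingHom.id ℂ) _ P
    congr 1
    ext q
    obtain ⟨⟨j, e⟩, a, b⟩ := q
    simp only [Function.comp_apply, ent]
    rw [AT_map _ _ _ hG, XT_map _ _ _ hG]
    unfold upd
    split_ifs
    · simp [Polynomial.eval₂_mul]; exact mul_comm _ _
    · simp
    · simp [mT, slHom_map]
  refine ⟨Polynomial.resultant (Polynomial.X ^ n - Polynomial.C d) p n p.natDegree, fun x => ?_⟩
  rw [← Polynomial.resultant_map_map]
  have hm : (Polynomial.X ^ n - Polynomial.C d).map (evS x) = Polynomial.X ^ n - Polynomial.C (evS x d) := by simp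
  have hnd : (Polynomial.X ^ n - Polynomial.C (evS x d)).natDegree = n := Polynomial.natDegree_X_pow_sub_C
  have hmon : (Polynomial.X ^ n - Polynomial.C (evS x d)).Monic := Polynomial.monic_X_pow_sub_C _ (by omega)
  have hr := Polynomial.resultant_eq_prod_eval (Polynomial.X ^ n - Polynomial.C (evS x d)) (p.map (evS x)) p.natDegree Polynomial.natDegree_map_le (IsAlgClosed.splits _)
  rw [hnd] at hr
  rw [hm, hr, hmon.leadingCoeff, one_pow, one_mul, Multiset.prod_eq_zero_iff, Multiset.mem_map]
  have hdx : (XT (mT (evS x) zS) k).det = evS x (XT zS k).det := by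
    rw [XT_map _ _ _ hG, RingHom.map_det]; rfl
  have hdd : evS x d * evS x (XT zS k).det = 1 := by
    rw [← map_mul, Ring.inverse_mul_cancel _ hdu, map_one]
  refine exists_congr fun y => and_congr ?_ ?_
  · rw [Polynomial.mem_roots hmon.ne_zero, Polynomial.IsRoot.def, hdx]
    simp only [Polynomial.eval_sub, Polynomial.eval_pow, Polynomial.eval_X, Polynomial.eval_C]
    constructor
    · intro h; rw [sub_eq_zero.mp h, hdd]
    · intro h
      have : evS x (XT zS k).det ≠ 0 := right_ne_zero_of_mul_eq_one hdd
      exact sub_eq_zero.mpr (mul_right_cancel₀ this (h.trans hdd.symm))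
  · rw [hp]

theorem E_main (hn : 2 ≤ n) (T : Fin g × Bool → Matrix (Fin n) (Fin n) ℝ) (P : MvPolynomial ((Fin g × Bool) × Fin n × Fin n) ℂ)
    (hP : ∀ B ∈ HIT g n T, eval (fun p => ((B p.1 p.2.1 p.2.2 : ℝ) : ℂ)) P = 0) (k : Fin g)
    (B0 : Fin g × Bool → Matrix (Fin n) (Fin n) ℝ) (hB0 : B0 ∈ HIT g n T) (hQ0 : QQ (B0 (k,false)) (B0 (k,true)) ≠ 0)
    (B1 : Fin g × Bool → Matrix (Fin n) (Fin n) ℂ) (hB1 : B1 ∈ RepVariety g n ℂ) (hQ1 : QQ (B1 (k,false)) (B1 (k,true)) ≠ 0) :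
    ∃ y : ℂ, y ^ n = 1 ∧ eval (fun p => upd B1 k (B1 (k,false)) (y • B1 (k,true)) p.1 p.2.1 p.2.2) P = 0 := by
  have hB0' : B0 ∈ RepVariety g n ℝ := connectedComponentIn_subset _ _ hB0
  obtain ⟨s0, hs0A, hs0⟩ := (rep_iff _).mp hB0'
  obtain ⟨s1, hs1A, hs1⟩ := (rep_iff _).mp hB1
  let aI : Polynomial ℝ →+* ℂ := (Polynomial.aeval Complex.I : Polynomial ℝ →ₐ[ℝ] ℂ).toRingHom
  have hz : ∀ x, ∃ z : SL n (Polynomial ℝ), SpecialLinearGroup.map (Polynomial.evalRingHom 0) z = s0 x ∧ SpecialLinearGroup.map aI z = s1 x := by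
    intro x
    obtain ⟨σ, h0, h1⟩ := SL_curve hn (Polynomial.evalRingHom (0:ℝ)) aI (fun u => by
      refine ⟨- Polynomial.C u.re * Polynomial.X ^ 2 + Polynomial.C u.im * Polynomial.X, by simp, ?_⟩
      simp only [aI, AlgHom.toRingHom_eq_coe, RingHom.coe_coe, map_add, map_mul, map_neg, map_pow, Polynomial.aeval_X, Polynomial.aeval_C, Complex.I_sq]
      simp only [Complex.coe_algebraMap]
      conv_rhs => rw [← Complex.re_add_im u]
      ring) ((SpecialLinearGroup.map Complex.ofRealHom (s0 x))⁻¹ * s1 x)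
    refine ⟨SpecialLinearGroup.map Polynomial.C (s0 x) * σ, ?_, ?_⟩
    · rw [map_mul, h0, mul_one]; ext a b; simp
    · rw [map_mul, h1]
      have : SpecialLinearGroup.map aI (SpecialLinearGroup.map Polynomial.C (s0 x)) = SpecialLinearGroup.map Complex.ofRealHom (s0 x) := by
        ext a b; simp [aI]
      rw [this, mul_inv_cancel_left]
  choose z hz0 hz1 using hz
  let aev : ℂ → (Polynomial ℝ →+* ℂ) := fun t => (Polynomial.aeval t : Polynomial ℝ →ₐ[ℝ] ℂ).toRingHom
  have m0 : mT (Polynomial.evalRingHom 0) z = s0 := funext hz0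
  have m1 : mT (aev Complex.I) z = s1 := funext hz1
  have aer : ∀ r : ℝ, aev (r:ℂ) = Complex.ofRealHom.comp (Polynomial.evalRingHom r) := by
    intro r
    ext p
    · simp [aev]
    · simp [aev]
  obtain ⟨G0, A0, X0⟩ := recoverT s0 hs0 k (by rw [← hs0A, ← hs0A]; exact hQ0)
  obtain ⟨G1, A1, X1⟩ := recoverT s1 hs1 k (by rw [← hs1A, ← hs1A]; exact hQ1)
  let D : Set ℂ := {t | GoodT (mT (aev t) z) k}
  have hID : Complex.I ∈ D := by change GoodT (mT (aev Complex.I) z) k; rw [m1]; exact G1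
  have h0D : GoodT (mT (aev 0) z) k := by
    have : mT (aev 0) z = mT Complex.ofRealHom s0 := by
      rw [← m0, mT_mT, ← aer]; simp
    rw [this]; exact GoodT_map _ _ _ G0
  obtain ⟨ε, hε, hball⟩ := Metric.eventually_nhds_iff_ball.mp (good_open z k 0 h0D)
  let zS : Fin g × Bool → SL n (SD D) := mT (incS D) z
  have hev : ∀ x : D, mT (evS x) zS = mT (aev (x:ℂ)) z := fun x => rfl
  have hu1 : IsUnit (Del (cT zS k) (WT zS k)) := by
    apply SD_unit
    intro x
    rw [Del_map, ← cT_map, ← WT_map, hev]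
    exact x.2.1.ne_zero
  have hGS : GoodT zS k := by
    refine ⟨hu1, SD_unit _ fun x => ?_, SD_unit _ fun x => ?_⟩
    · rw [cyc_map, AS_map _ _ _ hu1, ← cT_map, ← WT_map, hev]
      exact x.2.2.1.ne_zero
    · rw [RingHom.map_det, RingHom.mapMatrix_apply, KM_map, Matrix.map_mul, AS_map _ _ _ hu1, ← cT_map, ← WT_map, ← wT_map, hev]
      exact x.2.2.2.ne_zero
  obtain ⟨N, hN⟩ := exists_norm (by omega) zS k hGS P
  -- the real path
  let J : Set ℝ := Metric.ball 0 ε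
  have hJ : ∀ r : J, ((r:ℝ):ℂ) ∈ D := fun r => hball _ (by
    have h : |(r:ℝ)| < ε := by
      have := Metric.mem_ball.mp r.2
      rwa [Real.dist_eq, sub_zero] at this
    simpa only [Metric.mem_ball, dist_zero_right, Complex.norm_real, Real.norm_eq_abs] using h)
  let ι : J → D := fun r => ⟨((r:ℝ):ℂ), hJ r⟩
  have hι : Continuous ι := by
    apply Continuous.subtype_mk
    exact Complex.continuous_ofReal.comp continuous_subtype_val
  let sr : J → Fin g × Bool → SL n ℝ := fun r => mT (Polynomial.evalRingHom (r:ℝ)) z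
  have hsr : ∀ r : J, mT (evS (ι r)) zS = mT Complex.ofRealHom (sr r) := by
    intro r
    rw [hev, mT_mT, ← aer]
  have hGr : ∀ r : J, GoodT (sr r) k := fun r => GoodT_of_map Complex.ofRealHom _ _ (by rw [← hsr]; exact hJ r)
  have hArC : ∀ r : J, (AT (sr r) k).map Complex.ofRealHom = AT (mT (evS (ι r)) zS) k := fun r => by
    rw [hsr, AT_map _ _ _ (hGr r)]
  have hXrC : ∀ r : J, (XT (sr r) k).map Complex.ofRealHom = XT (mT (evS (ι r)) zS) k := fun r => by
    rw [hsr, XT_map _ _ _ (hGr r)]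
  have hXc : Continuous (fun r : J => XT (sr r) k) := by
    refine continuous_pi fun a => continuous_pi fun b => ?_
    have : ∀ r : J, XT (sr r) k a b = (evS (ι r) (XT zS k a b)).re := fun r => by
      have := congrFun (congrFun (hXrC r) a) b
      rw [XT_map _ _ _ hGS] at this
      rw [← Matrix.map_apply (f := evS (ι r)), ← this]; simp
    simp only [this]
    exact Complex.continuous_re.comp ((SD_cont _).comp hι)
  have hAc : Continuous (fun r : J => AT (sr r) k) := by
    refine continuous_pi fun a => continuous_pi fun b => ?_
    have : ∀ r : J, AT (sr r) k a b = (evS (ι r) (AT zS k a b)).re := fun r => by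
      have := congrFun (congrFun (hArC r) a) b
      rw [AT_map _ _ _ hGS] at this
      rw [← Matrix.map_apply (f := evS (ι r)), ← this]; simp
    simp only [this]
    exact Complex.continuous_re.comp ((SD_cont _).comp hι)
  have hsc : ∀ x, Continuous (fun r : J => slHom n ℝ (sr r x)) := by
    intro x
    refine continuous_pi fun a => continuous_pi fun b => ?_
    exact ((z x).1 a b).continuous.comp continuous_subtype_val
  have hdc : Continuous (fun r : J => (XT (sr r) k).det) := hXc.matrix_det
  have hd0 : ∀ r : J, (XT (sr r) k).det ≠ 0 := fun r => (XS_det _ _ _ (hGr r)).ne_zero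
  let z0 : J := ⟨0, Metric.mem_ball_self hε⟩
  have hsr0 : sr z0 = s0 := m0
  haveI : PreconnectedSpace J := Subtype.preconnectedSpace (convex_ball (0:ℝ) ε).isPreconnected
  have hdpos : ∀ r : J, 0 < (XT (sr r) k).det := by
    intro r
    by_contra hr
    obtain ⟨r', hr'⟩ := mem_range_of_exists_le_of_exists_ge hdc ⟨r, not_lt.mp hr⟩ ⟨z0, by
      rw [hsr0, X0]; exact le_of_lt (by rw [show (slHom n ℝ (s0 (k,true))).det = 1 from (s0 (k,true)).2]; exact one_pos)⟩
    exact hd0 r' hr'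
  let rt : J → ℝ := fun r => ((XT (sr r) k).det ^ (1 / (n:ℝ)))⁻¹
  have hn0 : (n:ℝ) ≠ 0 := by exact_mod_cast (by omega : n ≠ 0)
  have hrtc : Continuous rt := by
    apply Continuous.inv₀
    · exact hdc.rpow_const (fun r => Or.inl (hd0 r))
    · intro r; exact (Real.rpow_pos_of_pos (hdpos r) _).ne'
  have hrt : ∀ r, rt r ^ n * (XT (sr r) k).det = 1 := by
    intro r
    simp only [rt]
    rw [inv_pow, ← Real.rpow_natCast, ← Real.rpow_mul (hdpos r).le, one_div, inv_mul_cancel₀ hn0, Real.rpow_one, inv_mul_cancel₀ (hd0 r)]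
  let ρ : J → Fin g × Bool → Matrix (Fin n) (Fin n) ℝ := fun r => upd (fun x => slHom n ℝ (sr r x)) k (AT (sr r) k) (rt r • XT (sr r) k)
  have hρc : Continuous ρ := by
    refine continuous_pi fun x => ?_
    simp only [ρ, upd]
    split_ifs
    · exact hrtc.smul hXc
    · exact hAc
    · exact hsc x
  have hρ0 : ρ z0 = B0 := by
    simp only [ρ, rt, hsr0, A0, X0]
    rw [show (slHom n ℝ (s0 (k,true))).det = 1 from (s0 (k,true)).2]
    simp only [Real.one_rpow, inv_one, one_smul, ← hs0A]
    exact upd_self _ _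
  have hρH : ∀ r, ρ r ∈ HIT g n T := by
    intro r
    have h1 := (isPreconnected_range hρc).subset_connectedComponentIn (x := B0) (F := RepVariety g n ℝ) ⟨z0, hρ0⟩ (by
      rintro _ ⟨r, rfl⟩
      exact repT (by omega) _ _ (hGr r) _ (hrt r))
    unfold HIT
    rw [connectedComponentIn_eq hB0]
    exact h1 ⟨r, rfl⟩
  have hNz : ∀ r : J, evS (ι r) N = 0 := by
    intro r
    rw [hN]
    refine ⟨(rt r : ℂ), ?_, ?_⟩
    · rw [← hXrC]
      have := hrt r
      have h2 := congrArg Complex.ofRealHom this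
      rw [map_mul, map_pow, RingHom.map_det, map_one] at h2
      exact h2
    · rw [← hP _ (hρH r)]
      congr 2
      ext q
      simp only [ρ]
      rw [← hXrC, ← hArC, hsr]
      unfold upd
      split_ifs
      · simp
      · simp
      · simp [mT, slHom_map]
  have hfin := SD_zero N (by
    refine Set.Infinite.mono (s := (fun r : ℝ => (r:ℂ)) '' J) ?_ ?_
    · rintro _ ⟨r, hr, rfl⟩
      exact ⟨hJ ⟨r, hr⟩, hNz ⟨r, hr⟩⟩
    · apply Set.Infinite.image (Complex.ofReal_injective.injOn)
      exact infinite_of_mem_nhds 0 (Metric.ball_mem_nhds 0 hε)) ⟨Complex.I, hID⟩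
  rw [hN, hev] at hfin
  simp only [m1, A1, X1] at hfin
  obtain ⟨y, hy, hy2⟩ := hfin
  rw [show (slHom n ℂ (s1 (k,true))).det = 1 from (s1 (k,true)).2, mul_one] at hy
  refine ⟨y, hy, ?_⟩
  rw [← hy2]
  congr 2
  ext q
  have : B1 = fun j => slHom n ℂ (s1 j) := funext hs1A
  rw [this]
end E3
end PartE3

section PartF1
section F1
variable {n g : ℕ}

theorem exists_proj (hn : 1 ≤ n) (A : Matrix (Fin n) (Fin n) ℂ) (hA : A.charpoly.Separable) :
    ∃ E : Matrix (Fin n) (Fin n) ℂ, E * A = A * E ∧ ∀ t : ℂ, (1 + t • E).det = 1 + t := by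
  have hdeg : A.charpoly.degree ≠ 0 := by
    rw [Matrix.charpoly_degree_eq_dim]; simp; omega
  obtain ⟨l, hl⟩ := IsAlgClosed.exists_root A.charpoly hdeg
  obtain ⟨q, hq⟩ := Polynomial.dvd_iff_isRoot.mpr hl
  have hql : q.eval l ≠ 0 := by
    intro h0
    have h1 := hA
    rw [hq] at h1
    have h2 : IsCoprime (Polynomial.X - Polynomial.C l) q := Polynomial.Separable.isCoprime h1
    obtain ⟨a, b, hab⟩ := h2
    have := congrArg (Polynomial.eval l) hab
    simp [h0] at this
  have hdet : (A - l • 1).det = 0 := by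
    have := hl
    rw [Polynomial.IsRoot.def, Matrix.eval_charpoly] at this
    rw [← neg_sub, Matrix.det_neg]
    rw [show (l • (1:Matrix (Fin n) (Fin n) ℂ)) = scalar (Fin n) l by rw [smul_one_eq_diagonal]; rfl, this, mul_zero]
  obtain ⟨u, hu, hu2⟩ := Matrix.exists_mulVec_eq_zero_iff.mpr hdet
  have hAu : A *ᵥ u = l • u := by
    rw [sub_mulVec, smul_mulVec, one_mulVec, sub_eq_zero] at hu2; exact hu2
  let M := Polynomial.aeval A q
  have hMA : M * A = l • M := by
    have h := Matrix.aeval_self_charpoly A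
    rw [hq, mul_comm, map_mul, map_sub, Polynomial.aeval_X, Polynomial.aeval_C, mul_sub, sub_eq_zero] at h
    rw [h, Algebra.algebraMap_eq_smul_one, mul_smul_comm, mul_one]
  have hMu : M *ᵥ u = q.eval l • u := by
    have hpow : ∀ p : Polynomial ℂ, (Polynomial.aeval A p) *ᵥ u = p.eval l • u := by
      intro p
      induction p using Polynomial.induction_on' with
      | add p q hp hq => rw [map_add, add_mulVec, hp, hq, Polynomial.eval_add, add_smul]
      | monomial k a =>
        rw [Polynomial.aeval_monomial, Polynomial.eval_monomial, Algebra.algebraMap_eq_smul_one, smul_mul_assoc, one_mul, smul_mulVec]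
        rw [mul_smul]
        congr 1
        induction k with
        | zero => simp
        | succ k ih => rw [pow_succ', ← mulVec_mulVec, ih, mulVec_smul, hAu, smul_smul, pow_succ]
    exact hpow q
  obtain ⟨i, hi⟩ := Function.ne_iff.mp hu
  have hvu : M i ⬝ᵥ u = q.eval l * u i := congrFun hMu i
  have hne : q.eval l * u i ≠ 0 := mul_ne_zero hql hi
  let v : Fin n → ℂ := (q.eval l * u i)⁻¹ • M i
  have hvu1 : v ⬝ᵥ u = 1 := by
    simp only [v]
    rw [smul_dotProduct, hvu, smul_eq_mul, inv_mul_cancel₀ hne]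
  have hvA : v ᵥ* A = l • v := by
    have : M i ᵥ* A = l • M i := congrFun hMA i
    simp only [v]
    rw [smul_vecMul, this, smul_comm]
  refine ⟨vecMulVec u v, ?_, fun t => ?_⟩
  · rw [vecMulVec_mul, mul_vecMulVec, hvA, hAu, vecMulVec_smul, smul_vecMulVec]
  · rw [← smul_vecMulVec, det_rank_one, det_one, adjugate_one, one_mulVec, dotProduct_smul, hvu1, smul_eq_mul, mul_one]

theorem upd_upd {G : Type} (s : Fin g × Bool → G) (i : Fin g) (a b a' b' : G) : upd (upd s i a b) i a' b' = upd s i a' b' := by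
  ext ⟨j, e⟩
  by_cases h : j = i
  · subst h; cases e <;> simp [upd]
  · rw [upd_ne _ _ _ _ h, upd_ne _ _ _ _ h, upd_ne _ _ _ _ h]

theorem rep_twist (B : Fin g × Bool → Matrix (Fin n) (Fin n) ℂ) (hB : B ∈ RepVariety g n ℂ) (k : Fin g)
    (C : Matrix (Fin n) (Fin n) ℂ) (hC : C.det = 1) (hCA : C * B (k,false) = B (k,false) * C) :
    upd B k (B (k,false)) (B (k,true) * C) ∈ RepVariety g n ℂ := by
  obtain ⟨h1, h2⟩ := hB
  refine ⟨?_, ?_⟩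
  · rintro ⟨j, e⟩
    by_cases h : j = k
    · subst h
      cases e
      · rw [upd_false]; exact h1 _
      · rw [upd_true, det_mul, h1, hC, one_mul]
    · rw [upd_ne _ _ _ _ h]; exact h1 _
  · rw [← h2]
    congr 2
    funext j
    by_cases h : j = k
    · subst h
      rw [upd_false, upd_true, Matrix.mul_inv_rev]
      have hA : IsUnit (B (j,false)).det := by rw [h1]; exact isUnit_one
      have hCu : IsUnit C.det := by rw [hC]; exact isUnit_one
      have hc2 : C * (B (j,false))⁻¹ = (B (j,false))⁻¹ * C := by
        calc C * (B (j,false))⁻¹ = (B (j,false))⁻¹ * (B (j,false) * C) * (B (j,false))⁻¹ := by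
              rw [← mul_assoc, Matrix.nonsing_inv_mul _ hA, one_mul]
          _ = _ := by rw [← hCA, mul_assoc, mul_assoc, Matrix.mul_nonsing_inv _ hA, mul_one]
      calc _ = B (j,false) * B (j,true) * (C * (B (j,false))⁻¹) * C⁻¹ * (B (j,true))⁻¹ := by simp only [mul_assoc]
        _ = B (j,false) * B (j,true) * (B (j,false))⁻¹ * (C * C⁻¹) * (B (j,true))⁻¹ := by rw [hc2]; simp only [mul_assoc]
        _ = _ := by rw [Matrix.mul_nonsing_inv _ hCu, mul_one]
    · rw [upd_ne _ _ _ _ h, upd_ne _ _ _ _ h]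

theorem QQ_twist (A B C : Matrix (Fin n) (Fin n) ℂ) (hC : C.det = 1) (hCA : C * A = A * C) : QQ A (B * C) = QQ A B := by
  unfold QQ
  have : B * C * A * (B * C).adjugate * A.adjugate = B * A * B.adjugate * A.adjugate := by
    rw [adjugate_mul_distrib]
    calc _ = B * (C * A) * C.adjugate * B.adjugate * A.adjugate := by simp only [mul_assoc]
      _ = B * A * (C * C.adjugate) * B.adjugate * A.adjugate := by rw [hCA]; simp only [mul_assoc]
      _ = _ := by rw [mul_adjugate, hC, one_smul, mul_one]
  rw [this]

theorem F_main (hn : 2 ≤ n) (T : Fin g × Bool → Matrix (Fin n) (Fin n) ℝ) (P : MvPolynomial ((Fin g × Bool) × Fin n × Fin n) ℂ)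
    (hP : ∀ B ∈ HIT g n T, eval (fun p => ((B p.1 p.2.1 p.2.2 : ℝ) : ℂ)) P = 0) (k : Fin g)
    (B0 : Fin g × Bool → Matrix (Fin n) (Fin n) ℝ) (hB0 : B0 ∈ HIT g n T) (hQ0 : QQ (B0 (k,false)) (B0 (k,true)) ≠ 0)
    (B1 : Fin g × Bool → Matrix (Fin n) (Fin n) ℂ) (hB1 : B1 ∈ RepVariety g n ℂ) (hQ1 : QQ (B1 (k,false)) (B1 (k,true)) ≠ 0) :
    eval (fun p => B1 p.1 p.2.1 p.2.2) P = 0 := by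
  set A := B1 (k,false) with hAdef
  set B := B1 (k,true) with hBdef
  have hsep : A.charpoly.Separable := (dsc_ne_zero_iff (by omega) A).mp (right_ne_zero_of_mul hQ1)
  obtain ⟨E, hEA, hEd⟩ := exists_proj (by omega) A hsep
  let C : ℂ → Matrix (Fin n) (Fin n) ℂ := fun q => q⁻¹ • (1 + (q ^ n - 1) • E)
  have hCd : ∀ q : ℂ, q ≠ 0 → (C q).det = 1 := by
    intro q hq
    simp only [C]
    rw [det_smul, hEd, Fintype.card_fin, add_sub_cancel, ← mul_pow, inv_mul_cancel₀ hq, one_pow]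
  have hCA : ∀ q, C q * A = A * C q := by
    intro q
    simp only [C]
    rw [smul_mul_assoc, mul_smul_comm, add_mul, mul_add, smul_mul_assoc, mul_smul_comm, hEA, one_mul, mul_one]
  let f : ℂ → ℂ → ℂ := fun y q => eval (fun p => upd B1 k A (y • (B * C q)) p.1 p.2.1 p.2.2) P
  have hf : ∀ q : ℂ, q ≠ 0 → ∃ y : ℂ, y ^ n = 1 ∧ f y q = 0 := by
    intro q hq
    have h1 := rep_twist B1 hB1 k (C q) (hCd q hq) (hCA q)
    obtain ⟨y, hy, h2⟩ := E_main hn T P hP k B0 hB0 hQ0 _ h1 (by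
      rw [upd_false, upd_true, QQ_twist _ _ _ (hCd q hq) (hCA q)]; exact hQ1)
    refine ⟨y, hy, ?_⟩
    rw [upd_false, upd_true, upd_upd] at h2
    exact h2
  let D : Set ℂ := {0}ᶜ
  let X : SD D := ⟨fun x => (x:ℂ)⁻¹, Polynomial.X, 1, fun x => ⟨by rw [Polynomial.eval_X]; exact x.2, by
    have : (x:ℂ) ≠ 0 := x.2
    simp [this]⟩⟩
  let Z : SD D := ⟨fun x => (x:ℂ), 1, Polynomial.X, fun x => ⟨by simp, by simp⟩⟩
  have hF : ∀ y, ∃ F : SD D, ∀ x : D, evS x F = f y x := by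
    intro y
    let c : ℂ →+* SD D := constS D
    let ent : (Fin g × Bool) × Fin n × Fin n → SD D := fun p =>
      upd (fun j => (B1 j).map c) k (A.map c) (c y • (B.map c * (X • (1 + (Z ^ n - 1) • E.map c)))) p.1 p.2.1 p.2.2
    refine ⟨eval₂ c ent P, fun x => ?_⟩
    rw [MvPolynomial.hom_eval₂]
    have h1 : (evS x).comp c = RingHom.id ℂ := rfl
    have h1' : ∀ t, evS x (c t) = t := fun t => rfl
    have h1'' : ∀ M : Matrix (Fin n) (Fin n) ℂ, (M.map c).map (evS x) = M := fun t => rfl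
    have hX : evS x X = (x:ℂ)⁻¹ := rfl
    have hZ : evS x Z = (x:ℂ) := rfl
    rw [h1]
    change eval₂ (RingHom.id ℂ) _ P = eval₂ (RingHom.id ℂ) _ P
    congr 1
    ext q
    obtain ⟨⟨j, e⟩, a, b⟩ := q
    simp only [Function.comp_apply, ent]
    rw [← Matrix.map_apply (f := evS x), upd_apply_fun (fun M : Matrix (Fin n) (Fin n) (SD D) => M.map (evS x))]
    have : (c y • (B.map c * (X • (1 + (Z ^ n - 1) • E.map c)))).map (evS x) = y • (B * C x) := by
      change (evS x).mapMatrix _ = _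
      have hs : ∀ (r : SD D) (M : Matrix (Fin n) (Fin n) (SD D)), (evS x).mapMatrix (r • M) = evS x r • (evS x).mapMatrix M := by
        intro r M; ext a b; simp
      rw [hs, map_mul, hs, map_add, hs, map_one, map_sub, map_pow, map_one, h1', hX, hZ]
      rfl
    rw [this]
    rfl
  choose F hF using hF
  have hDinf : D.Infinite := (Set.finite_singleton (0:ℂ)).infinite_compl
  obtain ⟨y, hy, hyi⟩ : ∃ y : ℂ, y ^ n = 1 ∧ {z : ℂ | z ∈ D ∧ f y z = 0}.Infinite := by
    by_contra hcon
    push Not at hcon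
    have hfin : {y : ℂ | y ^ n = 1}.Finite := by
      have := (Polynomial.nthRoots n (1:ℂ)).toFinset.finite_toSet
      refine this.subset fun y hy => ?_
      simp only [Finset.mem_coe, Multiset.mem_toFinset]
      exact (Polynomial.mem_nthRoots (by omega)).mpr hy
    have := hfin.biUnion (t := fun y => {z : ℂ | z ∈ D ∧ f y z = 0}) (fun y hy => by
      simpa using hcon y hy)
    refine hDinf (this.subset fun z hz => ?_)
    obtain ⟨y, hy, h⟩ := hf z hz
    exact Set.mem_biUnion (x := y) hy ⟨hz, h⟩
  have hy0 : y ≠ 0 := by rintro rfl; rw [zero_pow (by omega)] at hy; exact zero_ne_one hy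
  have hfin := SD_zero (F y) (hyi.mono (by
    rintro z ⟨hz, hz2⟩
    exact ⟨hz, by rw [hF]; exact hz2⟩)) ⟨y, hy0⟩
  rw [hF] at hfin
  simp only [f, C] at hfin
  rw [hy, sub_self, zero_smul, add_zero, mul_smul_comm, mul_one, smul_smul, mul_inv_cancel₀ hy0, one_smul, hAdef, hBdef, upd_self] at hfin
  exact hfin
end F1
end PartF1

section PartH1
section H1
variable {n : ℕ}

theorem oneparam_unip (φ : ℝ → Matrix (Fin n) (Fin n) ℝ) (hc : Continuous φ) (h0 : φ 0 = 1)
    (D D' : Matrix (Fin n) (Fin n) ℝ) (hD : D' * D = 1) (hconj : ∀ t, D * φ t * D' = φ (4 * t)) (t : ℝ) :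
    (φ t - 1) ^ n = 0 := by
  have key : ∀ x : ℝ, ∀ s, (scalar (Fin n) x - φ (4 * s)).det = (scalar (Fin n) x - φ s).det := by
    intro x s
    have hD2 : D * D' = 1 := mul_eq_one_comm.mp hD
    have : scalar (Fin n) x - φ (4 * s) = D * (scalar (Fin n) x - φ s) * D' := by
      rw [mul_sub, sub_mul, hconj, ← (scalar_commute x (fun r => mul_comm x r) D).eq, mul_assoc, hD2, mul_one]
    rw [this, det_mul, det_mul, mul_right_comm, ← det_mul, hD2, det_one, one_mul]
  have key2 : ∀ x : ℝ, (scalar (Fin n) x - φ t).det = (scalar (Fin n) x - φ 0).det := by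
    intro x
    have hcd : Continuous (fun s => (scalar (Fin n) x - φ s).det) := (continuous_const.sub hc).matrix_det
    have h1 : ∀ m : ℕ, (scalar (Fin n) x - φ (t * ((1:ℝ)/4) ^ m)).det = (scalar (Fin n) x - φ t).det := by
      intro m
      induction m with
      | zero => simp
      | succ m ih => rw [← ih, ← key x (t * ((1:ℝ)/4) ^ (m+1))]; congr 3; ring
    have h2 : Filter.Tendsto (fun m : ℕ => t * ((1:ℝ)/4) ^ m) Filter.atTop (nhds 0) := by
      have := (tendsto_pow_atTop_nhds_zero_of_lt_one (r := (1:ℝ)/4) (by norm_num) (by norm_num)).const_mul t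
      rwa [mul_zero] at this
    have h3 := (hcd.tendsto 0).comp h2
    have h4 : ((fun s => (scalar (Fin n) x - φ s).det) ∘ fun m : ℕ => t * ((1:ℝ)/4) ^ m) = fun _ => (scalar (Fin n) x - φ t).det := by
      funext m; exact h1 m
    rw [h4] at h3
    exact tendsto_nhds_unique tendsto_const_nhds h3
  have hch : (φ t).charpoly = (Polynomial.X - 1) ^ n := by
    apply Polynomial.funext
    intro x
    rw [Matrix.eval_charpoly, key2, h0, ← Matrix.eval_charpoly, Matrix.charpoly_one, Fintype.card_fin]
  have := Matrix.aeval_self_charpoly (φ t)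
  rw [hch] at this
  simpa using this

/-- binomial polynomial -/
noncomputable def binP (i : ℕ) : Polynomial ℝ := Polynomial.C ((i.factorial : ℝ)⁻¹) * descPochhammer ℝ i

theorem binP_eval (i k : ℕ) : (binP i).eval (k:ℝ) = (k.choose i : ℝ) := by
  unfold binP
  rw [Polynomial.eval_mul, Polynomial.eval_C, descPochhammer_eval_eq_descFactorial, Nat.descFactorial_eq_factorial_mul_choose]
  push_cast
  rw [inv_mul_cancel_left₀]
  exact_mod_cast i.factorial_ne_zero

theorem unip_pow (M : Matrix (Fin n) (Fin n) ℝ) (hM : (M - 1) ^ n = 0) (k : ℕ) :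
    M ^ k = ∑ i ∈ Finset.range n, (k.choose i : ℝ) • (M - 1) ^ i := by
  have h1 : M ^ k = ∑ i ∈ Finset.range (k + 1), (k.choose i : ℝ) • (M - 1) ^ i := by
    conv_lhs => rw [show M = (M - 1) + 1 by abel]
    rw [(Commute.one_right (M - 1)).add_pow]
    refine Finset.sum_congr rfl fun i _ => ?_
    rw [one_pow, mul_one, Nat.cast_smul_eq_nsmul, nsmul_eq_mul']
  rw [h1]
  have z1 : ∀ i, n ≤ i → (k.choose i : ℝ) • (M - 1) ^ i = 0 := fun i hi => by rw [pow_eq_zero_of_le hi hM, smul_zero]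
  have z2 : ∀ i, k + 1 ≤ i → (k.choose i : ℝ) • (M - 1) ^ i = 0 := fun i hi => by
    rw [Nat.choose_eq_zero_of_lt (by omega), Nat.cast_zero, zero_smul]
  rcases le_total n (k+1) with h | h
  · symm
    apply Finset.sum_subset (Finset.range_subset_range.mpr h)
    intro i _ hi; exact z1 i (by simpa using hi)
  · apply Finset.sum_subset (Finset.range_subset_range.mpr h)
    intro i _ hi; exact z2 i (by simpa using hi)

theorem poly_eq_of_nat (p q : Polynomial ℝ) (h : ∀ k : ℕ, p.eval (k:ℝ) = q.eval (k:ℝ)) : p = q := by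
  apply Polynomial.eq_of_infinite_eval_eq
  refine (Set.infinite_range_of_injective (Nat.cast_injective (R := ℝ))).mono ?_
  rintro _ ⟨k, rfl⟩
  exact h k

theorem oneparam_poly (φ : ℝ → Matrix (Fin n) (Fin n) ℝ) (hc : Continuous φ) (h0 : φ 0 = 1) (hadd : ∀ s t, φ (s + t) = φ s * φ t)
    (hu : ∀ t, (φ t - 1) ^ n = 0) : ∃ p : Matrix (Fin n) (Fin n) (Polynomial ℝ), ∀ t, φ t = p.map (Polynomial.eval t) := by
  have hpow : ∀ (h : ℝ) (k : ℕ), φ (k * h) = φ h ^ k := by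
    intro h k
    induction k with
    | zero => simp [h0]
    | succ k ih => rw [pow_succ, ← ih, ← hadd]; congr 1; push_cast; ring
  let pp : ℝ → Matrix (Fin n) (Fin n) (Polynomial ℝ) := fun h => Matrix.of fun a b =>
    ∑ i ∈ Finset.range n, Polynomial.C (((φ h - 1) ^ i) a b) * binP i
  have hpp : ∀ (h : ℝ) (k : ℕ) a b, (pp h a b).eval (k:ℝ) = φ (k * h) a b := by
    intro h k a b
    rw [hpow, unip_pow _ (hu h)]
    simp only [pp, Matrix.of_apply, Polynomial.eval_finset_sum, Polynomial.eval_mul, Polynomial.eval_C, binP_eval, Matrix.sum_apply, Matrix.smul_apply, smul_eq_mul]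
    exact Finset.sum_congr rfl fun i _ => mul_comm _ _
  have hrat : ∀ (k N : ℕ), 0 < N → ∀ a b, (pp 1 a b).eval ((k:ℝ)/N) = φ ((k:ℝ)/N) a b := by
    intro k N hN a b
    have hN' : (N:ℝ) ≠ 0 := by exact_mod_cast hN.ne'
    have e : pp 1 a b = (pp (1/N) a b).comp (Polynomial.C (N:ℝ) * Polynomial.X) := by
      apply poly_eq_of_nat
      intro l
      rw [Polynomial.eval_comp, Polynomial.eval_mul, Polynomial.eval_C, Polynomial.eval_X, hpp, ← Nat.cast_mul, hpp]
      have : (l:ℝ) * 1 = ((N * l : ℕ):ℝ) * (1 / N) := by push_cast; field_simp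
      rw [this]
    rw [e, Polynomial.eval_comp, Polynomial.eval_mul, Polynomial.eval_C, Polynomial.eval_X, mul_div_cancel₀ _ hN', hpp]
    congr 2; ring
  have hpos : ∀ t : ℝ, 0 ≤ t → ∀ a b, (pp 1 a b).eval t = φ t a b := by
    intro t ht a b
    have h1 : Filter.Tendsto (fun N : ℕ => ((⌊t * (N:ℝ)⌋₊ : ℝ)) / (N:ℝ)) Filter.atTop (nhds t) :=
      (tendsto_nat_floor_mul_div_atTop ht).comp tendsto_natCast_atTop_atTop
    have h2 := ((pp 1 a b).continuous.tendsto t).comp h1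
    have hcab : Continuous (fun s => φ s a b) := (continuous_apply b).comp ((continuous_apply a).comp hc)
    have h3 := (hcab.tendsto t).comp h1
    refine tendsto_nhds_unique (h2.congr' ?_) h3
    filter_upwards [Filter.eventually_gt_atTop 0] with N hN
    exact hrat _ N hN a b
  refine ⟨pp 1, fun t => ?_⟩
  ext a b
  rw [Matrix.map_apply]
  obtain ⟨M, hM⟩ := exists_nat_ge (-t)
  have e : pp 1 a b = ∑ c, (pp 1 a c).comp (Polynomial.X + Polynomial.C (M:ℝ)) * Polynomial.C (φ (-M) c b) := by
    apply poly_eq_of_nat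
    intro l
    simp only [Polynomial.eval_finset_sum, Polynomial.eval_mul, Polynomial.eval_comp, Polynomial.eval_C, Polynomial.eval_X, Polynomial.eval_add]
    have : ∀ c, (pp 1 a c).eval ((l:ℝ) + M) = φ (l + M) a c := fun c => hpos _ (by positivity) a c
    simp only [this]
    rw [← Matrix.mul_apply, ← hadd, hpos _ (by positivity), add_neg_cancel_right]
  rw [e]
  simp only [Polynomial.eval_finset_sum, Polynomial.eval_mul, Polynomial.eval_comp, Polynomial.eval_C, Polynomial.eval_X, Polynomial.eval_add]
  have : ∀ c, (pp 1 a c).eval (t + M) = φ (t + M) a c := fun c => hpos _ (by linarith) a c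
  simp only [this]
  rw [← Matrix.mul_apply, ← hadd, add_neg_cancel_right]
end H1
end PartH1

section PartH2
section H2
variable {n : ℕ}

/-- entrywise derivative -/
def MDer {m : ℕ} (f : ℝ → Matrix (Fin m) (Fin m) ℝ) (f' : Matrix (Fin m) (Fin m) ℝ) (t : ℝ) : Prop :=
  ∀ a b, HasDerivAt (fun s => f s a b) (f' a b) t

theorem MDer.unique {m : ℕ} {f : ℝ → Matrix (Fin m) (Fin m) ℝ} {f' f'' : Matrix (Fin m) (Fin m) ℝ} {t : ℝ}
    (h : MDer f f' t) (h' : MDer f f'' t) : f' = f'' := by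
  ext a b; exact (h a b).unique (h' a b)

theorem MDer.mul {m : ℕ} {f g : ℝ → Matrix (Fin m) (Fin m) ℝ} {f' g' : Matrix (Fin m) (Fin m) ℝ} {t : ℝ}
    (hf : MDer f f' t) (hg : MDer g g' t) : MDer (fun s => f s * g s) (f' * g t + f t * g') t := by
  intro a b
  simp only [Matrix.add_apply, Matrix.mul_apply, ← Finset.sum_add_distrib]
  exact HasDerivAt.fun_sum fun c _ => (hf a c).mul (hg c b)

theorem MDer.const {m : ℕ} (M : Matrix (Fin m) (Fin m) ℝ) (t : ℝ) : MDer (fun _ => M) 0 t := fun a b => hasDerivAt_const t (M a b)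

theorem MDer.congr {m : ℕ} {f g : ℝ → Matrix (Fin m) (Fin m) ℝ} {f' : Matrix (Fin m) (Fin m) ℝ} {t : ℝ}
    (hf : MDer f f' t) (h : ∀ᶠ s in nhds t, g s = f s) : MDer g f' t := fun a b =>
  (hf a b).congr_of_eventuallyEq (by filter_upwards [h] with s hs; rw [hs])

def ups (t : ℝ) : SL 2 ℝ := ⟨!![1, t; 0, 1], by simp [Matrix.det_fin_two]⟩
def lws (t : ℝ) : SL 2 ℝ := ⟨!![1, 0; t, 1], by simp [Matrix.det_fin_two]⟩
noncomputable def dg2 : SL 2 ℝ := ⟨!![2, 0; 0, 1/2], by simp [Matrix.det_fin_two]⟩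

theorem sl2_ext (A B : SL 2 ℝ) (h00 : A.1 0 0 = B.1 0 0) (h01 : A.1 0 1 = B.1 0 1) (h10 : A.1 1 0 = B.1 1 0) (h11 : A.1 1 1 = B.1 1 1) : A = B := by
  apply Subtype.ext
  ext a b
  fin_cases a <;> fin_cases b <;> assumption

theorem sl_val_mul {m : ℕ} (A B : SL m ℝ) : (A * B).1 = A.1 * B.1 := rfl
theorem sl_val_one {m : ℕ} : (1 : SL m ℝ).1 = 1 := rfl
theorem sl2_inv (A : SL 2 ℝ) : (A⁻¹).1 = !![A.1 1 1, -A.1 0 1; -A.1 1 0, A.1 0 0] := by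
  rw [Matrix.SpecialLinearGroup.coe_inv, Matrix.adjugate_fin_two]

theorem sl2_det (A : SL 2 ℝ) : A.1 0 0 * A.1 1 1 - A.1 0 1 * A.1 1 0 = 1 := by
  have := A.2; rwa [Matrix.det_fin_two] at this

theorem ups_add (s t : ℝ) : ups (s + t) = ups s * ups t := by
  apply sl2_ext <;> rw [sl_val_mul] <;> simp [ups, Matrix.mul_apply, add_comm]
theorem lws_add (s t : ℝ) : lws (s + t) = lws s * lws t := by
  apply sl2_ext <;> rw [sl_val_mul] <;> simp [lws, Matrix.mul_apply]
theorem ups_zero : ups 0 = 1 := by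
  apply sl2_ext <;> rw [sl_val_one] <;> simp [ups]
theorem lws_zero : lws 0 = 1 := by
  apply sl2_ext <;> rw [sl_val_one] <;> simp [lws]
theorem dg2_ups (t : ℝ) : dg2 * ups t * dg2⁻¹ = ups (4 * t) := by
  apply sl2_ext <;> rw [sl_val_mul, sl_val_mul, sl2_inv] <;> simp [ups, dg2, Matrix.mul_apply] <;> ring
theorem dg2_lws (t : ℝ) : dg2⁻¹ * lws t * dg2⁻¹⁻¹ = lws (4 * t) := by
  rw [inv_inv]
  apply sl2_ext <;> rw [sl_val_mul, sl_val_mul, sl2_inv] <;> simp [lws, dg2, Matrix.mul_apply] <;> ring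

theorem cont_ups : Continuous ups := by
  refine continuous_induced_rng.2 ?_
  refine continuous_pi fun a => continuous_pi fun b => ?_
  fin_cases a <;> fin_cases b <;> simp [ups] <;> fun_prop
theorem cont_lws : Continuous lws := by
  refine continuous_induced_rng.2 ?_
  refine continuous_pi fun a => continuous_pi fun b => ?_
  fin_cases a <;> fin_cases b <;> simp [lws] <;> fun_prop

theorem j_poly (j : SL 2 ℝ →* SL n ℝ) (hj : Continuous j) (f : ℝ → SL 2 ℝ) (hf : Continuous f) (h0 : f 0 = 1)
    (hadd : ∀ s t, f (s + t) = f s * f t) (d : SL 2 ℝ) (hd : ∀ t, d * f t * d⁻¹ = f (4 * t)) :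
    ∃ p : Matrix (Fin n) (Fin n) (Polynomial ℝ), ∀ t, (j (f t)).1 = p.map (Polynomial.eval t) := by
  have hc : Continuous (fun t => (j (f t)).1) := continuous_induced_dom.comp (hj.comp hf)
  refine oneparam_poly _ hc (by rw [h0, map_one]; rfl) (fun s t => by rw [hadd, map_mul]; rfl) ?_
  refine oneparam_unip _ hc (by rw [h0, map_one]; rfl) (j d).1 (j d⁻¹).1 ?_ ?_
  · rw [← sl_val_mul, ← map_mul, inv_mul_cancel, map_one]; rfl
  · intro t
    rw [← hd, map_mul, map_mul]; rfl

/-- `p`, `q` describe `j` on unipotents -/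
structure PQ (j : SL 2 ℝ →* SL n ℝ) (p q : Matrix (Fin n) (Fin n) (Polynomial ℝ)) : Prop where
  hp : ∀ t, (j (ups t)).1 = p.map (Polynomial.eval t)
  hq : ∀ t, (j (lws t)).1 = q.map (Polynomial.eval t)

theorem exists_PQ (j : SL 2 ℝ →* SL n ℝ) (hj : Continuous j) : ∃ p q, PQ j p q := by
  obtain ⟨p, hp⟩ := j_poly j hj ups cont_ups ups_zero ups_add dg2 dg2_ups
  obtain ⟨q, hq⟩ := j_poly j hj lws cont_lws lws_zero lws_add dg2⁻¹ dg2_lws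
  exact ⟨p, q, hp, hq⟩

noncomputable def dM (p : Matrix (Fin n) (Fin n) (Polynomial ℝ)) (t : ℝ) : Matrix (Fin n) (Fin n) ℝ :=
  Matrix.of fun a b => ((p a b).derivative).eval t

theorem MDer_poly (p : Matrix (Fin n) (Fin n) (Polynomial ℝ)) {x : ℝ → ℝ} {x' t : ℝ} (hx : HasDerivAt x x' t) :
    MDer (fun s => p.map (Polynomial.eval (x s))) (x' • dM p (x t)) t := by
  intro a b
  simp only [Matrix.map_apply, Matrix.smul_apply, dM, Matrix.of_apply, smul_eq_mul]
  rw [mul_comm]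
  exact ((p a b).hasDerivAt (x t)).comp t hx

noncomputable def LL (p q : Matrix (Fin n) (Fin n) (Polynomial ℝ)) (X : Matrix (Fin 2) (Fin 2) ℝ) : Matrix (Fin n) (Fin n) ℝ :=
  (X 0 0 + X 0 1) • dM p 0 + (X 1 0 + X 1 1) • dM q 0 + X 1 1 • (q.map (Polynomial.eval 1) * dM p 0 * q.map (Polynomial.eval (-1)))

theorem LL_add (p q : Matrix (Fin n) (Fin n) (Polynomial ℝ)) (X Z : Matrix (Fin 2) (Fin 2) ℝ) : LL p q (X + Z) = LL p q X + LL p q Z := by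
  simp only [LL, Matrix.add_apply]; module
theorem LL_smul (p q : Matrix (Fin n) (Fin n) (Polynomial ℝ)) (c : ℝ) (X : Matrix (Fin 2) (Fin 2) ℝ) : LL p q (c • X) = c • LL p q X := by
  simp only [LL, Matrix.smul_apply, smul_eq_mul]; module

theorem MDer.LL {p q : Matrix (Fin n) (Fin n) (Polynomial ℝ)} {f : ℝ → Matrix (Fin 2) (Fin 2) ℝ} {f' : Matrix (Fin 2) (Fin 2) ℝ} {t : ℝ}
    (h : MDer f f' t) : MDer (fun s => LL p q (f s)) (LL p q f') t := by
  intro a b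
  simp only [_root_.LL, Matrix.add_apply, Matrix.smul_apply, smul_eq_mul]
  exact ((((h 0 0).add (h 0 1)).mul_const _).add (((h 1 0).add (h 1 1)).mul_const _)).add ((h 1 1).mul_const _)

theorem sl2_decomp (M : SL 2 ℝ) (h : M.1 1 0 + M.1 1 1 ≠ 0) :
    M = ups ((M.1 0 0 + M.1 0 1 - 1) / (M.1 1 0 + M.1 1 1)) * lws (M.1 1 0 + M.1 1 1) * ups ((M.1 1 1 - 1) / (M.1 1 0 + M.1 1 1)) * lws (-1) := by
  have hd := sl2_det M
  apply sl2_ext <;> rw [sl_val_mul, sl_val_mul, sl_val_mul] <;> simp [ups, lws, Matrix.mul_apply] <;> field_simp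
  · linear_combination hd
  · linear_combination (-1) * hd
  · ring
  · ring

/-- the rational extension of `j` -/
noncomputable def JJ (p q : Matrix (Fin n) (Fin n) (Polynomial ℝ)) (M : Matrix (Fin 2) (Fin 2) ℝ) : Matrix (Fin n) (Fin n) ℝ :=
  p.map (Polynomial.eval ((M 0 0 + M 0 1 - 1) / (M 1 0 + M 1 1))) * q.map (Polynomial.eval (M 1 0 + M 1 1)) * p.map (Polynomial.eval ((M 1 1 - 1) / (M 1 0 + M 1 1))) * q.map (Polynomial.eval (-1))

variable {j : SL 2 ℝ →* SL n ℝ} {p q : Matrix (Fin n) (Fin n) (Polynomial ℝ)}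

theorem PQ.J (h : PQ j p q) (M : SL 2 ℝ) (hM : M.1 1 0 + M.1 1 1 ≠ 0) : (j M).1 = JJ p q M.1 := by
  conv_lhs => rw [sl2_decomp M hM]
  rw [map_mul, map_mul, map_mul, sl_val_mul, sl_val_mul, sl_val_mul, h.hp, h.hp, h.hq, h.hq]
  rfl

theorem PQ.dp (h : PQ j p q) (t : ℝ) : dM p t = dM p 0 * p.map (Polynomial.eval t) := by
  have h1 := MDer_poly p (x := fun s => s + t) (t := 0) (x' := 1) ((hasDerivAt_id 0).add_const t)
  have h2 := (MDer_poly p (hasDerivAt_id 0)).mul (MDer.const (p.map (Polynomial.eval t)) 0)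
  have h3 : (fun s => p.map (Polynomial.eval (s + t))) = fun s => p.map (Polynomial.eval (id s)) * p.map (Polynomial.eval t) := by
    funext s; rw [← h.hp, ups_add, map_mul, sl_val_mul, h.hp, h.hp]; rfl
  rw [h3] at h1
  have := h1.unique h2
  simpa using this

theorem PQ.dq (h : PQ j p q) (t : ℝ) : dM q t = dM q 0 * q.map (Polynomial.eval t) := by
  have h1 := MDer_poly q (x := fun s => s + t) (t := 0) (x' := 1) ((hasDerivAt_id 0).add_const t)
  have h2 := (MDer_poly q (hasDerivAt_id 0)).mul (MDer.const (q.map (Polynomial.eval t)) 0)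
  have h3 : (fun s => q.map (Polynomial.eval (s + t))) = fun s => q.map (Polynomial.eval (id s)) * q.map (Polynomial.eval t) := by
    funext s; rw [← h.hq, lws_add, map_mul, sl_val_mul, h.hq, h.hq]; rfl
  rw [h3] at h1
  have := h1.unique h2
  simpa using this

theorem PQ.p0 (h : PQ j p q) : p.map (Polynomial.eval 0) = 1 := by rw [← h.hp, ups_zero, map_one]; rfl
theorem PQ.q11 (h : PQ j p q) : q.map (Polynomial.eval 1) * q.map (Polynomial.eval (-1)) = 1 := by
  rw [← h.hq, ← h.hq, ← sl_val_mul, ← map_mul, ← lws_add, add_neg_cancel, lws_zero, map_one]; rfl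

theorem JJ_der (h : PQ j p q) {f : ℝ → Matrix (Fin 2) (Fin 2) ℝ} {X : Matrix (Fin 2) (Fin 2) ℝ} (h1 : f 0 = 1) (hX : MDer f X 0) :
    MDer (fun t => JJ p q (f t)) (LL p q X) 0 := by
  have hs : HasDerivAt (fun t => f t 1 0 + f t 1 1) (X 1 0 + X 1 1) 0 := (hX 1 0).add (hX 1 1)
  have hs0 : f 0 1 0 + f 0 1 1 = 1 := by rw [h1]; simp
  have hx : HasDerivAt (fun t => (f t 0 0 + f t 0 1 - 1) / (f t 1 0 + f t 1 1)) (X 0 0 + X 0 1) 0 := by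
    have := (((hX 0 0).add (hX 0 1)).sub_const 1).div hs (by rw [hs0]; exact one_ne_zero)
    refine this.congr_deriv ?_
    simp [h1]
  have hy : HasDerivAt (fun t => (f t 1 1 - 1) / (f t 1 0 + f t 1 1)) (X 1 1) 0 := by
    have := ((hX 1 1).sub_const 1).div hs (by rw [hs0]; exact one_ne_zero)
    refine this.congr_deriv ?_
    simp [h1]
  have := (((MDer_poly p hx).mul (MDer_poly q hs)).mul (MDer_poly p hy)).mul (MDer.const (q.map (Polynomial.eval (-1))) 0)
  refine (?_ : _ = LL p q X) ▸ this
  simp only [h1]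
  simp only [Matrix.one_apply_eq, ne_eq, zero_ne_one, one_ne_zero, not_false_eq_true, Matrix.one_apply_ne, zero_add, add_zero, sub_self, zero_div, h.p0, one_mul, mul_one, mul_zero]
  rw [h.dq 1, add_mul, add_mul]
  simp only [smul_mul_assoc, mul_smul_comm, mul_assoc, h.q11, mul_one, LL]

/-- curve through `1` with tangent `X` -/
def IsCurve (c : ℝ → SL 2 ℝ) (X : Matrix (Fin 2) (Fin 2) ℝ) : Prop := c 0 = 1 ∧ MDer (fun t => (c t).1) X 0

theorem IsCurve.ev {c : ℝ → SL 2 ℝ} {X : Matrix (Fin 2) (Fin 2) ℝ} (hc : IsCurve c X) : ∀ᶠ t in nhds (0:ℝ), (c t).1 1 0 + (c t).1 1 1 ≠ 0 := by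
  have hs : ContinuousAt (fun t => (c t).1 1 0 + (c t).1 1 1) 0 := ((hc.2 1 0).add (hc.2 1 1)).continuousAt
  exact hs.eventually_ne (by rw [hc.1, sl_val_one]; simp)

theorem Lcurve (h : PQ j p q) {c : ℝ → SL 2 ℝ} {X : Matrix (Fin 2) (Fin 2) ℝ} (hc : IsCurve c X) :
    MDer (fun t => (j (c t)).1) (LL p q X) 0 := by
  refine (JJ_der h (f := fun t => (c t).1) (by rw [hc.1]; rfl) hc.2).congr ?_
  filter_upwards [hc.ev] with t ht
  exact h.J _ ht

theorem IsCurve.conj {c : ℝ → SL 2 ℝ} {X : Matrix (Fin 2) (Fin 2) ℝ} (hc : IsCurve c X) (M : SL 2 ℝ) :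
    IsCurve (fun t => M * c t * M⁻¹) (M.1 * X * M⁻¹.1) := by
  refine ⟨by simp [hc.1], ?_⟩
  have := ((MDer.const M.1 0).mul hc.2).mul (MDer.const M⁻¹.1 0)
  simpa using this

theorem IsCurve.inv {c : ℝ → SL 2 ℝ} {X : Matrix (Fin 2) (Fin 2) ℝ} (hc : IsCurve c X) : IsCurve (fun t => (c t)⁻¹) (-X) := by
  refine ⟨by simp [hc.1], ?_⟩
  have h1 : MDer (fun t => ((c t)⁻¹).1) !![X 1 1, -X 0 1; -X 1 0, X 0 0] 0 := by
    intro a b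
    simp only [sl2_inv]
    fin_cases a <;> fin_cases b <;> simp
    · exact hc.2 1 1
    · exact (hc.2 0 1).neg
    · exact (hc.2 1 0).neg
    · exact hc.2 0 0
  have h2 := hc.2.mul h1
  have h3 : (fun t => (c t).1 * ((c t)⁻¹).1) = fun _ => 1 := by
    funext t; rw [← sl_val_mul, mul_inv_cancel]; rfl
  rw [h3] at h2
  have h4 := (MDer.const 1 0).unique h2
  simp only [hc.1, inv_one, sl_val_one, mul_one, one_mul] at h4
  rw [← eq_neg_of_add_eq_zero_right h4.symm]
  exact h1

theorem Lconj (h : PQ j p q) {c : ℝ → SL 2 ℝ} {X : Matrix (Fin 2) (Fin 2) ℝ} (hc : IsCurve c X) (M : SL 2 ℝ) :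
    LL p q (M.1 * X * M⁻¹.1) = (j M).1 * LL p q X * (j M⁻¹).1 := by
  have h1 := Lcurve h (hc.conj M)
  have h2 := ((MDer.const (j M).1 0).mul (Lcurve h hc)).mul (MDer.const (j M⁻¹).1 0)
  simp only [map_mul, sl_val_mul] at h1
  have := h1.unique h2
  simpa using this

theorem Lbr (h : PQ j p q) {c e : ℝ → SL 2 ℝ} {X Z : Matrix (Fin 2) (Fin 2) ℝ} (hc : IsCurve c X) (he : IsCurve e Z) :
    LL p q (X * Z - Z * X) = LL p q X * LL p q Z - LL p q Z * LL p q X := by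
  have h1 := ((hc.2.mul (MDer.const Z 0)).mul hc.inv.2).LL (p := p) (q := q)
  have h2 := ((Lcurve h hc).mul (MDer.const (LL p q Z) 0)).mul (Lcurve h hc.inv)
  simp only [Lconj h he] at h1
  have := h1.unique h2
  simp only [hc.1, inv_one, sl_val_one, mul_one, one_mul, mul_zero, add_zero, map_one] at this
  have hneg : LL p q (-X) = - LL p q X := by rw [← neg_one_smul ℝ, LL_smul, neg_one_smul]
  rw [hneg, mul_neg, mul_neg, ← sub_eq_add_neg, ← sub_eq_add_neg] at this
  exact this
end H2
end PartH2

section PartH3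
section H3
variable {n : ℕ} {j : SL 2 ℝ →* SL n ℝ} {p q : Matrix (Fin n) (Fin n) (Polynomial ℝ)}

/-- rational up to finitely many points -/
def IsR (f : ℝ → ℝ) : Prop := ∃ b h : Polynomial ℝ, b ≠ 0 ∧ ∀ t, b.eval t * f t = h.eval t

theorem IsR.const (c : ℝ) : IsR (fun _ => c) := ⟨1, Polynomial.C c, one_ne_zero, fun t => by simp⟩
theorem IsR.add {f g : ℝ → ℝ} (hf : IsR f) (hg : IsR g) : IsR (fun t => f t + g t) := by
  obtain ⟨b, h, hb, H⟩ := hf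
  obtain ⟨b', h', hb', H'⟩ := hg
  refine ⟨b * b', h * b' + h' * b, mul_ne_zero hb hb', fun t => ?_⟩
  rw [Polynomial.eval_mul, Polynomial.eval_add, Polynomial.eval_mul, Polynomial.eval_mul, ← H, ← H']; ring
theorem IsR.mul {f g : ℝ → ℝ} (hf : IsR f) (hg : IsR g) : IsR (fun t => f t * g t) := by
  obtain ⟨b, h, hb, H⟩ := hf
  obtain ⟨b', h', hb', H'⟩ := hg
  refine ⟨b * b', h * h', mul_ne_zero hb hb', fun t => ?_⟩
  rw [Polynomial.eval_mul, Polynomial.eval_mul, ← H, ← H']; ring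
theorem IsR.sub {f g : ℝ → ℝ} (hf : IsR f) (hg : IsR g) : IsR (fun t => f t - g t) := by
  have e : (fun t => f t - g t) = fun t => f t + -1 * g t := by funext t; ring
  rw [e]; exact hf.add ((IsR.const (-1)).mul hg)
theorem IsR.inv {f : ℝ → ℝ} (hf : IsR f) : IsR (fun t => (f t)⁻¹) := by
  obtain ⟨b, h, hb, H⟩ := hf
  by_cases hh : h = 0
  · refine ⟨b, 0, hb, fun t => ?_⟩
    have := H t
    rw [hh, Polynomial.eval_zero] at this
    rcases mul_eq_zero.mp this with h | h <;> simp [h]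
  · refine ⟨h * h, h * b, mul_ne_zero hh hh, fun t => ?_⟩
    rw [Polynomial.eval_mul, Polynomial.eval_mul, ← H]
    by_cases h0 : f t = 0
    · simp [h0]
    · field_simp
theorem IsR.div {f g : ℝ → ℝ} (hf : IsR f) (hg : IsR g) : IsR (fun t => f t / g t) := by
  simp only [div_eq_mul_inv]; exact hf.mul hg.inv
theorem IsR.sum {ι : Type} (s : Finset ι) {f : ι → ℝ → ℝ} (hf : ∀ i, IsR (f i)) : IsR (fun t => ∑ i ∈ s, f i t) := by
  classical
  induction s using Finset.induction_on with
  | empty => simpa using IsR.const 0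
  | insert a s ha ih => simp only [Finset.sum_insert ha]; exact (hf a).add ih
theorem IsR.poly (r : Polynomial ℝ) {f : ℝ → ℝ} (hf : IsR f) : IsR (fun t => r.eval (f t)) := by
  induction r using Polynomial.induction_on' with
  | add p q hp hq => simp only [Polynomial.eval_add]; exact hp.add hq
  | monomial k a =>
    simp only [Polynomial.eval_monomial]
    refine (IsR.const a).mul ?_
    induction k with
    | zero => simpa using IsR.const 1
    | succ k ih => simp only [pow_succ]; exact ih.mul hf

def IsRM {m : ℕ} (f : ℝ → Matrix (Fin m) (Fin m) ℝ) : Prop := ∀ a b, IsR (fun t => f t a b)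
theorem IsRM.mul {m : ℕ} {f g : ℝ → Matrix (Fin m) (Fin m) ℝ} (hf : IsRM f) (hg : IsRM g) : IsRM (fun t => f t * g t) := fun a b => by
  simp only [Matrix.mul_apply]
  exact IsR.sum _ fun c => (hf a c).mul (hg c b)
theorem IsRM.sub {m : ℕ} {f g : ℝ → Matrix (Fin m) (Fin m) ℝ} (hf : IsRM f) (hg : IsRM g) : IsRM (fun t => f t - g t) := fun a b =>
  (hf a b).sub (hg a b)
theorem IsRM.const {m : ℕ} (M : Matrix (Fin m) (Fin m) ℝ) : IsRM (fun _ => M) := fun a b => IsR.const _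
theorem IsRM.poly (p : Matrix (Fin n) (Fin n) (Polynomial ℝ)) {f : ℝ → ℝ} (hf : IsR f) : IsRM (fun t => p.map (Polynomial.eval (f t))) := fun a b =>
  IsR.poly _ hf

theorem IsRM.JJ {f : ℝ → Matrix (Fin 2) (Fin 2) ℝ} (hf : IsRM f) : IsRM (fun t => JJ p q (f t)) := by
  unfold _root_.JJ
  have hs : IsR (fun t => f t 1 0 + f t 1 1) := (hf 1 0).add (hf 1 1)
  exact (((IsRM.poly p ((((hf 0 0).add (hf 0 1)).sub (IsR.const 1)).div hs)).mul (IsRM.poly q hs)).mul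
    (IsRM.poly p (((hf 1 1).sub (IsR.const 1)).div hs))).mul (IsRM.const _)

theorem IsR.finite {f : ℝ → ℝ} (hf : IsR f) (h : {t | f t = 0}.Infinite) : {t | f t ≠ 0}.Finite := by
  obtain ⟨b, r, hb, H⟩ := hf
  have h0 : r = 0 := Polynomial.eq_zero_of_infinite_isRoot r (h.mono fun t ht => by
    change r.eval t = 0
    rw [← H, show f t = 0 from ht, mul_zero])
  have : {t | b.IsRoot t}.Finite := by
    by_contra hc
    exact hb (Polynomial.eq_zero_of_infinite_isRoot b hc)
  refine this.subset fun t ht => ?_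
  have := H t
  rw [h0, Polynomial.eval_zero] at this
  exact (mul_eq_zero.mp this).resolve_right ht

theorem IsR.der {f : ℝ → ℝ} (hf : IsR f) (h : {t | f t = 0}.Infinite) {f' : ℝ} (hd : HasDerivAt f f' 0) : f' = 0 := by
  have hfin := hf.finite h
  have h1 : ∀ᶠ t in nhdsWithin (0:ℝ) {0}ᶜ, f t = 0 := by
    have : ∀ᶠ t in nhdsWithin (0:ℝ) {0}ᶜ, t ∉ {t | f t ≠ 0} \ {0} := by
      apply nhdsWithin_le_nhds
      exact (hfin.subset Set.diff_subset).isClosed.isOpen_compl.mem_nhds (by simp)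
    filter_upwards [this, self_mem_nhdsWithin] with t ht ht0
    by_contra hc
    exact ht ⟨hc, ht0⟩
  have h2 : f 0 = 0 := by
    have := hd.continuousAt.tendsto.mono_left (nhdsWithin_le_nhds (s := {0}ᶜ))
    refine tendsto_nhds_unique this (tendsto_const_nhds.congr' ?_)
    filter_upwards [h1] with t ht using ht.symm
  have h3 : ∀ᶠ t in nhds (0:ℝ), f t = 0 := by
    rw [← nhdsNE_sup_pure, Filter.eventually_sup]
    exact ⟨h1, by simpa using h2⟩
  exact hd.unique ((hasDerivAt_const (0:ℝ) (0:ℝ)).congr_of_eventuallyEq h3)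

theorem tangent (h : PQ j p q) {c : ℝ → SL 2 ℝ} {X : Matrix (Fin 2) (Fin 2) ℝ} (hc : IsCurve c X) (hR : IsRM (fun t => (c t).1))
    (Y : Matrix (Fin n) (Fin n) ℝ) (hY : {t | Y * (j (c t)).1 = (j (c t)).1 * Y}.Infinite) : Y * LL p q X = LL p q X * Y := by
  have hs : IsR (fun t => (c t).1 1 0 + (c t).1 1 1) := (hR 1 0).add (hR 1 1)
  have hsf : {t | (c t).1 1 0 + (c t).1 1 1 = 0}.Finite := by
    by_contra hinf
    exact (infinite_of_mem_nhds (0:ℝ) hc.ev) (hs.finite hinf)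
  have hF : IsRM (fun t => Y * JJ p q (c t).1 - JJ p q (c t).1 * Y) :=
    ((IsRM.const Y).mul hR.JJ).sub (hR.JJ.mul (IsRM.const Y))
  have hJ := JJ_der h (f := fun t => (c t).1) (by rw [hc.1]; rfl) hc.2
  have h1 := (MDer.const Y 0).mul hJ
  have h2 := hJ.mul (MDer.const Y 0)
  rw [← sub_eq_zero]
  ext a b
  have hd := (h1 a b).sub (h2 a b)
  have hz := (hF a b).der ((hY.diff hsf).mono ?_) hd
  · simpa using hz
  · rintro t ⟨ht, ht2⟩
    change (Y * JJ p q (c t).1 - JJ p q (c t).1 * Y) a b = 0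
    rw [← h.J _ ht2, show Y * (j (c t)).1 = (j (c t)).1 * Y from ht, sub_self]; rfl

end H3
end PartH3

section PartH4
section H4
variable {n : ℕ} {j : SL 2 ℝ →* SL n ℝ} {p q : Matrix (Fin n) (Fin n) (Polynomial ℝ)}

/-- trace zero matrix -/
def tz (x y z : ℝ) : Matrix (Fin 2) (Fin 2) ℝ := !![x, y; z, -x]

/-- the rational curve `(1+tX)^2 / det (1+tX)` -/
noncomputable def crvM (x y z t : ℝ) : Matrix (Fin 2) (Fin 2) ℝ :=
  !![(1 + t ^ 2 * (x ^ 2 + y * z) + 2 * t * x) / (1 - t ^ 2 * (x ^ 2 + y * z)), (2 * t * y) / (1 - t ^ 2 * (x ^ 2 + y * z));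
    (2 * t * z) / (1 - t ^ 2 * (x ^ 2 + y * z)), (1 + t ^ 2 * (x ^ 2 + y * z) - 2 * t * x) / (1 - t ^ 2 * (x ^ 2 + y * z))]

noncomputable def crv (x y z t : ℝ) : SL 2 ℝ :=
  ⟨if 1 - t ^ 2 * (x ^ 2 + y * z) = 0 then 1 else crvM x y z t, by
    split_ifs with h
    · exact Matrix.det_one
    · rw [Matrix.det_fin_two]
      simp only [crvM, Matrix.of_apply, Matrix.cons_val', Matrix.cons_val_zero, Matrix.cons_val_one, Matrix.cons_val_fin_one]
      field_simp; ring⟩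

theorem crv_pos {x y z t : ℝ} (h : 1 - t ^ 2 * (x ^ 2 + y * z) ≠ 0) : (crv x y z t).1 =
    !![(1 + t ^ 2 * (x ^ 2 + y * z) + 2 * t * x) / (1 - t ^ 2 * (x ^ 2 + y * z)), (2 * t * y) / (1 - t ^ 2 * (x ^ 2 + y * z));
    (2 * t * z) / (1 - t ^ 2 * (x ^ 2 + y * z)), (1 + t ^ 2 * (x ^ 2 + y * z) - 2 * t * x) / (1 - t ^ 2 * (x ^ 2 + y * z))] := by
  change (if _ then _ else _) = _
  rw [if_neg h]; rfl

theorem hder_quot (D u v c : ℝ) : HasDerivAt (fun t : ℝ => (c * (1 + t ^ 2 * D) + 2 * t * u) / (1 - t ^ 2 * D)) (2 * u) 0 := by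
  have h2 : HasDerivAt (fun t : ℝ => t ^ 2 * D) 0 0 := by
    simpa using ((hasDerivAt_id (0:ℝ)).pow 2).mul_const D
  have h1 : HasDerivAt (fun t : ℝ => c * (1 + t ^ 2 * D) + 2 * t * u) (c * 0 + 2 * 1 * u) 0 :=
    ((h2.const_add 1).const_mul c).add ((((hasDerivAt_id (0:ℝ)).const_mul 2)).mul_const u)
  have := h1.div (h2.const_sub 1) (by simp)
  refine this.congr_deriv ?_
  simp

theorem crv_curve (x y z : ℝ) : IsCurve (crv x y z) ((2:ℝ) • tz x y z) := by
  constructor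
  · apply sl2_ext <;> rw [crv_pos (by simp)] <;> simp
  · have hev : ∀ᶠ t : ℝ in nhds 0, 1 - t ^ 2 * (x ^ 2 + y * z) ≠ 0 := by
      have : ContinuousAt (fun t : ℝ => 1 - t ^ 2 * (x ^ 2 + y * z)) 0 := by fun_prop
      exact this.eventually_ne (by simp)
    intro a b
    have key : ∀ f : ℝ → ℝ, ∀ f' c u : ℝ, f' = 2 * u → (∀ t, 1 - t ^ 2 * (x ^ 2 + y * z) ≠ 0 → f t = (c * (1 + t ^ 2 * (x ^ 2 + y * z)) + 2 * t * u) / (1 - t ^ 2 * (x ^ 2 + y * z))) → HasDerivAt f f' 0 := by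
      intro f f' c u hf hft
      rw [hf]
      refine (hder_quot (x ^ 2 + y * z) u 0 c).congr_of_eventuallyEq ?_
      filter_upwards [hev] with t ht using hft t ht
    fin_cases a <;> fin_cases b
    · refine key _ _ 1 x (by simp [tz]) fun t ht => ?_
      beta_reduce; rw [crv_pos ht]; simp
    · refine key _ _ 0 y (by simp [tz]) fun t ht => ?_
      beta_reduce; rw [crv_pos ht]; simp
    · refine key _ _ 0 z (by simp [tz]) fun t ht => ?_
      beta_reduce; rw [crv_pos ht]; simp
    · refine key _ _ 1 (-x) (by simp [tz]) fun t ht => ?_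
      beta_reduce; rw [crv_pos ht]; simp [sub_eq_add_neg]

theorem crv_R (x y z : ℝ) : IsRM (fun t => (crv x y z t).1) := by
  have hb : (1 - Polynomial.X ^ 2 * Polynomial.C (x ^ 2 + y * z) : Polynomial ℝ) ≠ 0 := by
    intro h
    have := congrArg (Polynomial.eval 0) h
    simp at this
  have key : ∀ f : ℝ → ℝ, ∀ c u : ℝ, (∀ t, 1 - t ^ 2 * (x ^ 2 + y * z) ≠ 0 → f t = (c * (1 + t ^ 2 * (x ^ 2 + y * z)) + 2 * t * u) / (1 - t ^ 2 * (x ^ 2 + y * z))) → IsR f := by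
    intro f c u hf
    refine ⟨_, (1 - Polynomial.X ^ 2 * Polynomial.C (x ^ 2 + y * z)) * (Polynomial.C c * (1 + Polynomial.X ^ 2 * Polynomial.C (x ^ 2 + y * z)) + Polynomial.C 2 * Polynomial.X * Polynomial.C u), mul_ne_zero hb hb, fun t => ?_⟩
    simp only [Polynomial.eval_mul, Polynomial.eval_add, Polynomial.eval_sub, Polynomial.eval_one, Polynomial.eval_C, Polynomial.eval_X, Polynomial.eval_pow]
    by_cases ht : 1 - t ^ 2 * (x ^ 2 + y * z) = 0
    · simp only [ht, zero_mul]
    · rw [hf t ht]; field_simp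
  intro a b
  fin_cases a <;> fin_cases b
  · refine key _ 1 x fun t ht => ?_
    beta_reduce; rw [crv_pos ht]; simp
  · refine key _ 0 y fun t ht => ?_
    beta_reduce; rw [crv_pos ht]; simp
  · refine key _ 0 z fun t ht => ?_
    beta_reduce; rw [crv_pos ht]; simp
  · refine key _ 1 (-x) fun t ht => ?_
    beta_reduce; rw [crv_pos ht]; simp [sub_eq_add_neg]

theorem tz_sq (x y z : ℝ) : tz x y z * tz x y z = (x ^ 2 + y * z) • 1 := by
  ext a b; fin_cases a <;> fin_cases b <;> simp [tz, Matrix.mul_apply] <;> ring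

theorem crv_sq (x y z : ℝ) (m : SL 2 ℝ) (r s : ℝ) (hr : r ≠ 0) (hm : m.1 = r • 1 + s • tz x y z) : crv x y z (s / r) = m * m := by
  have hd := sl2_det m
  have e00 : m.1 0 0 = r + s * x := by rw [hm]; simp [tz]
  have e01 : m.1 0 1 = s * y := by rw [hm]; simp [tz]
  have e10 : m.1 1 0 = s * z := by rw [hm]; simp [tz]
  have e11 : m.1 1 1 = r - s * x := by rw [hm]; simp [tz, sub_eq_add_neg]
  rw [e00, e01, e10, e11] at hd
  have hδ : 1 - (s / r) ^ 2 * (x ^ 2 + y * z) = 1 / r ^ 2 := by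
    field_simp; linear_combination hd
  have hδ0 : 1 - (s / r) ^ 2 * (x ^ 2 + y * z) ≠ 0 := by rw [hδ]; positivity
  have hδ2 : (s / r) ^ 2 * (x ^ 2 + y * z) = 1 - 1 / r ^ 2 := by linarith
  apply sl2_ext <;> rw [crv_pos hδ0, hδ, hδ2, sl_val_mul, Matrix.mul_apply, Fin.sum_univ_two] <;> simp [e00, e01, e10, e11] <;> field_simp
  · linear_combination hd
  · ring
  · ring
  · linear_combination hd

theorem sl_pow_lin (a : SL 2 ℝ) (x y z τ : ℝ) (ha : a.1 = τ • 1 + (1:ℝ) • tz x y z) (k : ℕ) : ∃ r s : ℝ, (a ^ k).1 = r • 1 + s • tz x y z := by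
  induction k with
  | zero => exact ⟨1, 0, by rw [pow_zero, sl_val_one]; simp⟩
  | succ k ih =>
    obtain ⟨r, s, h⟩ := ih
    refine ⟨r * τ + s * (x ^ 2 + y * z), r + s * τ, ?_⟩
    rw [pow_succ, sl_val_mul, h, ha, add_mul, mul_add, mul_add]
    simp only [smul_mul_assoc, mul_smul_comm, mul_one, one_mul, tz_sq]
    module

theorem pow_tangent (h : PQ j p q) (a : SL 2 ℝ) (ha : ∀ k : ℕ, 0 < k → a ^ k ≠ 1) (Y : Matrix (Fin n) (Fin n) ℝ)
    (hY : Y * (j a).1 = (j a).1 * Y) (x y z τ : ℝ) (hx : a.1 = τ • 1 + (1:ℝ) • tz x y z) :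
    Y * LL p q (tz x y z) = LL p q (tz x y z) * Y := by
  have hpow : ∀ k : ℕ, Y * (j (a ^ k)).1 = (j (a ^ k)).1 * Y := by
    intro k
    induction k with
    | zero => rw [pow_zero, map_one, sl_val_one, mul_one, one_mul]
    | succ k ih => rw [pow_succ, map_mul, sl_val_mul, ← mul_assoc, ih, mul_assoc, hY, mul_assoc]
  choose r s hrs using sl_pow_lin a x y z τ hx
  have hr : ∀ k, 0 < k → r k ≠ 0 := by
    intro k hk h0
    have hd := sl2_det (a ^ k)
    have hv := hrs k
    rw [h0, zero_smul, zero_add] at hv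
    rw [hv] at hd
    simp [tz] at hd
    apply ha (k * 4) (by omega)
    rw [pow_mul]
    apply Subtype.ext
    have h2 : (a ^ k).1 * (a ^ k).1 = (-1 : ℝ) • 1 := by
      rw [hv, smul_mul_assoc, mul_smul_comm, tz_sq, smul_smul, smul_smul]
      congr 1; linarith
    rw [show (4:ℕ) = 2 + 2 from rfl, pow_add, pow_two, sl_val_mul, sl_val_mul, h2]
    simp [sl_val_one]
  have hinj : Function.Injective (fun k : ℕ => s (k + 1) / r (k + 1)) := by
    intro k l hkl
    have hkl' : s (k + 1) / r (k + 1) = s (l + 1) / r (l + 1) := hkl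
    have h1 := crv_sq x y z _ _ _ (hr (k + 1) (by omega)) (hrs (k + 1))
    have h2 := crv_sq x y z _ _ _ (hr (l + 1) (by omega)) (hrs (l + 1))
    rw [hkl', h2, ← pow_add, ← pow_add] at h1
    have inj : Function.Injective (fun k : ℕ => a ^ k) := by
      rw [injective_pow_iff_not_isOfFinOrder, isOfFinOrder_iff_pow_eq_one]
      rintro ⟨k, hk, h⟩
      exact ha k hk h
    have := inj h1
    omega
  have := tangent h (crv_curve x y z) (crv_R x y z) Y (Set.infinite_of_injective_forall_mem hinj fun k => by
    change Y * (j (crv x y z _)).1 = _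
    rw [crv_sq x y z _ _ _ (hr (k + 1) (by omega)) (hrs (k + 1)), ← pow_add]
    exact hpow _)
  rw [LL_smul, mul_smul_comm, smul_mul_assoc] at this
  exact smul_right_injective _ (two_ne_zero' ℝ) this

theorem Lbr' (h : PQ j p q) (x y z x' y' z' : ℝ) :
    LL p q (tz x y z * tz x' y' z' - tz x' y' z' * tz x y z) = LL p q (tz x y z) * LL p q (tz x' y' z') - LL p q (tz x' y' z') * LL p q (tz x y z) := by
  have := Lbr h (crv_curve x y z) (crv_curve x' y' z')
  simp only [LL_smul, smul_mul_assoc, mul_smul_comm, ← smul_sub] at this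
  exact smul_right_injective _ (two_ne_zero' ℝ) (smul_right_injective _ (two_ne_zero' ℝ) this)
end H4
end PartH4

section PartH5
section H5
variable {n : ℕ} {j : SL 2 ℝ →* SL n ℝ} {p q : Matrix (Fin n) (Fin n) (Polynomial ℝ)}

theorem comm_comm {R : Type} [Ring R] (a b a' b' C : R) (ha : a * a' = 1) (ha' : a' * a = 1) (hb : b * b' = 1)
    (hC : a * b = b * a + C) (h1 : C * a' = a * C) (h2 : C * b' = b * C) (h0 : C * C = 0) :
    (a * b * a' * b') * (a' * b * a * b') = (a' * b * a * b') * (a * b * a' * b') := by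
  have u1 : a * b * a' * b' = 1 + C * a' * b' := by
    rw [hC, add_mul, add_mul, mul_assoc b a a', ha, mul_one, hb]
  have u2 : a' * b * a * b' = 1 - a' * C * b' := by
    have : b * a = a * b - C := by rw [hC]; abel
    rw [mul_assoc a' b a, this, mul_sub, sub_mul, ← mul_assoc a' a b, ha', one_mul, hb]
  have z1 : (C * a' * b') * (a' * C * b') = 0 := by
    have : (C * a' * b') * (a' * C * b') = a * b * a * (C * C) * b' := by
      calc (C * a' * b') * (a' * C * b') = (C * a') * b' * a' * C * b' := by noncomm_ring
        _ = a * (C * b') * a' * C * b' := by rw [h1]; noncomm_ring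
        _ = a * b * (C * a') * C * b' := by rw [h2]; noncomm_ring
        _ = _ := by rw [h1]; noncomm_ring
    rw [this, h0]; simp
  have z2 : (a' * C * b') * (C * a' * b') = 0 := by
    have : (a' * C * b') * (C * a' * b') = a' * b * (C * C) * a' * b' := by
      calc (a' * C * b') * (C * a' * b') = a' * (C * b') * C * a' * b' := by noncomm_ring
        _ = _ := by rw [h2]; noncomm_ring
    rw [this, h0]; simp
  rw [u1, u2, add_mul, mul_sub, mul_sub, sub_mul, mul_add, mul_add, z1, z2]
  simp only [one_mul, mul_one]
  abel

theorem sl2_tz (a : SL 2 ℝ) : ∃ τ x y z : ℝ, a.1 = τ • 1 + (1:ℝ) • tz x y z := by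
  refine ⟨(a.1 0 0 + a.1 1 1) / 2, (a.1 0 0 - a.1 1 1) / 2, a.1 0 1, a.1 1 0, ?_⟩
  ext i k; fin_cases i <;> fin_cases k <;> simp [tz] <;> ring

theorem comm_adj (a : SL 2 ℝ) (b : Matrix (Fin 2) (Fin 2) ℝ) : (a.1 * b - b * a.1) * (a⁻¹).1 = a.1 * (a.1 * b - b * a.1) := by
  rw [sl2_inv]
  ext i k; fin_cases i <;> fin_cases k <;> simp [Matrix.mul_apply] <;> ring

theorem br_tz (x y z x' y' z' : ℝ) : tz x y z * tz x' y' z' - tz x' y' z' * tz x y z =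
    tz (y * z' - z * y') (2 * (x * y' - y * x')) (2 * (z * x' - x * z')) := by
  ext i k; fin_cases i <;> fin_cases k <;> simp [tz, Matrix.mul_apply] <;> ring

theorem gen_comm (h : PQ j p q) (a b : SL 2 ℝ) (ha : ∀ k : ℕ, 0 < k → a ^ k ≠ 1) (hb : ∀ k : ℕ, 0 < k → b ^ k ≠ 1)
    (hab : ⁅a, b⁆ * ⁅a⁻¹, b⁆ ≠ ⁅a⁻¹, b⁆ * ⁅a, b⁆) (Y : Matrix (Fin n) (Fin n) ℝ)
    (hYa : Y * (j a).1 = (j a).1 * Y) (hYb : Y * (j b).1 = (j b).1 * Y) (w1 w2 w3 : ℝ) :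
    Y * LL p q (tz w1 w2 w3) = LL p q (tz w1 w2 w3) * Y := by
  obtain ⟨τ, x, y, z, hA⟩ := sl2_tz a
  obtain ⟨σ, x', y', z', hB⟩ := sl2_tz b
  have c1 := pow_tangent h a ha Y hYa x y z τ hA
  have c2 := pow_tangent h b hb Y hYb x' y' z' σ hB
  have c3 : Y * LL p q (tz (y * z' - z * y') (2 * (x * y' - y * x')) (2 * (z * x' - x * z'))) = LL p q (tz (y * z' - z * y') (2 * (x * y' - y * x')) (2 * (z * x' - x * z'))) * Y := by
    rw [← br_tz, Lbr' h, mul_sub, sub_mul, ← mul_assoc, ← mul_assoc, c1, c2, mul_assoc, mul_assoc, c1, c2, mul_assoc, mul_assoc]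
  by_cases hΔ : (y * z' - z * y') ^ 2 + (2 * (x * y' - y * x')) * (2 * (z * x' - x * z')) = 0
  · exfalso
    apply hab
    have hC : a.1 * b.1 - b.1 * a.1 = tz (y * z' - z * y') (2 * (x * y' - y * x')) (2 * (z * x' - x * z')) := by
      rw [← br_tz, hA, hB]
      simp only [add_mul, mul_add, smul_mul_assoc, mul_smul_comm, mul_one, one_mul]
      module
    apply Subtype.ext
    rw [commutatorElement_def, commutatorElement_def, inv_inv]
    simp only [sl_val_mul]
    refine comm_comm a.1 b.1 (a⁻¹).1 (b⁻¹).1 (a.1 * b.1 - b.1 * a.1) ?_ ?_ ?_ (by abel) (comm_adj a b.1) ?_ ?_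
    · rw [← sl_val_mul, mul_inv_cancel, sl_val_one]
    · rw [← sl_val_mul, inv_mul_cancel, sl_val_one]
    · rw [← sl_val_mul, mul_inv_cancel, sl_val_one]
    · have := comm_adj b a.1
      rw [← neg_sub (a.1 * b.1), neg_mul, mul_neg, neg_inj] at this
      exact this
    · rw [hC, tz_sq, hΔ, zero_smul]
  · set Δ := (y * z' - z * y') ^ 2 + (2 * (x * y' - y * x')) * (2 * (z * x' - x * z')) with hΔd
    have key : ∃ α β γ : ℝ, Δ • tz w1 w2 w3 = α • tz x y z + β • tz x' y' z' + γ • tz (y * z' - z * y') (2 * (x * y' - y * x')) (2 * (z * x' - x * z')) := by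
      refine ⟨w1 * (y' * (2 * (z * x' - x * z')) - z' * (2 * (x * y' - y * x'))) - w2 * (x' * (2 * (z * x' - x * z')) - z' * (y * z' - z * y')) + w3 * (x' * (2 * (x * y' - y * x')) - y' * (y * z' - z * y')),
        -(w1 * (y * (2 * (z * x' - x * z')) - z * (2 * (x * y' - y * x'))) - w2 * (x * (2 * (z * x' - x * z')) - z * (y * z' - z * y')) + w3 * (x * (2 * (x * y' - y * x')) - y * (y * z' - z * y'))),
        w1 * (y * z' - z * y') + w2 * (z * x' - x * z') + w3 * (x * y' - y * x'), ?_⟩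
      rw [hΔd]
      ext i k; fin_cases i <;> fin_cases k <;> simp [tz] <;> ring
    obtain ⟨α, β, γ, hk⟩ := key
    have h2 := congrArg (LL p q) hk
    rw [LL_smul, LL_add, LL_add, LL_smul, LL_smul, LL_smul] at h2
    have h3 : Y * (Δ • LL p q (tz w1 w2 w3)) = (Δ • LL p q (tz w1 w2 w3)) * Y := by
      rw [h2]
      simp only [mul_add, add_mul, smul_mul_assoc, mul_smul_comm, c1, c2, c3]
    rw [mul_smul_comm, smul_mul_assoc] at h3
    exact smul_right_injective _ hΔ h3
end H5
end PartH5

section PartH6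
section H6
section abs
variable {V : Type} [AddCommGroup V] [Module ℝ V] (E F H : Module.End ℝ V)

theorem EF_pow (hEF : E * F = F * E + H) (hHF : H * F = F * H - (2:ℝ) • F) (k : ℕ) :
    E * F ^ (k + 1) = F ^ (k + 1) * E + ((k:ℝ) + 1) • (F ^ k * (H - (k:ℝ) • 1)) := by
  induction k with
  | zero => simp [hEF]
  | succ k ih =>
    rw [pow_succ F (k + 1), ← mul_assoc, ih, add_mul, mul_assoc (F ^ (k+1)) E F, hEF, smul_mul_assoc, mul_assoc (F ^ k), sub_mul, hHF]
    push_cast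
    simp only [mul_add, mul_sub, pow_succ, mul_assoc, smul_mul_assoc, mul_smul_comm, one_mul, mul_one]
    module

theorem HF_pow (hHF : H * F = F * H - (2:ℝ) • F) (k : ℕ) : H * F ^ k = F ^ k * (H - (2 * (k:ℝ)) • 1) := by
  induction k with
  | zero => simp
  | succ k ih =>
    rw [pow_succ, ← mul_assoc, ih, mul_assoc, sub_mul, hHF]
    push_cast
    simp only [mul_add, mul_sub, pow_succ, mul_assoc, smul_mul_assoc, mul_smul_comm, one_mul, mul_one]
    module

theorem prim_exists (hEF : E * F = F * E + H) (hHE : H * E = E * H + (2:ℝ) • E) (hHF : H * F = F * H - (2:ℝ) • F) (k : ℕ) :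
    ∀ w : V, w ≠ 0 → E w = 0 → (E ^ k) ((F ^ k) w) = 0 → ∃ m : V, ∃ μ : ℝ, m ≠ 0 ∧ E m = 0 ∧ H m = μ • m := by
  induction k with
  | zero => intro w h0 _ h; exact absurd (by simpa using h) h0
  | succ k ih =>
    intro w h0 hE h
    have e1 : E ((F ^ (k + 1)) w) = ((k:ℝ) + 1) • (F ^ k) (H w - (k:ℝ) • w) := by
      have := congrArg (fun T : Module.End ℝ V => T w) (EF_pow E F H hEF hHF k)
      simpa [hE, Module.End.mul_apply] using this
    by_cases hw : H w - (k:ℝ) • w = 0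
    · exact ⟨w, k, h0, hE, sub_eq_zero.mp hw⟩
    · refine ih _ hw ?_ ?_
      · have := congrArg (fun T : Module.End ℝ V => T w) hHE
        simp only [Module.End.mul_apply, LinearMap.add_apply, LinearMap.smul_apply, hE, map_zero, smul_zero, add_zero] at this
        rw [map_sub, map_smul, hE, ← this]; simp
      · rw [pow_succ, Module.End.mul_apply, e1, map_smul] at h
        exact (smul_eq_zero.mp h).resolve_left (by positivity)

theorem schur_abs [Nontrivial V] (Y : Module.End ℝ V) (hEF : E * F = F * E + H) (hHE : H * E = E * H + (2:ℝ) • E) (hHF : H * F = F * H - (2:ℝ) • F)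
    (N : ℕ) (hE : E ^ N = 0) (hF : F ^ N = 0)
    (hirr : ∀ W : Submodule ℝ V, (∀ v ∈ W, E v ∈ W) → (∀ v ∈ W, F v ∈ W) → W = ⊥ ∨ W = ⊤)
    (hYE : Y * E = E * Y) (hYF : Y * F = F * Y) : ∃ c : ℝ, Y = c • 1 := by
  have hYH : Y * H = H * Y := by
    have : H = E * F - F * E := by rw [hEF]; abel
    rw [this, mul_sub, sub_mul, ← mul_assoc, ← mul_assoc, hYE, hYF, mul_assoc, mul_assoc, hYE, hYF, mul_assoc, mul_assoc]
  have hker : ∃ w : V, w ≠ 0 ∧ E w = 0 := by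
    by_contra hc
    push Not at hc
    obtain ⟨v, hv⟩ := exists_ne (0:V)
    have : ∀ k : ℕ, (E ^ k) v ≠ 0 := by
      intro k
      induction k with
      | zero => simpa using hv
      | succ k ih => rw [pow_succ', Module.End.mul_apply]; exact hc _ ih
    exact this N (by rw [hE]; rfl)
  obtain ⟨w, hw0, hw⟩ := hker
  obtain ⟨m, μ, hm0, hm, hHm⟩ := prim_exists E F H hEF hHE hHF N w hw0 hw (by rw [hF]; simp)
  have hEk : ∀ k : ℕ, E ((F ^ (k + 1)) m) = (((k:ℝ) + 1) * (μ - k)) • (F ^ k) m := by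
    intro k
    have := congrArg (fun T : Module.End ℝ V => T m) (EF_pow E F H hEF hHF k)
    simp only [Module.End.mul_apply, LinearMap.add_apply, LinearMap.smul_apply, LinearMap.sub_apply, Module.End.one_apply, hm, hHm, map_zero, zero_add, ← sub_smul, map_smul, smul_smul] at this
    exact this
  have hHk : ∀ k : ℕ, H ((F ^ k) m) = (μ - 2 * k) • (F ^ k) m := by
    intro k
    have := congrArg (fun T : Module.End ℝ V => T m) (HF_pow F H hHF k)
    simp only [Module.End.mul_apply, LinearMap.smul_apply, LinearMap.sub_apply, Module.End.one_apply, hHm, ← sub_smul, map_smul] at this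
    exact this
  have hS : Submodule.span ℝ (Set.range fun k : ℕ => (F ^ k) m) = ⊤ := by
    refine (hirr _ ?_ ?_).resolve_left ?_
    · intro v hv
      induction hv using Submodule.span_induction with
      | mem x hx =>
        obtain ⟨k, rfl⟩ := hx
        cases k with
        | zero => simp [hm]
        | succ k => 
          change E ((F ^ (k + 1)) m) ∈ _
          rw [hEk]; exact Submodule.smul_mem _ _ (Submodule.subset_span ⟨k, rfl⟩)
      | zero => simp
      | add x y _ _ hx hy => rw [map_add]; exact Submodule.add_mem _ hx hy
      | smul a x _ hx => rw [map_smul]; exact Submodule.smul_mem _ _ hx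
    · intro v hv
      induction hv using Submodule.span_induction with
      | mem x hx =>
        obtain ⟨k, rfl⟩ := hx
        exact Submodule.subset_span ⟨k + 1, by simp [pow_succ', Module.End.mul_apply]⟩
      | zero => simp
      | add x y _ _ hx hy => rw [map_add]; exact Submodule.add_mem _ hx hy
      | smul a x _ hx => rw [map_smul]; exact Submodule.smul_mem _ _ hx
    · intro hb
      have : m ∈ Submodule.span ℝ (Set.range fun k : ℕ => (F ^ k) m) := Submodule.subset_span ⟨0, by simp⟩
      rw [hb] at this
      exact hm0 ((Submodule.mem_bot ℝ).1 this)
  have hle : Submodule.span ℝ (Set.range fun k : ℕ => (F ^ k) m) ≤ Submodule.span ℝ {m} ⊔ ⨆ ν, ⨆ (_ : ν ≠ μ), Module.End.eigenspace H ν := by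
    rw [Submodule.span_le]
    rintro _ ⟨k, rfl⟩
    cases k with
    | zero => exact Submodule.mem_sup_left (by simpa using Submodule.mem_span_singleton_self m)
    | succ k =>
      refine Submodule.mem_sup_right ?_
      have hne : μ - 2 * ((k + 1 : ℕ) : ℝ) ≠ μ := by
        have : (0:ℝ) < ((k + 1 : ℕ) : ℝ) := by positivity
        linarith
      exact Submodule.mem_iSup_of_mem _ (Submodule.mem_iSup_of_mem hne (Module.End.mem_eigenspace_iff.2 (hHk _)))
  have hYm : Y m ∈ Submodule.span ℝ {m} ⊔ ⨆ ν, ⨆ (_ : ν ≠ μ), Module.End.eigenspace H ν := by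
    apply hle; rw [hS]; trivial
  obtain ⟨x, hx, u, hu, hxu⟩ := Submodule.mem_sup.1 hYm
  obtain ⟨c, rfl⟩ := Submodule.mem_span_singleton.1 hx
  have hHY : H (Y m) = μ • Y m := by
    have := congrArg (fun T : Module.End ℝ V => T m) hYH
    simp only [Module.End.mul_apply, hHm, map_smul] at this
    exact this.symm
  have hu' : u ∈ Module.End.eigenspace H μ := by
    have : u = Y m - c • m := by rw [← hxu]; abel
    rw [Module.End.mem_eigenspace_iff, this, map_sub, map_smul, hHY, hHm]
    module
  have hu0 : u = 0 := by
    have := (Module.End.eigenspaces_iSupIndep H) μ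
    exact (Submodule.disjoint_def.1 this) u hu' hu
  rw [hu0, add_zero] at hxu
  refine ⟨c, ?_⟩
  have := (hirr (LinearMap.ker (Y - c • 1)) ?_ ?_).resolve_left ?_
  · rw [LinearMap.ker_eq_top] at this
    exact sub_eq_zero.mp this
  · intro v hv
    rw [LinearMap.mem_ker] at hv ⊢
    have h2 : (Y - c • 1) * E = E * (Y - c • 1) := by
      rw [sub_mul, mul_sub, hYE]; simp
    rw [← Module.End.mul_apply, h2, Module.End.mul_apply, hv, map_zero]
  · intro v hv
    rw [LinearMap.mem_ker] at hv ⊢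
    have h2 : (Y - c • 1) * F = F * (Y - c • 1) := by
      rw [sub_mul, mul_sub, hYF]; simp
    rw [← Module.End.mul_apply, h2, Module.End.mul_apply, hv, map_zero]
  · intro hb
    have : m ∈ LinearMap.ker (Y - c • 1) := by
      rw [LinearMap.mem_ker]; simp [← hxu]
    rw [hb] at this
    exact hm0 ((Submodule.mem_bot ℝ).1 this)
end abs
end H6
end PartH6

section PartH7
section H7
variable {n : ℕ} {j : SL 2 ℝ →* SL n ℝ} {p q : Matrix (Fin n) (Fin n) (Polynomial ℝ)}

theorem exp_form (p : Matrix (Fin n) (Fin n) (Polynomial ℝ)) (h0 : p.map (Polynomial.eval 0) = 1)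
    (hd : ∀ t, dM p t = dM p 0 * p.map (Polynomial.eval t)) :
    ∃ N, ∀ M, N ≤ M → (dM p 0) ^ M = 0 ∧ ∀ t : ℝ, p.map (Polynomial.eval t) = ∑ k ∈ Finset.range M, (t ^ k / (k.factorial : ℝ)) • (dM p 0) ^ k := by
  have hc : ∀ k : ℕ, (dM p 0) ^ k = (k.factorial : ℝ) • Matrix.of fun a b => (p a b).coeff k := by
    intro k
    induction k with
    | zero =>
      rw [pow_zero, ← h0]
      ext a b
      simp [Polynomial.coeff_zero_eq_eval_zero]
    | succ k ih =>
      have hpoly : ∀ a b, (p a b).derivative = ∑ c, Polynomial.C (dM p 0 a c) * p c b := by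
        intro a b
        refine Polynomial.funext fun t => ?_
        have := congrFun (congrFun (hd t) a) b
        rw [Matrix.mul_apply] at this
        rw [Polynomial.eval_finsetSum]
        simp only [Polynomial.eval_mul, Polynomial.eval_C]
        exact this
      rw [pow_succ', ih, Matrix.mul_smul]
      ext a b
      have := congrArg (fun r => Polynomial.coeff r k) (hpoly a b)
      simp only [Polynomial.coeff_derivative, Polynomial.finset_sum_coeff, Polynomial.coeff_C_mul] at this
      simp only [Matrix.smul_apply, Matrix.mul_apply, Matrix.of_apply, ← this, smul_eq_mul, Nat.factorial_succ]
      push_cast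
      ring
  refine ⟨(∑ a, ∑ b, (p a b).natDegree) + 1, fun M hM => ?_⟩
  have hdeg : ∀ a b, (p a b).natDegree < M := by
    intro a b
    have h1 : (p a b).natDegree ≤ ∑ b, (p a b).natDegree := Finset.single_le_sum (f := fun b => (p a b).natDegree) (fun _ _ => Nat.zero_le _) (Finset.mem_univ b)
    have h2 : ∑ b, (p a b).natDegree ≤ ∑ a, ∑ b, (p a b).natDegree := Finset.single_le_sum (f := fun a => ∑ b, (p a b).natDegree) (fun _ _ => Nat.zero_le _) (Finset.mem_univ a)
    omega
  constructor
  · rw [hc]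
    ext a b
    simp [Polynomial.coeff_eq_zero_of_natDegree_lt (hdeg a b)]
  · intro t
    ext a b
    rw [Matrix.map_apply, Polynomial.eval_eq_sum_range' (hdeg a b), Matrix.sum_apply]
    refine Finset.sum_congr rfl fun k _ => ?_
    rw [hc]
    have : (k.factorial : ℝ) ≠ 0 := by positivity
    simp only [Matrix.smul_apply, Matrix.of_apply, smul_eq_mul]
    field_simp

theorem PQ.q0 (h : PQ j p q) : q.map (Polynomial.eval 0) = 1 := by rw [← h.hq, lws_zero, map_one]; rfl

theorem exp_inv {p : Matrix (Fin n) (Fin n) (Polynomial ℝ)} {M : ℕ} (t : ℝ) (h : p.map (Polynomial.eval t) = ∑ k ∈ Finset.range M, (t ^ k / (k.factorial : ℝ)) • (dM p 0) ^ k)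
    (W : Submodule ℝ (Fin n → ℝ)) (hW : ∀ v ∈ W, (dM p 0).mulVec v ∈ W) : ∀ v ∈ W, (p.map (Polynomial.eval t)).mulVec v ∈ W := by
  intro v hv
  rw [h, Matrix.sum_mulVec]
  refine Submodule.sum_mem _ fun k hk => ?_
  clear hk
  rw [Matrix.smul_mulVec]
  refine Submodule.smul_mem _ _ ?_
  induction k with
  | zero => simpa using hv
  | succ k ih => rw [pow_succ', ← Matrix.mulVec_mulVec]; exact hW _ ih

theorem j_inv (W : Submodule ℝ (Fin n → ℝ)) (hu : ∀ t, ∀ v ∈ W, (j (ups t)).1.mulVec v ∈ W) (hl : ∀ t, ∀ v ∈ W, (j (lws t)).1.mulVec v ∈ W)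
    (A : SL 2 ℝ) : ∀ v ∈ W, (j A).1.mulVec v ∈ W := by
  have h1 : ∀ A : SL 2 ℝ, A.1 1 0 + A.1 1 1 ≠ 0 → ∀ v ∈ W, (j A).1.mulVec v ∈ W := by
    intro A hA v hv
    rw [sl2_decomp A hA, map_mul, map_mul, map_mul, sl_val_mul, sl_val_mul, sl_val_mul, ← Matrix.mulVec_mulVec, ← Matrix.mulVec_mulVec, ← Matrix.mulVec_mulVec]
    exact hu _ _ (hl _ _ (hu _ _ (hl _ _ hv)))
  by_cases hA : A.1 1 0 + A.1 1 1 = 0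
  · intro v hv
    have hd := sl2_det A
    have h2 : (A * ups 1).1 1 0 + (A * ups 1).1 1 1 ≠ 0 := by
      rw [sl_val_mul]
      simp only [Matrix.mul_apply, Fin.sum_univ_two, ups]
      simp
      intro h
      have h10 : A.1 1 0 = 0 := by linarith
      have h11 : A.1 1 1 = 0 := by linarith
      rw [h10, h11] at hd
      simp at hd
    have e : A = (A * ups 1) * ups (-1) := by
      rw [mul_assoc, ← ups_add, add_neg_cancel, ups_zero, mul_one]
    rw [e, map_mul, sl_val_mul, ← Matrix.mulVec_mulVec]
    exact h1 _ h2 _ (hu _ _ hv)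
  · exact h1 A hA

theorem schur_final (hn : 2 ≤ n) (hj : IsIrreducibleEmbedding n j) (a b : SL 2 ℝ) (ha : ∀ k : ℕ, 0 < k → a ^ k ≠ 1) (hb : ∀ k : ℕ, 0 < k → b ^ k ≠ 1)
    (hab : ⁅a, b⁆ * ⁅a⁻¹, b⁆ ≠ ⁅a⁻¹, b⁆ * ⁅a, b⁆) (Y : Matrix (Fin n) (Fin n) ℝ)
    (hYa : Y * (j a).1 = (j a).1 * Y) (hYb : Y * (j b).1 = (j b).1 * Y) : ∃ c : ℝ, Y = c • 1 := by
  obtain ⟨p, q, h⟩ := exists_PQ j hj.1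
  have hG := gen_comm h a b ha hb hab Y hYa hYb
  have eE : LL p q (tz 0 1 0) = dM p 0 := by simp [LL, tz]
  have eF : LL p q (tz 0 0 1) = dM q 0 := by simp [LL, tz]
  have b1 := Lbr' h 0 1 0 0 0 1
  have b2 := Lbr' h 1 0 0 0 1 0
  have b3 := Lbr' h 1 0 0 0 0 1
  rw [br_tz] at b1 b2 b3
  rw [show tz (1 * 1 - 0 * 0) (2 * (0 * 0 - 1 * 0)) (2 * (0 * 0 - 0 * 1)) = tz 1 0 0 by norm_num] at b1
  rw [show tz (0 * 0 - 0 * 1) (2 * (1 * 1 - 0 * 0)) (2 * (0 * 0 - 1 * 0)) = (2:ℝ) • tz 0 1 0 by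
    ext i k; fin_cases i <;> fin_cases k <;> simp [tz], LL_smul] at b2
  rw [show tz (0 * 1 - 0 * 0) (2 * (1 * 0 - 0 * 0)) (2 * (0 * 0 - 1 * 1)) = (-2:ℝ) • tz 0 0 1 by
    ext i k; fin_cases i <;> fin_cases k <;> simp [tz], LL_smul] at b3
  have hYE := hG 0 1 0
  have hYF := hG 0 0 1
  rw [eE] at b1 b2 hYE
  rw [eF] at b1 b3 hYF
  obtain ⟨N1, h1⟩ := exp_form p h.p0 h.dp
  obtain ⟨N2, h2⟩ := exp_form q h.q0 h.dq
  have h1 := h1 (max N1 N2) (le_max_left _ _)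
  have h2 := h2 (max N1 N2) (le_max_right _ _)
  haveI : Nonempty (Fin n) := ⟨⟨0, by omega⟩⟩
  let φ := Matrix.toLinAlgEquiv' (R := ℝ) (n := Fin n)
  have := schur_abs (φ (dM p 0)) (φ (dM q 0)) (φ (LL p q (tz 1 0 0))) (φ Y) ?_ ?_ ?_ (max N1 N2) ?_ ?_ ?_ ?_ ?_
  · obtain ⟨c, hc⟩ := this
    refine ⟨c, φ.injective ?_⟩
    rw [hc, map_smul, map_one]
  · rw [← map_mul, ← map_mul, ← map_add]; congr 1; rw [b1]; abel
  · rw [← map_mul, ← map_mul, ← map_smul, ← map_add]; congr 1; rw [b2]; abel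
  · rw [← map_mul, ← map_mul, ← map_smul, ← map_sub]; congr 1
    have : (2:ℝ) • dM q 0 = -((-2:ℝ) • dM q 0) := by module
    rw [this, b3]; abel
  · rw [← map_pow, h1.1, map_zero]
  · rw [← map_pow, h2.1, map_zero]
  · intro W hWE hWF
    have hWE' : ∀ v ∈ W, (dM p 0).mulVec v ∈ W := hWE
    have hWF' : ∀ v ∈ W, (dM q 0).mulVec v ∈ W := hWF
    apply hj.2 W
    apply j_inv
    · intro t; rw [h.hp]; exact exp_inv t (h1.2 t) W hWE'
    · intro t; rw [h.hq]; exact exp_inv t (h2.2 t) W hWF'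
  · rw [← map_mul, ← map_mul, hYE]
  · rw [← map_mul, ← map_mul, hYF]
end H7
end PartH7

section PartH8
section H8
variable {g n : ℕ}

theorem list_zpow {G : Type} [Group G] (c : G) (e : Fin g → ℤ) : (List.ofFn fun k => c ^ e k).prod = c ^ (∑ k, e k) := by
  have h := map_list_prod (zpowersHom G c) (List.ofFn fun k => Multiplicative.ofAdd (e k))
  rw [List.map_ofFn, List.prod_ofFn, ← ofAdd_sum] at h
  simp only [zpowersHom_apply, toAdd_ofAdd] at h
  rw [h]
  rfl

theorem relator_lift {G : Type} [Group G] (f : Fin g × Bool → G) :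
    FreeGroup.lift f (surfaceRelator g) = (List.ofFn fun i : Fin g => ⁅f (i, false), f (i, true)⁆).prod := by
  rw [surfaceRelator, map_list_prod, List.map_ofFn]
  congr 2
  funext i
  simp [map_commutatorElement]

/-- the map to the free group -/
def toF (i l : Fin g) (x : Fin g × Bool) : FreeGroup Bool :=
  if x.1 = i then FreeGroup.of x.2 else if x.1 = l then FreeGroup.of (!x.2) else 1

theorem toF_rel (i l : Fin g) (hil : l ≠ i) : FreeGroup.lift (toF i l) (surfaceRelator g) = 1 := by
  rw [relator_lift]
  have : (fun k : Fin g => ⁅toF i l (k, false), toF i l (k, true)⁆) =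
      fun k => ⁅FreeGroup.of false, FreeGroup.of true⁆ ^ ((if k = i then (1:ℤ) else 0) - if k = l then (1:ℤ) else 0) := by
    funext k
    by_cases h1 : k = i
    · subst h1; simp [toF, hil.symm]
    · by_cases h2 : k = l
      · subst h2; simp [toF, h1]
      · simp [toF, h1, h2]
  rw [this, list_zpow]
  simp

theorem free_facts (i l : Fin g) (hil : l ≠ i) :
    (∀ k : ℕ, 0 < k → (PresentedGroup.of (i, false) : SurfaceGroup g) ^ k ≠ 1) ∧
    (∀ k : ℕ, 0 < k → (PresentedGroup.of (i, true) : SurfaceGroup g) ^ k ≠ 1) ∧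
    ⁅(PresentedGroup.of (i, false) : SurfaceGroup g), (PresentedGroup.of (i, true) : SurfaceGroup g)⁆ * ⁅(PresentedGroup.of (i, false) : SurfaceGroup g)⁻¹, (PresentedGroup.of (i, true) : SurfaceGroup g)⁆ ≠
      ⁅(PresentedGroup.of (i, false) : SurfaceGroup g)⁻¹, (PresentedGroup.of (i, true) : SurfaceGroup g)⁆ * ⁅(PresentedGroup.of (i, false) : SurfaceGroup g), (PresentedGroup.of (i, true) : SurfaceGroup g)⁆ := by
  let Φ : SurfaceGroup g →* FreeGroup Bool := PresentedGroup.toGroup (f := toF i l) (by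
    intro r hr; rw [Set.mem_singleton_iff.1 hr]; exact toF_rel i l hil)
  have hΦ : ∀ s, Φ (PresentedGroup.of (i, s)) = FreeGroup.of s := by
    intro s
    have : Φ (PresentedGroup.of (i, s)) = toF i l (i, s) := PresentedGroup.toGroup.of _
    rw [this]; simp [toF]
  have tf : ∀ s : Bool, ∀ k : ℕ, 0 < k → (PresentedGroup.of (i, s) : SurfaceGroup g) ^ k ≠ 1 := by
    intro s k hk h
    have h2 := congrArg (fun x => FreeGroup.lift (fun _ : Bool => Multiplicative.ofAdd (1:ℤ)) (Φ x)) h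
    simp only [map_pow, hΦ, FreeGroup.lift_apply_of, map_one] at h2
    rw [← ofAdd_nsmul, ← ofAdd_zero] at h2
    have := Multiplicative.ofAdd.injective h2
    simp at this
    omega
  refine ⟨tf false, tf true, fun h => ?_⟩
  have h2 := congrArg Φ h
  simp only [map_mul, map_commutatorElement, map_inv, hΦ] at h2
  revert h2
  decide

theorem T_rep (ρ : SurfaceGroup g →* SL n ℝ) : repTuple ρ ∈ RepVariety g n ℝ := by
  rw [rep_iff]
  refine ⟨fun x => ρ (PresentedGroup.of x), fun x => rfl, ?_⟩
  refine (relator_lift fun x => ρ (PresentedGroup.of x)).symm.trans ?_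
  have : FreeGroup.lift (fun x => ρ (PresentedGroup.of x)) = ρ.comp (PresentedGroup.mk {surfaceRelator g}) := by
    ext x; simp [PresentedGroup.of]
  rw [this, MonoidHom.comp_apply]
  have h1 : PresentedGroup.mk {surfaceRelator g} (surfaceRelator g) = 1 := PresentedGroup.one_of_mem rfl
  rw [h1, map_one]

theorem T_triv (hn : 2 ≤ n) (T : (Fin g × Bool) → Matrix (Fin n) (Fin n) ℝ) (hT : IsTeichmuller g n T) (i l : Fin g) (hil : l ≠ i) (Y : Matrix (Fin n) (Fin n) ℝ)
    (h1 : Y * T (i, false) = T (i, false) * Y) (h2 : Y * T (i, true) = T (i, true) * Y) : ∃ c : ℝ, Y = c • 1 := by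
  obtain ⟨ρ, j, hρ, hj, rfl⟩ := hT
  obtain ⟨f1, f2, f3⟩ := free_facts i l hil
  refine schur_final hn hj (ρ (PresentedGroup.of (i, false))) (ρ (PresentedGroup.of (i, true))) ?_ ?_ ?_ Y h1 h2
  · intro k hk h
    rw [← map_pow, ← map_one ρ] at h
    exact f1 k hk (hρ.1 h)
  · intro k hk h
    rw [← map_pow, ← map_one ρ] at h
    exact f2 k hk (hρ.1 h)
  · intro h
    simp only [← map_inv, ← map_commutatorElement, ← map_mul] at h
    exact f3 (hρ.1 h)

theorem exists_other (hg : 2 ≤ g) (k : Fin g) : ∃ i : Fin g, k ≠ i := by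
  haveI : Nontrivial (Fin g) := Fin.nontrivial_iff_two_le.2 hg
  obtain ⟨i, hi⟩ := exists_ne k
  exact ⟨i, hi.symm⟩

theorem final_main (hg : 2 ≤ g) (hn : 2 ≤ n) (T : (Fin g × Bool) → Matrix (Fin n) (Fin n) ℝ) (hT : IsTeichmuller g n T)
    (P : MvPolynomial ((Fin g × Bool) × Fin n × Fin n) ℂ)
    (hP : ∀ B ∈ HIT g n T, eval (fun p => ((B p.1 p.2.1 p.2.2 : ℝ) : ℂ)) P = 0) :
    ∀ B ∈ RepVariety g n ℂ, eval (fun p => B p.1 p.2.1 p.2.2) P = 0 := by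
  have hTR : T ∈ RepVariety g n ℝ := by
    obtain ⟨ρ, j, _, _, rfl⟩ := hT
    exact T_rep _
  have hQ : ∀ k : Fin g, ∀ B ∈ RepVariety g n ℂ, QQ (B (k, false)) (B (k, true)) ≠ 0 → eval (fun p => B p.1 p.2.1 p.2.2) P = 0 := by
    intro k B hB hQB
    obtain ⟨i, hi⟩ := exists_other hg k
    obtain ⟨B0, hB0, hQ0⟩ := D_real hn T hTR i k hi (T_triv hn T hT i k hi)
    exact F_main hn T P hP k B0 hB0 hQ0 B hB hQB
  refine G6_main hg hn P ?_
  rintro B hB ⟨i, hi⟩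
  obtain ⟨k, hk⟩ := exists_other hg i
  exact D_cplx hn P k (hQ k) B hB i hk.symm hi
end H8
end PartH8

/-- The Hitchin component is Zariski-dense in `Hom(Γ_g, SL_n(ℂ))`: every complex polynomial
in the `2g·n²` coordinates vanishing on `HIT_n` (embedded in `ℂ^{2g·n²}`) vanishes on all of
`Hom(Γ_g, SL_n(ℂ))`. -/
theorem Hitchin_zariski_dense_complex (g n : ℕ) (hg : 2 ≤ g) (hn : 2 ≤ n)
    (T : (Fin g × Bool) → Matrix (Fin n) (Fin n) ℝ) (hT : IsTeichmuller g n T)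
    (P : MvPolynomial ((Fin g × Bool) × Fin n × Fin n) ℂ)
    (hP : ∀ A ∈ HIT g n T,
      MvPolynomial.eval (fun p => ((A p.1 p.2.1 p.2.2 : ℝ) : ℂ)) P = 0) :
    ∀ B ∈ RepVariety g n ℂ, MvPolynomial.eval (fun p => B p.1 p.2.1 p.2.2) P = 0 := by
  exact final_main hg hn T hT P hP
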